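/- Let β and b satisfy hypotheses (i)–(iii). Then for each u0 ∈ L¹(ℝ^d) ∩ L^∞(ℝ^d), the nonlinear Fokker–Planck equation ∂_t u − Δβ(u) + div(b(x,u)u) = 0 with initial datum u0 has exactly one distributional solution u satisfying u ∈ L^∞((0,T); L¹(ℝ^d)) and u ∈ L^∞((0,T)×ℝ^d) for every T > 0. -/

import Mathlib

open MeasureTheory Filter Set

noncomputable section

/-- The Laplacian of a function on `ℝ^d` (sum of second partial derivatives). -/
noncomputable def lap {d : ℕ} (f : EuclideanSpace ℝ (Fin d) → ℝ)
    (x : EuclideanSpace ℝ (Fin d)) : ℝ :=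
  ∑ i, fderiv ℝ (fun y => fderiv ℝ f y (EuclideanSpace.single i 1)) x
    (EuclideanSpace.single i 1)

/-- Hypothesis (i): `β(0) = 0`, `β ∈ C¹(ℝ)`, and strong monotonicity with constant `γ0 > 0`. -/
def HypBeta (β : ℝ → ℝ) (γ0 : ℝ) : Prop :=
  β 0 = 0 ∧ ContDiff ℝ 1 β ∧ 0 < γ0 ∧
    ∀ r1 r2 : ℝ, γ0 * (r1 - r2) ^ 2 ≤ (β r1 - β r2) * (r1 - r2)

/-- Hypothesis (ii) on the drift `b : ℝ^d × ℝ → ℝ^d`: `b` is `C¹`, bounded, `b(x,0) = 0`,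
`∂_r b` is bounded on `ℝ^d × [-M,M]` for every `M > 0`, and
`δ(r) = sup_x |∇_x b(x,r)|` is a bounded continuous function of `r`. -/
def HypB {d : ℕ} (b : EuclideanSpace ℝ (Fin d) → ℝ → EuclideanSpace ℝ (Fin d)) : Prop :=
  ContDiff ℝ 1 (fun p : EuclideanSpace ℝ (Fin d) × ℝ => b p.1 p.2) ∧
  (∃ C, ∀ x r, ‖b x r‖ ≤ C) ∧
  (∀ x, b x 0 = 0) ∧
  (∀ M > (0 : ℝ), ∃ C, ∀ x r, |r| ≤ M → ‖deriv (fun s => b x s) r‖ ≤ C) ∧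
  (∃ δb : ℝ → ℝ, Continuous δb ∧ (∃ C, ∀ r, δb r ≤ C) ∧
    ∀ r, IsLUB (range fun x => ‖fderiv ℝ (fun y => b y r) x‖) (δb r))

/-- `u` is a distributional (Schwartz sense) solution of
`∂_t u − Δβ(u) + div(b(x,u)u) = 0`, `u(0) = u0`:
each `u(t)` is in `L¹`, `t ↦ u(t,x)dx` is narrowly continuous, the weak formulation holds
against all test functions `φ ∈ C_c^∞((0,∞) × ℝ^d)`, and the initial condition holds a.e. -/
def IsDistSol {d : ℕ} (β : ℝ → ℝ) (b : EuclideanSpace ℝ (Fin d) → ℝ → EuclideanSpace ℝ (Fin d))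
    (u0 : EuclideanSpace ℝ (Fin d) → ℝ) (u : ℝ → EuclideanSpace ℝ (Fin d) → ℝ) : Prop :=
  (∀ t, 0 ≤ t → Integrable (u t)) ∧
  (∀ ψ : EuclideanSpace ℝ (Fin d) → ℝ, Continuous ψ → (∃ C, ∀ x, |ψ x| ≤ C) →
    ∀ s, 0 ≤ s →
      Tendsto (fun t => ∫ x, u t x * ψ x) (nhdsWithin s (Ici 0))
        (nhds (∫ x, u s x * ψ x))) ∧
  (∀ φ : ℝ → EuclideanSpace ℝ (Fin d) → ℝ,
    ContDiff ℝ (⊤ : ℕ∞) (Function.uncurry φ) →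
    HasCompactSupport (Function.uncurry φ) →
    (∀ p ∈ tsupport (Function.uncurry φ), 0 < p.1) →
    (∫ t in Ioi (0 : ℝ), ∫ x,
      (u t x * deriv (fun s => φ s x) t
        + β (u t x) * lap (φ t) x
        + u t x * fderiv ℝ (φ t) x (b x (u t x)))) = 0) ∧
  (∀ᵐ x, u 0 x = u0 x)

/-- `u ∈ L^∞((0,T); L¹(ℝ^d))`. -/
def BddL1 {d : ℕ} (T : ℝ) (u : ℝ → EuclideanSpace ℝ (Fin d) → ℝ) : Prop :=
  ∃ C, ∀ t ∈ Ioo 0 T, (∫ x, |u t x|) ≤ C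

/-- `u ∈ L^∞((0,T) × ℝ^d)`. -/
def BddLinfty {d : ℕ} (T : ℝ) (u : ℝ → EuclideanSpace ℝ (Fin d) → ℝ) : Prop :=
  ∃ C, ∀ᵐ p ∂((volume.restrict (Ioo 0 T)).prod
      (volume : Measure (EuclideanSpace ℝ (Fin d)))), |u p.1 p.2| ≤ C

/-- Hypothesis (iii): `Φ(r) = β(r)/r` (with `Φ(0) = β'(0)`) is of class `C²`. -/
def HypPhi (β : ℝ → ℝ) : Prop :=
  ∃ Φ : ℝ → ℝ, ContDiff ℝ 2 Φ ∧ Φ 0 = deriv β 0 ∧ ∀ r : ℝ, r ≠ 0 → Φ r = β r / r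

namespace FP
set_option linter.unusedSectionVars false
set_option linter.unusedVariables false

open scoped InnerProductSpace Topology

section ode
variable {H : Type*} [NormedAddCommGroup H] [InnerProductSpace ℝ H] [CompleteSpace H]

/-- Picard map -/
def pic (S : H → H) (l : ℝ) (u0 : H) (a : ℝ → H) (t : ℝ) : H :=
  Real.exp (-l * t) • (u0 + ∫ s in (0:ℝ)..t, (l * Real.exp (l * s)) • S (a (max s 0)))

lemma pic_integrand_cont {S : H → H} (hS : Continuous S) {l : ℝ} {a : ℝ → H}
    (ha : ContinuousOn a (Ici 0)) :
    Continuous fun s : ℝ => (l * Real.exp (l * s)) • S (a (max s 0)) := by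
  have : Continuous fun s : ℝ => a (max s 0) :=
    ha.comp_continuous (by fun_prop) (fun x => mem_Ici.2 (le_max_right _ _))
  exact Continuous.smul (by fun_prop) (hS.comp this)

lemma pic_deriv {S : H → H} (hS : Continuous S) {l : ℝ} {u0 : H} {a : ℝ → H}
    (ha : ContinuousOn a (Ici 0)) (t : ℝ) :
    HasDerivAt (pic S l u0 a) (l • (S (a (max t 0)) - pic S l u0 a t)) t := by
  have h1 := intervalIntegral.integral_hasDerivAt_right
    ((pic_integrand_cont hS (l := l) ha).intervalIntegrable 0 t)
    (pic_integrand_cont hS (l := l) ha).stronglyMeasurable.stronglyMeasurableAtFilter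
    (pic_integrand_cont hS (l := l) ha).continuousAt
  have h2 : HasDerivAt (fun t : ℝ => Real.exp (-l * t)) (Real.exp (-l * t) * (-l)) t := by
    have := ((hasDerivAt_id t).const_mul (-l)).exp
    simpa using this
  have h3 := h2.smul (h1.const_add u0)
  refine HasDerivAt.congr_deriv (f := pic S l u0 a) h3 ?_
  unfold pic
  rw [smul_smul]
  have : Real.exp (-l * t) * (l * Real.exp (l * t)) = l := by
    rw [mul_comm l, ← mul_assoc, ← Real.exp_add]; simp
  rw [this]
  module

lemma pic_zero (S : H → H) (l : ℝ) (u0 : H) (a : ℝ → H) : pic S l u0 a 0 = u0 := by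
  simp [pic]

lemma pic_est {S : H → H} {K : ℝ} (hK : 0 ≤ K) (hS : ∀ x y, ‖S x - S y‖ ≤ K * ‖x - y‖)
    (hSc : Continuous S)
    {l k : ℝ} (hl : 0 < l) (hk : 0 < k) (hkl : l * K ≤ k)
    {u0 : H} {a c : ℝ → H} (ha : ContinuousOn a (Ici 0)) (hc : ContinuousOn c (Ici 0)) {D : ℝ}
    (hD : 0 ≤ D)
    (h : ∀ t, 0 ≤ t → ‖a t - c t‖ ≤ D * Real.exp (2 * k * t)) (t : ℝ) (ht : 0 ≤ t) :
    ‖pic S l u0 a t - pic S l u0 c t‖ ≤ D / 2 * Real.exp (2 * k * t) := by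
  have e1 : pic S l u0 a t - pic S l u0 c t = Real.exp (-l * t) •
      ∫ s in (0:ℝ)..t, ((l * Real.exp (l * s)) • S (a (max s 0)) -
        (l * Real.exp (l * s)) • S (c (max s 0))) := by
    rw [intervalIntegral.integral_sub ((pic_integrand_cont hSc ha).intervalIntegrable _ _)
      ((pic_integrand_cont hSc hc).intervalIntegrable _ _), smul_sub]
    simp only [pic, smul_add]; abel
  rw [e1, norm_smul, Real.norm_of_nonneg (Real.exp_pos _).le]
  have e2 : ‖∫ s in (0:ℝ)..t, ((l * Real.exp (l * s)) • S (a (max s 0)) -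
        (l * Real.exp (l * s)) • S (c (max s 0)))‖ ≤
      ∫ s in (0:ℝ)..t, Real.exp (l * t) * (k * D * Real.exp (2 * k * s)) := by
    apply intervalIntegral.norm_integral_le_of_norm_le ht
    · filter_upwards with s hs
      rw [← smul_sub, norm_smul, max_eq_left hs.1.le]
      rw [Real.norm_of_nonneg (by positivity)]
      have h1 : Real.exp (l * s) ≤ Real.exp (l * t) := by
        apply Real.exp_le_exp.2; exact mul_le_mul_of_nonneg_left hs.2 hl.le
      calc l * Real.exp (l * s) * ‖S (a s) - S (c s)‖
          ≤ l * Real.exp (l * s) * (K * (D * Real.exp (2 * k * s))) := by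
            gcongr
            exact (hS _ _).trans (by gcongr; exact h s hs.1.le)
        _ = Real.exp (l * s) * ((l * K) * D * Real.exp (2 * k * s)) := by ring
        _ ≤ _ := by gcongr
    · exact Continuous.intervalIntegrable (by fun_prop) _ _
  have e3 : ∫ s in (0:ℝ)..t, Real.exp (l * t) * (k * D * Real.exp (2 * k * s)) =
      Real.exp (l * t) * (D / 2 * (Real.exp (2 * k * t) - 1)) := by
    rw [intervalIntegral.integral_eq_sub_of_hasDerivAt
      (f := fun s => Real.exp (l * t) * (D / 2 * Real.exp (2 * k * s)))]
    · simp; ring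
    · intro s _
      have := ((((hasDerivAt_id s).const_mul (2 * k)).exp).const_mul (D / 2)).const_mul
        (Real.exp (l * t))
      refine HasDerivAt.congr_deriv this ?_
      simp only [id]
      ring
    · exact Continuous.intervalIntegrable (by fun_prop) _ _
  rw [e3] at e2
  calc _ ≤ Real.exp (-l * t) * (Real.exp (l * t) * (D / 2 * (Real.exp (2 * k * t) - 1))) := by
        gcongr
    _ = D / 2 * (Real.exp (2 * k * t) - 1) := by
        rw [← mul_assoc, ← Real.exp_add]; simp
    _ ≤ _ := by nlinarith

theorem ode_inv {S : H → H} {K : ℝ} (hK : 0 ≤ K) (hS : ∀ x y, ‖S x - S y‖ ≤ K * ‖x - y‖)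
    {l : ℝ} (hl : 0 < l) {ι : Type*} (g : ι → H) (ρ ρ' : ι → ℝ → ℝ)
    (hρ : ∀ i t, HasDerivAt (ρ i) (ρ' i t) t) (hρ' : ∀ i, Continuous (ρ' i)) (u0 : H)
    (h0 : ∀ i, ⟪g i, u0⟫_ℝ ≤ ρ i 0) (h00 : ∀ i t, 0 ≤ t → ρ i 0 ≤ ρ i t)
    (hinv : ∀ t, 0 ≤ t → ∀ x, (∀ i, ⟪g i, x⟫_ℝ ≤ ρ i t) → ∀ i, ⟪g i, S x⟫_ℝ ≤ ρ i t + l⁻¹ * ρ' i t) :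
    ∃ u : ℝ → H, u 0 = u0 ∧ (∀ t, 0 ≤ t → HasDerivAt u (l • (S (u t) - u t)) t) ∧
      ∀ t, 0 ≤ t → ∀ i, ⟪g i, u t⟫_ℝ ≤ ρ i t := by
  have hSc : Continuous S := by
    have : LipschitzWith ⟨K, hK⟩ S := LipschitzWith.of_dist_le_mul fun x y => by
      rw [dist_eq_norm, dist_eq_norm]; exact hS x y
    exact this.continuous
  set k : ℝ := l * K + 1 with hkdef
  have hk : 0 < k := by positivity
  have hkl : l * K ≤ k := by linarith
  let c : ℕ → ℝ → H := fun n => (pic S l u0)^[n] (fun _ => u0)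
  have hc0 : c 0 = fun _ => u0 := rfl
  have hcs : ∀ n, c (n+1) = pic S l u0 (c n) := fun n => Function.iterate_succ_apply' _ _ _
  have hcc : ∀ n, ContinuousOn (c n) (Ici 0) := by
    intro n
    induction n with
    | zero => rw [hc0]; exact continuousOn_const
    | succ n ih =>
      rw [hcs]
      exact fun t _ => (pic_deriv hSc ih t).continuousAt.continuousWithinAt
  -- step estimate
  obtain ⟨D, hD, hbase⟩ : ∃ D, 0 ≤ D ∧ ∀ t, 0 ≤ t → ‖c 0 t - c 1 t‖ ≤ D * Real.exp (2 * k * t) := by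
    refine ⟨‖S u0 - u0‖, norm_nonneg _, fun t ht => ?_⟩
    have e : c 1 t = u0 + (1 - Real.exp (-l * t)) • (S u0 - u0) := by
      rw [hcs 0, hc0]
      unfold pic
      have : ∫ s in (0:ℝ)..t, (l * Real.exp (l * s)) • S u0 = (Real.exp (l * t) - 1) • S u0 := by
        rw [intervalIntegral.integral_smul_const]
        congr 1
        rw [intervalIntegral.integral_eq_sub_of_hasDerivAt (f := fun s => Real.exp (l * s))]
        · simp
        · intro s _
          have := (((hasDerivAt_id s).const_mul l).exp)
          refine HasDerivAt.congr_deriv this ?_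
          simp only [id]
          ring
        · exact Continuous.intervalIntegrable (by fun_prop) _ _
      rw [this, smul_add, smul_smul, mul_sub, ← Real.exp_add]
      simp only [neg_mul, neg_add_cancel, Real.exp_zero, mul_one]
      module
    rw [e, hc0]
    have h1 : Real.exp (-l * t) ≤ 1 := Real.exp_le_one_iff.2 (by nlinarith)
    have h2 := Real.exp_pos (-l * t)
    have h3 : 1 ≤ Real.exp (2 * k * t) := Real.one_le_exp (by positivity)
    rw [sub_add_cancel_left, norm_neg, norm_smul, Real.norm_of_nonneg (by linarith), mul_comm]
    gcongr
    linarith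
  have hstep : ∀ n t, 0 ≤ t → ‖c n t - c (n+1) t‖ ≤ D / 2 ^ n * Real.exp (2 * k * t) := by
    intro n
    induction n with
    | zero => simpa using hbase
    | succ n ih =>
      intro t ht
      rw [hcs n, hcs (n+1)]
      have := pic_est (u0 := u0) hK hS hSc hl hk hkl (hcc n) (hcc (n+1)) (by positivity) ih t ht
      rw [pow_succ, ← div_div]
      exact this
  have hlim : ∀ t, ∃ x, 0 ≤ t → Tendsto (fun n => c n t) atTop (𝓝 x) := by
    intro t
    by_cases ht : 0 ≤ t
    · have : CauchySeq (fun n => c n t) := by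
        apply cauchySeq_of_le_geometric_two (C := 2 * D * Real.exp (2 * k * t))
        intro n
        rw [dist_eq_norm]
        refine (hstep n t ht).trans (le_of_eq ?_)
        field_simp
      obtain ⟨x, hx⟩ := cauchySeq_tendsto_of_complete this
      exact ⟨x, fun _ => hx⟩
    · exact ⟨0, fun h => absurd h ht⟩
  choose v hv using hlim
  have hvc : ∀ n t, 0 ≤ t → ‖c n t - v t‖ ≤ (2 * D) / 2 ^ n * Real.exp (2 * k * t) := by
    intro n t ht
    have := dist_le_of_le_geometric_two_of_tendsto (C := 2 * D * Real.exp (2 * k * t))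
      (f := fun n => c n t) (a := v t) (fun n => by
        rw [dist_eq_norm]
        refine (hstep n t ht).trans (le_of_eq ?_)
        field_simp) (hv t ht) n
    rw [dist_eq_norm] at this
    refine this.trans (le_of_eq ?_)
    ring
  have hvcont : ContinuousOn v (Ici 0) := by
    have : TendstoLocallyUniformlyOn c v atTop (Ici 0) := by
      rw [Metric.tendstoLocallyUniformlyOn_iff]
      intro e he t ht
      refine ⟨Iio (t+1) ∩ Ici 0, inter_mem (mem_nhdsWithin_of_mem_nhds (Iio_mem_nhds (by linarith)))
        self_mem_nhdsWithin, ?_⟩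
      have hz : Tendsto (fun n : ℕ => (2 * D) * (1/2) ^ n * Real.exp (2 * k * (t+1))) atTop (𝓝 0) := by
        have := ((tendsto_pow_atTop_nhds_zero_of_lt_one (r := (1/2:ℝ)) (by norm_num)
          (by norm_num)).const_mul (2 * D)).mul_const (Real.exp (2 * k * (t+1)))
        simpa using this
      filter_upwards [hz.eventually (gt_mem_nhds he)] with n hn y hy
      rw [dist_comm, dist_eq_norm]
      refine (hvc n y hy.2).trans_lt (lt_of_le_of_lt ?_ hn)
      have : Real.exp (2 * k * y) ≤ Real.exp (2 * k * (t+1)) :=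
        Real.exp_le_exp.2 (by have := hy.1; simp only [mem_Iio] at this; gcongr)
      rw [one_div, inv_pow, div_eq_mul_inv]
      gcongr
    exact this.continuousOn (Frequently.of_forall hcc)
  have hfix : ∀ t, 0 ≤ t → pic S l u0 v t = v t := by
    intro t ht
    refine tendsto_nhds_unique (f := fun n => c (n+1) t) ?_ ((hv t ht).comp (tendsto_add_atTop_nat 1))
    rw [tendsto_iff_norm_sub_tendsto_zero]
    have hz : Tendsto (fun n : ℕ => (2 * D) / 2 ^ n / 2 * Real.exp (2 * k * t)) atTop (𝓝 0) := by
      have := (((tendsto_pow_atTop_nhds_zero_of_lt_one (r := (1/2:ℝ)) (by norm_num)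
          (by norm_num)).const_mul (2 * D)).div_const 2).mul_const (Real.exp (2 * k * t))
      simpa [div_eq_mul_inv] using this
    refine squeeze_zero (fun _ => norm_nonneg _) (fun n => ?_) hz
    rw [hcs]
    exact pic_est hK hS hSc hl hk hkl (hcc n) hvcont (by positivity) (hvc n) t ht
  have hcinv : ∀ n t, 0 ≤ t → ∀ i, ⟪g i, c n t⟫_ℝ ≤ ρ i t := by
    intro n
    induction n with
    | zero => intro t ht i; exact (h0 i).trans (h00 i t ht)
    | succ n ih =>
      intro t ht i
      have hint := (pic_integrand_cont hSc (l := l) (hcc n)).intervalIntegrable (μ := volume) 0 t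
      rw [hcs]
      unfold pic
      rw [inner_smul_right, inner_add_right]
      have e1 : ⟪g i, ∫ s in (0:ℝ)..t, (l * Real.exp (l * s)) • S (c n (max s 0))⟫_ℝ
          = ∫ s in (0:ℝ)..t, ⟪g i, (l * Real.exp (l * s)) • S (c n (max s 0))⟫_ℝ :=
        ((innerSL ℝ (g i)).intervalIntegral_comp_comm hint).symm
      have hρc : Continuous (ρ i) := continuous_iff_continuousAt.2 fun t => (hρ i t).continuousAt
      have e2 : ∫ s in (0:ℝ)..t, ⟪g i, (l * Real.exp (l * s)) • S (c n (max s 0))⟫_ℝ ≤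
          ∫ s in (0:ℝ)..t, (l * Real.exp (l * s) * ρ i s + Real.exp (l * s) * ρ' i s) := by
        apply intervalIntegral.integral_mono_on ht
        · exact (continuous_const.inner (pic_integrand_cont hSc (hcc n))).intervalIntegrable _ _
        · exact Continuous.intervalIntegrable (by have := hρ' i; fun_prop) _ _
        · intro s hs
          rw [inner_smul_right, max_eq_left hs.1]
          have := hinv s hs.1 _ (ih s hs.1) i
          calc _ ≤ l * Real.exp (l * s) * (ρ i s + l⁻¹ * ρ' i s) := by gcongr
            _ = _ := by field_simp
      have e3 : ∫ s in (0:ℝ)..t, (l * Real.exp (l * s) * ρ i s + Real.exp (l * s) * ρ' i s) =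
          Real.exp (l * t) * ρ i t - ρ i 0 := by
        rw [intervalIntegral.integral_eq_sub_of_hasDerivAt (f := fun s => Real.exp (l * s) * ρ i s)]
        · simp
        · intro s _
          have := (((hasDerivAt_id s).const_mul l).exp).mul (hρ i s)
          refine HasDerivAt.congr_deriv this ?_
          simp only [id]
          ring
        · exact Continuous.intervalIntegrable (by have := hρ' i; fun_prop) _ _
      rw [e1]
      calc Real.exp (-l * t) * (⟪g i, u0⟫_ℝ + _)
          ≤ Real.exp (-l * t) * (ρ i 0 + (Real.exp (l * t) * ρ i t - ρ i 0)) := by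
            gcongr
            · exact h0 i
            · exact e2.trans e3.le
        _ = Real.exp (-l * t) * Real.exp (l * t) * ρ i t := by ring
        _ = ρ i t := by rw [← Real.exp_add]; simp
  refine ⟨pic S l u0 v, pic_zero _ _ _ _, fun t ht => ?_, fun t ht i => ?_⟩
  · have := pic_deriv (u0 := u0) (l := l) hSc hvcont t
    rw [max_eq_left ht] at this
    rwa [← hfix t ht] at this
  · rw [hfix t ht]
    have : Tendsto (fun n => ⟪g i, c n t⟫_ℝ) atTop (𝓝 ⟪g i, v t⟫_ℝ) :=
      (continuous_const.inner continuous_id).tendsto _ |>.comp (hv t ht)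
    exact le_of_tendsto' this fun n => hcinv n t ht i
end ode

end FP

namespace FP
set_option linter.unusedSectionVars false
set_option linter.unusedVariables false

open scoped InnerProductSpace Topology

section abs
variable {H : Type*} [NormedAddCommGroup H] [InnerProductSpace ℝ H] {ι : Type*} [Fintype ι]

/-- limiting data -/
structure Dat (H : Type*) [NormedAddCommGroup H] [InnerProductSpace ℝ H] (ι : Type*) where
  J : H →L[ℝ] H
  T : ι → H →L[ℝ] H
  f : H → H
  b : ι → H → H
  γ : ℝ
  L : ℝ
  Jsymm : ∀ x y, ⟪J x, y⟫_ℝ = ⟪x, J y⟫_ℝ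
  Jle : ∀ x, ‖J x‖ ^ 2 ≤ ⟪x, J x⟫_ℝ
  Tle : ∀ i x, ‖T i x‖ ^ 2 ≤ ⟪x, J x⟫_ℝ
  Jdense : DenseRange J
  γpos : 0 < γ
  Lnonneg : 0 ≤ L
  fmono : ∀ x y, γ * ‖x - y‖ ^ 2 ≤ ⟪f x - f y, x - y⟫_ℝ
  flip : ∀ x y, ‖f x - f y‖ ≤ L * ‖x - y‖
  blip : ∀ i x y, ‖b i x - b i y‖ ≤ L * ‖x - y‖
  f0 : f 0 = 0
  b0 : ∀ i, b i 0 = 0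

/-- approximating operators -/
structure Apx (𝒟 : Dat H ι) (C h : ℝ) where
  A : H →L[ℝ] H
  D : ι → H →L[ℝ] H
  V : H →L[ℝ] H
  Asymm : ∀ x y, ⟪A x, y⟫_ℝ = ⟪x, A y⟫_ℝ
  Dsymm : ∀ i x y, ⟪D i x, y⟫_ℝ = - ⟪x, D i y⟫_ℝ
  Vsymm : ∀ x y, ⟪V x, y⟫_ℝ = ⟪x, V y⟫_ℝ
  Vneg : ∀ x, ⟪V x, x⟫_ℝ ≤ 0
  Qsymm : ∀ x y, ⟪x, A (𝒟.J y) - (y - 𝒟.J y)⟫_ℝ = ⟪A (𝒟.J x) - (x - 𝒟.J x), y⟫_ℝ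
  Qle : ∀ x, ‖A (𝒟.J x) - (x - 𝒟.J x)‖ ^ 2 ≤ C * h ^ 2 * ⟪A x, x⟫_ℝ
  DJ : ∀ i x, ‖D i (𝒟.J x) - 𝒟.T i x‖ ≤ C * h * ‖x‖
  VJ : ∀ x, ‖V (𝒟.J x)‖ ≤ C * h * ‖x‖
  Dle : ∀ i x, ‖D i x‖ ^ 2 ≤ C * ⟪A x, x⟫_ℝ
  Apos : ∀ x, 0 ≤ ⟪A x, x⟫_ℝ
  Af : ∀ x, 𝒟.γ * ⟪A x, x⟫_ℝ ≤ ⟪A (𝒟.f x), x⟫_ℝ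
  Aff : ∀ x, ⟪A (𝒟.f x), 𝒟.f x⟫_ℝ ≤ 𝒟.L ^ 2 * ⟪A x, x⟫_ℝ

variable (𝒟 : Dat H ι)

/-- limit form -/
def Dat.G (u w : H) : ℝ := - ⟪𝒟.f u, w - 𝒟.J w⟫_ℝ + ∑ i, ⟪𝒟.b i u, 𝒟.T i w⟫_ℝ

variable {𝒟}

/-- approximate field -/
def Apx.F {C h : ℝ} (a : Apx 𝒟 C h) (u : H) : H :=
  - a.A (𝒟.f u) - ∑ i, a.D i (𝒟.b i u) + a.V u

lemma Dat.fn (𝒟 : Dat H ι) (x : H) : ‖𝒟.f x‖ ≤ 𝒟.L * ‖x‖ := by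
  simpa [𝒟.f0] using 𝒟.flip x 0

lemma Dat.bn (𝒟 : Dat H ι) (i : ι) (x : H) : ‖𝒟.b i x‖ ≤ 𝒟.L * ‖x‖ := by
  simpa [𝒟.b0] using 𝒟.blip i x 0

lemma Dat.JJ (𝒟 : Dat H ι) (x : H) : 0 ≤ ⟪x, 𝒟.J x⟫_ℝ := (sq_nonneg _).trans (𝒟.Jle x)

/-- constant -/
def Dat.k1 (𝒟 : Dat H ι) : ℝ := (Fintype.card ι + 1) * 𝒟.L

lemma Dat.k1_nonneg (𝒟 : Dat H ι) : 0 ≤ 𝒟.k1 := mul_nonneg (by positivity) 𝒟.Lnonneg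

lemma Dat.Gdiff (𝒟 : Dat H ι) (u v : H) :
    2 * (𝒟.G u (u - v) - 𝒟.G v (u - v)) ≤ - (3 / 2 * 𝒟.γ) * ‖u - v‖ ^ 2
      + 2 * 𝒟.k1 ^ 2 / 𝒟.γ * ⟪u - v, 𝒟.J (u - v)⟫_ℝ := by
  set w := u - v with hw
  set s := Real.sqrt ⟪w, 𝒟.J w⟫_ℝ with hs
  have hs2 : s ^ 2 = ⟪w, 𝒟.J w⟫_ℝ := Real.sq_sqrt (𝒟.JJ w)
  have hs0 : 0 ≤ s := Real.sqrt_nonneg _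
  have hJ : ‖𝒟.J w‖ ≤ s := Real.le_sqrt_of_sq_le (𝒟.Jle w)
  have hT : ∀ i, ‖𝒟.T i w‖ ≤ s := fun i => Real.le_sqrt_of_sq_le (𝒟.Tle i w)
  have e : 𝒟.G u w - 𝒟.G v w = - ⟪𝒟.f u - 𝒟.f v, w⟫_ℝ + ⟪𝒟.f u - 𝒟.f v, 𝒟.J w⟫_ℝ
      + ∑ i, ⟪𝒟.b i u - 𝒟.b i v, 𝒟.T i w⟫_ℝ := by
    simp only [Dat.G, inner_sub_left, inner_sub_right, Finset.sum_sub_distrib]; ring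
  have h1 := 𝒟.fmono u v
  have h2 : ⟪𝒟.f u - 𝒟.f v, 𝒟.J w⟫_ℝ ≤ 𝒟.L * ‖w‖ * s :=
    (real_inner_le_norm _ _).trans (mul_le_mul (𝒟.flip u v) hJ (norm_nonneg _)
      (mul_nonneg 𝒟.Lnonneg (norm_nonneg _)))
  have h3 : ∑ i, ⟪𝒟.b i u - 𝒟.b i v, 𝒟.T i w⟫_ℝ ≤ ∑ _i : ι, 𝒟.L * ‖w‖ * s :=
    Finset.sum_le_sum fun i _ => (real_inner_le_norm _ _).trans (mul_le_mul (𝒟.blip i u v) (hT i)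
      (norm_nonneg _) (mul_nonneg 𝒟.Lnonneg (norm_nonneg _)))
  rw [Finset.sum_const, Finset.card_univ, nsmul_eq_mul] at h3
  rw [e, ← hs2]
  have h4 : 𝒟.L * ‖w‖ * s + Fintype.card ι * (𝒟.L * ‖w‖ * s) = 𝒟.k1 * s * ‖w‖ := by
    unfold Dat.k1; ring
  have hγ := 𝒟.γpos
  have h5 : 2 * (𝒟.k1 * s * ‖w‖) ≤ 𝒟.γ / 2 * ‖w‖ ^ 2 + 2 * 𝒟.k1 ^ 2 / 𝒟.γ * s ^ 2 := by
    have : 0 ≤ (𝒟.γ * ‖w‖ - 2 * (𝒟.k1 * s)) ^ 2 / (2 * 𝒟.γ) := by positivity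
    have e2 : (𝒟.γ * ‖w‖ - 2 * (𝒟.k1 * s)) ^ 2 / (2 * 𝒟.γ) = 𝒟.γ / 2 * ‖w‖ ^ 2
      + 2 * 𝒟.k1 ^ 2 / 𝒟.γ * s ^ 2 - 2 * (𝒟.k1 * s * ‖w‖) := by field_simp; ring
    linarith
  linarith

/-- error size -/
def Apx.e {C h : ℝ} (a : Apx 𝒟 C h) (u : H) : ℝ :=
  (C + 1) * 𝒟.L * Real.sqrt ⟪a.A u, u⟫_ℝ + (𝒟.k1 + 1) * C * ‖u‖

lemma Apx.FJ {C h : ℝ} (hC : 0 ≤ C) (hh : 0 ≤ h) (a : Apx 𝒟 C h) (u w : H) :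
    |⟪a.F u, 𝒟.J w⟫_ℝ - 𝒟.G u w| ≤ h * a.e u * ‖w‖ := by
  have e : ⟪a.F u, 𝒟.J w⟫_ℝ - 𝒟.G u w = - ⟪a.A (𝒟.J (𝒟.f u)) - (𝒟.f u - 𝒟.J (𝒟.f u)), w⟫_ℝ
      + ∑ i, ⟪𝒟.b i u, a.D i (𝒟.J w) - 𝒟.T i w⟫_ℝ + ⟪u, a.V (𝒟.J w)⟫_ℝ := by
    rw [← a.Qsymm]
    unfold Apx.F Dat.G
    simp only [inner_add_left, inner_sub_left, inner_neg_left, a.Asymm, a.Vsymm, sum_inner,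
      a.Dsymm, inner_sub_right, Finset.sum_sub_distrib, Finset.sum_neg_distrib]
    ring
  rw [e]
  have hL := 𝒟.Lnonneg
  set A := ⟪a.A u, u⟫_ℝ with hA
  have h1 : |⟪a.A (𝒟.J (𝒟.f u)) - (𝒟.f u - 𝒟.J (𝒟.f u)), w⟫_ℝ| ≤
      h * ((C + 1) * 𝒟.L * Real.sqrt A) * ‖w‖ := by
    refine (abs_real_inner_le_norm _ _).trans ?_
    gcongr
    refine (pow_le_pow_iff_left₀ (norm_nonneg _) (by positivity) two_ne_zero).1 ?_
    refine (a.Qle _).trans ?_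
    rw [mul_pow, mul_pow, mul_pow, Real.sq_sqrt (a.Apos u)]
    have h2 := a.Aff u
    calc C * h ^ 2 * ⟪a.A (𝒟.f u), 𝒟.f u⟫_ℝ ≤ (C + 1) ^ 2 * h ^ 2 * (𝒟.L ^ 2 * A) := by
          gcongr
          · exact a.Apos _
          · nlinarith
      _ = _ := by ring
  have h2 : |∑ i, ⟪𝒟.b i u, a.D i (𝒟.J w) - 𝒟.T i w⟫_ℝ| ≤
      ∑ _i : ι, (𝒟.L * ‖u‖) * (C * h * ‖w‖) := by
    refine (Finset.abs_sum_le_sum_abs _ _).trans (Finset.sum_le_sum fun i _ => ?_)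
    refine (abs_real_inner_le_norm _ _).trans ?_
    gcongr
    · exact 𝒟.bn i u
    · exact a.DJ i w
  rw [Finset.sum_const, Finset.card_univ, nsmul_eq_mul] at h2
  have h3 : |⟪u, a.V (𝒟.J w)⟫_ℝ| ≤ ‖u‖ * (C * h * ‖w‖) := by
    refine (abs_real_inner_le_norm _ _).trans ?_
    gcongr
    exact a.VJ w
  have h4 := abs_add_three (-⟪a.A (𝒟.J (𝒟.f u)) - (𝒟.f u - 𝒟.J (𝒟.f u)), w⟫_ℝ)
    (∑ i, ⟪𝒟.b i u, a.D i (𝒟.J w) - 𝒟.T i w⟫_ℝ) (⟪u, a.V (𝒟.J w)⟫_ℝ)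
  rw [abs_neg] at h4
  have h5 : h * a.e u * ‖w‖ = h * ((C + 1) * 𝒟.L * Real.sqrt A) * ‖w‖ +
     Fintype.card ι * ((𝒟.L * ‖u‖) * (C * h * ‖w‖)) + ‖u‖ * (C * h * ‖w‖)
     + 𝒟.L * ‖u‖ * (C * h * ‖w‖) := by
    unfold Apx.e Dat.k1; ring
  have h6 : 0 ≤ 𝒟.L * ‖u‖ * (C * h * ‖w‖) := by positivity
  linarith

lemma Apx.e_sq {C h : ℝ} (hC : 0 ≤ C) (a : Apx 𝒟 C h) (u : H) :
    a.e u ^ 2 ≤ 2 * ((C + 1) * (𝒟.k1 + 1) ) ^ 2 * ((𝒟.L + 1) ^ 2) * (⟪a.A u, u⟫_ℝ + ‖u‖ ^ 2) := by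
  have hL := 𝒟.Lnonneg
  have hk := 𝒟.k1_nonneg
  have h1 := Real.sq_sqrt (a.Apos u)
  have h3 := a.Apos u
  set s := Real.sqrt ⟪a.A u, u⟫_ℝ
  have hs : 0 ≤ s := Real.sqrt_nonneg _
  rw [← h1]
  have h2 : a.e u ≤ ((C + 1) * (𝒟.k1 + 1) * (𝒟.L + 1)) * (s + ‖u‖) := by
    unfold Apx.e
    have e1 : (C + 1) * 𝒟.L * s ≤ (C + 1) * (𝒟.k1 + 1) * (𝒟.L + 1) * s := by
      gcongr ?_ * s
      calc (C + 1) * 𝒟.L ≤ (C + 1) * 1 * (𝒟.L + 1) := by nlinarith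
        _ ≤ _ := by gcongr; linarith
    have e2 : (𝒟.k1 + 1) * C * ‖u‖ ≤ (C + 1) * (𝒟.k1 + 1) * (𝒟.L + 1) * ‖u‖ := by
      gcongr ?_ * ‖u‖
      calc (𝒟.k1 + 1) * C ≤ (C + 1) * (𝒟.k1 + 1) * 1 := by nlinarith
        _ ≤ _ := by gcongr; linarith
    linarith
  have h0 : 0 ≤ a.e u := by unfold Apx.e; positivity
  calc a.e u ^ 2 ≤ (((C + 1) * (𝒟.k1 + 1) * (𝒟.L + 1)) * (s + ‖u‖)) ^ 2 := by gcongr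
    _ = ((C + 1) * (𝒟.k1 + 1) * (𝒟.L + 1)) ^ 2 * (s + ‖u‖) ^ 2 := by ring
    _ ≤ ((C + 1) * (𝒟.k1 + 1) * (𝒟.L + 1)) ^ 2 * (2 * (s ^ 2 + ‖u‖ ^ 2)) := by
      gcongr; exact add_sq_le
    _ = _ := by ring

/-- constant -/
def Dat.k2 (𝒟 : Dat H ι) (C : ℝ) : ℝ := (𝒟.k1 ^ 2 * (C + 1)) / 𝒟.γ

lemma Apx.energy {C h : ℝ} (hC : 0 ≤ C) (a : Apx 𝒟 C h) (u : H) :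
    2 * ⟪a.F u, u⟫_ℝ ≤ - 𝒟.γ * ⟪a.A u, u⟫_ℝ + 𝒟.k2 C * ‖u‖ ^ 2 := by
  have hγ := 𝒟.γpos
  have hL := 𝒟.Lnonneg
  set s := Real.sqrt ⟪a.A u, u⟫_ℝ with hs
  have hs2 : s ^ 2 = ⟪a.A u, u⟫_ℝ := Real.sq_sqrt (a.Apos u)
  have hs0 : 0 ≤ s := Real.sqrt_nonneg _
  set c := Real.sqrt C
  have hc2 : c ^ 2 = C := Real.sq_sqrt hC
  have hc0 : 0 ≤ c := Real.sqrt_nonneg _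
  have h1 := a.Af u
  have h2 := a.Vneg u
  have h3 : ∑ i, ⟪𝒟.b i u, a.D i u⟫_ℝ ≤ ∑ _i : ι, (𝒟.L * ‖u‖) * (c * s) := by
    refine Finset.sum_le_sum fun i _ => (real_inner_le_norm _ _).trans ?_
    gcongr
    · exact 𝒟.bn i u
    · refine (pow_le_pow_iff_left₀ (norm_nonneg _) (by positivity) two_ne_zero).1 ?_
      rw [mul_pow, hc2, hs2]; exact a.Dle i u
  rw [Finset.sum_const, Finset.card_univ, nsmul_eq_mul] at h3
  have e : ⟪a.F u, u⟫_ℝ = - ⟪a.A (𝒟.f u), u⟫_ℝ + ∑ i, ⟪𝒟.b i u, a.D i u⟫_ℝ + ⟪a.V u, u⟫_ℝ := by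
    unfold Apx.F
    simp only [inner_add_left, inner_sub_left, inner_neg_left, sum_inner,
      a.Dsymm, Finset.sum_neg_distrib]
    ring
  have h4 : Fintype.card ι * ((𝒟.L * ‖u‖) * (c * s)) ≤ 𝒟.k1 * c * ‖u‖ * s := by
    have e2 : 𝒟.k1 * c * ‖u‖ * s = Fintype.card ι * ((𝒟.L * ‖u‖) * (c * s)) +
      𝒟.L * c * ‖u‖ * s := by
      unfold Dat.k1; ring
    have : 0 ≤ 𝒟.L * c * ‖u‖ * s := by positivity
    linarith
  have h5 : 2 * (𝒟.k1 * c * ‖u‖ * s) ≤ 𝒟.γ * s ^ 2 + 𝒟.k1 ^ 2 * c ^ 2 / 𝒟.γ * ‖u‖ ^ 2 := by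
    have : 0 ≤ (𝒟.γ * s - 𝒟.k1 * c * ‖u‖) ^ 2 / 𝒟.γ := by positivity
    have e2 : (𝒟.γ * s - 𝒟.k1 * c * ‖u‖) ^ 2 / 𝒟.γ = 𝒟.γ * s ^ 2
       + 𝒟.k1 ^ 2 * c ^ 2 / 𝒟.γ * ‖u‖ ^ 2 - 2 * (𝒟.k1 * c * ‖u‖ * s) := by field_simp; ring
    linarith
  have h6 : 𝒟.k1 ^ 2 * c ^ 2 / 𝒟.γ * ‖u‖ ^ 2 ≤ 𝒟.k2 C * ‖u‖ ^ 2 := by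
    unfold Dat.k2; gcongr; rw [hc2]; linarith
  rw [← hs2] at h1 ⊢
  rw [e]
  linarith

/-- constant -/
def Dat.k3 (𝒟 : Dat H ι) (C : ℝ) : ℝ :=
  2 * 𝒟.k1 ^ 2 / 𝒟.γ + 4 / 𝒟.γ * (2 * ((C + 1) * (𝒟.k1 + 1) ) ^ 2 * ((𝒟.L + 1) ^ 2))

lemma Apx.pair {C h h' : ℝ} (hC : 0 ≤ C) (hh : 0 ≤ h) (hh' : 0 ≤ h')
    (a : Apx 𝒟 C h) (a' : Apx 𝒟 C h') (u v : H) :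
    2 * ⟪a.F u - a'.F v, 𝒟.J (u - v)⟫_ℝ ≤ - 𝒟.γ * ‖u - v‖ ^ 2 + 𝒟.k3 C * ⟪u - v, 𝒟.J (u - v)⟫_ℝ
      + 𝒟.k3 C * (h ^ 2 * (⟪a.A u, u⟫_ℝ + ‖u‖ ^ 2) + h' ^ 2 * (⟪a'.A v, v⟫_ℝ + ‖v‖ ^ 2)) := by
  have hγ := 𝒟.γpos
  have h1 := (abs_le.1 (a.FJ hC hh u (u - v))).2
  have h2 := (abs_le.1 (a'.FJ hC hh' v (u - v))).1
  have h3 := 𝒟.Gdiff u v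
  have h4 := a.e_sq hC u
  have h5 := a'.e_sq hC v
  have am : ∀ x y : ℝ, 2 * (x * y) ≤ 𝒟.γ / 4 * y ^ 2 + 4 / 𝒟.γ * x ^ 2 := by
    intro x y
    have : 0 ≤ (𝒟.γ * y - 4 * x) ^ 2 / (4 * 𝒟.γ) := by positivity
    have e2 : (𝒟.γ * y - 4 * x) ^ 2 / (4 * 𝒟.γ) = 𝒟.γ / 4 * y ^ 2 + 4 / 𝒟.γ * x ^ 2
        - 2 * (x * y) := by field_simp; ring
    linarith
  have h6 := am (h * a.e u) ‖u - v‖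
  have h7 := am (h' * a'.e v) ‖u - v‖
  rw [inner_sub_left]
  have hN := 𝒟.JJ (u - v)
  have pu : 0 ≤ ⟪a.A u, u⟫_ℝ + ‖u‖ ^ 2 := add_nonneg (a.Apos u) (sq_nonneg _)
  have pv : 0 ≤ ⟪a'.A v, v⟫_ℝ + ‖v‖ ^ 2 := add_nonneg (a'.Apos v) (sq_nonneg _)
  set X := (2 * ((C + 1) * (𝒟.k1 + 1) ) ^ 2 * ((𝒟.L + 1) ^ 2)) with hX
  have hX0 : 0 ≤ X := by positivity
  have q1 : 4 / 𝒟.γ * (h * a.e u) ^ 2 ≤ 𝒟.k3 C * (h ^ 2 * (⟪a.A u, u⟫_ℝ + ‖u‖ ^ 2)) := by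
    calc 4 / 𝒟.γ * (h * a.e u) ^ 2 = 4 / 𝒟.γ * (h ^ 2 * a.e u ^ 2) := by ring
      _ ≤ 4 / 𝒟.γ * (h ^ 2 * (X * (⟪a.A u, u⟫_ℝ + ‖u‖ ^ 2))) := by gcongr
      _ = (4 / 𝒟.γ * X) * (h ^ 2 * (⟪a.A u, u⟫_ℝ + ‖u‖ ^ 2)) := by ring
      _ ≤ _ := by
        gcongr
        unfold Dat.k3
        exact le_add_of_nonneg_left (by positivity)
  have q2 : 4 / 𝒟.γ * (h' * a'.e v) ^ 2 ≤ 𝒟.k3 C * (h' ^ 2 * (⟪a'.A v, v⟫_ℝ + ‖v‖ ^ 2)) := by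
    calc 4 / 𝒟.γ * (h' * a'.e v) ^ 2 = 4 / 𝒟.γ * (h' ^ 2 * a'.e v ^ 2) := by ring
      _ ≤ 4 / 𝒟.γ * (h' ^ 2 * (X * (⟪a'.A v, v⟫_ℝ + ‖v‖ ^ 2))) := by gcongr
      _ = (4 / 𝒟.γ * X) * (h' ^ 2 * (⟪a'.A v, v⟫_ℝ + ‖v‖ ^ 2)) := by ring
      _ ≤ _ := by
        gcongr
        unfold Dat.k3
        exact le_add_of_nonneg_left (by positivity)
  have q3 : 2 * 𝒟.k1 ^ 2 / 𝒟.γ * ⟪u - v, 𝒟.J (u - v)⟫_ℝ ≤ 𝒟.k3 C * ⟪u - v, 𝒟.J (u - v)⟫_ℝ := by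
    gcongr
    unfold Dat.k3
    exact le_add_of_nonneg_right (by positivity)
  linarith
end abs

/-- Gronwall with dissipation -/
lemma gron {Y Y' g : ℝ → ℝ} {K : ℝ} (hK : 0 ≤ K) (hY : ∀ t, 0 ≤ t → HasDerivAt Y (Y' t) t)
    (hg : ContinuousOn g (Ici 0)) (hg0 : ∀ t, 0 ≤ t → 0 ≤ g t)
    (h : ∀ t, 0 ≤ t → Y' t ≤ K * Y t - g t) (t : ℝ) (ht : 0 ≤ t) :
    Y t + ∫ s in (0:ℝ)..t, g s ≤ Real.exp (K * t) * Y 0 := by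
  have hgm : Continuous fun s : ℝ => g (max s 0) :=
    hg.comp_continuous (by fun_prop) (fun x => mem_Ici.2 (le_max_right _ _))
  have hc : Continuous fun s : ℝ => Real.exp (-K * s) * g (max s 0) :=
    Continuous.mul (by fun_prop) hgm
  have hZ : ∀ s, 0 ≤ s → HasDerivAt (fun s => Real.exp (-K * s) * Y s + ∫ r in (0:ℝ)..s,
      Real.exp (-K * r) * g (max r 0)) (Real.exp (-K * s) * (Y' s - K * Y s + g s)) s := by
    intro s hs
    have h1 := intervalIntegral.integral_hasDerivAt_right (hc.intervalIntegrable 0 s)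
      hc.stronglyMeasurable.stronglyMeasurableAtFilter hc.continuousAt
    have h2 := ((((hasDerivAt_id s).const_mul (-K)).exp).mul (hY s hs)).add h1
    refine HasDerivAt.congr_deriv h2 ?_
    simp only [id, max_eq_left hs]; ring
  have hanti : AntitoneOn (fun s => Real.exp (-K * s) * Y s + ∫ r in (0:ℝ)..s,
      Real.exp (-K * r) * g (max r 0)) (Ici 0) := by
    apply antitoneOn_of_deriv_nonpos (convex_Ici 0)
    · exact fun s hs => (hZ s hs).continuousAt.continuousWithinAt
    · intro s hs
      rw [interior_Ici] at hs
      exact (hZ s (le_of_lt hs)).differentiableAt.differentiableWithinAt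
    · intro s hs
      rw [interior_Ici] at hs
      have hs' := le_of_lt (mem_Ioi.1 hs)
      rw [(hZ s hs').deriv]
      have := h s hs'
      exact mul_nonpos_of_nonneg_of_nonpos (Real.exp_pos _).le (by linarith)
  have h1 := hanti (mem_Ici.2 le_rfl) (mem_Ici.2 ht) ht
  simp only [mul_zero, Real.exp_zero, one_mul, intervalIntegral.integral_same, add_zero] at h1
  have h2 : Real.exp (-K * t) * ∫ s in (0:ℝ)..t, g s ≤
      ∫ r in (0:ℝ)..t, Real.exp (-K * r) * g (max r 0) := by
    rw [← intervalIntegral.integral_const_mul]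
    apply intervalIntegral.integral_mono_on ht
    · apply ContinuousOn.intervalIntegrable
      rw [uIcc_of_le ht]
      exact (continuousOn_const.mul hg).mono Icc_subset_Ici_self
    · exact hc.intervalIntegrable _ _
    · intro s hs
      rw [max_eq_left hs.1]
      have := hg0 s hs.1
      gcongr ?_ * _
      apply Real.exp_le_exp.2
      nlinarith [hs.2]
  have h3 : Real.exp (-K * t) * (Y t + ∫ s in (0:ℝ)..t, g s) ≤ Y 0 := by
    rw [mul_add]; linarith
  have h4 : Real.exp (K * t) * (Real.exp (-K * t) * (Y t + ∫ s in (0:ℝ)..t, g s)) ≤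
    Real.exp (K * t) * Y 0 := by gcongr
  rwa [← mul_assoc, ← Real.exp_add, neg_mul, add_neg_cancel, Real.exp_zero, one_mul] at h4
end FP

namespace FP
set_option linter.unusedSectionVars false
set_option linter.unusedVariables false

open scoped InnerProductSpace Topology

section abs
variable {H : Type*} [NormedAddCommGroup H] [InnerProductSpace ℝ H] {ι : Type*} [Fintype ι]
variable {𝒟 : Dat H ι}

/-- solution of the approximate ODE -/
def Apx.IsSol {C h : ℝ} (a : Apx 𝒟 C h) (u0 : H) (u : ℝ → H) : Prop :=
  u 0 = u0 ∧ ∀ t, 0 ≤ t → HasDerivAt u (a.F (u t)) t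

lemma Dat.k2_nonneg (𝒟 : Dat H ι) {C : ℝ} (hC : 0 ≤ C) : 0 ≤ 𝒟.k2 C := by
  have := 𝒟.γpos
  unfold Dat.k2; positivity

lemma Dat.k3_nonneg (𝒟 : Dat H ι) {C : ℝ} (hC : 0 ≤ C) : 0 ≤ 𝒟.k3 C := by
  have := 𝒟.γpos
  unfold Dat.k3; positivity

lemma Apx.IsSol.cont {C h : ℝ} {a : Apx 𝒟 C h} {u0 : H} {u : ℝ → H} (hu : a.IsSol u0 u) :
    ContinuousOn u (Ici 0) := fun t ht => (hu.2 t ht).continuousAt.continuousWithinAt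

lemma Dat.fcont (𝒟 : Dat H ι) : Continuous 𝒟.f := by
  have : LipschitzWith ⟨𝒟.L, 𝒟.Lnonneg⟩ 𝒟.f := LipschitzWith.of_dist_le_mul fun x y => by
    rw [dist_eq_norm, dist_eq_norm]; exact 𝒟.flip x y
  exact this.continuous

lemma Dat.bcont (𝒟 : Dat H ι) (i : ι) : Continuous (𝒟.b i) := by
  have : LipschitzWith ⟨𝒟.L, 𝒟.Lnonneg⟩ (𝒟.b i) := LipschitzWith.of_dist_le_mul fun x y => by
    rw [dist_eq_norm, dist_eq_norm]; exact 𝒟.blip i x y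
  exact this.continuous

lemma Apx.Fcont {C h : ℝ} (a : Apx 𝒟 C h) : Continuous a.F := by
  unfold Apx.F
  have h1 := 𝒟.fcont
  have h2 := 𝒟.bcont
  fun_prop

lemma Apx.IsSol.energy_int {C h : ℝ} (hC : 0 ≤ C) {a : Apx 𝒟 C h} {u0 : H} {u : ℝ → H}
    (hu : a.IsSol u0 u) (t : ℝ) (ht : 0 ≤ t) :
    ‖u t‖ ^ 2 + ∫ s in (0:ℝ)..t, 𝒟.γ * ⟪a.A (u s), u s⟫_ℝ ≤ Real.exp (𝒟.k2 C * t) * ‖u0‖ ^ 2 := by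
  have hγ := 𝒟.γpos
  have := gron (Y := fun t => ‖u t‖ ^ 2) (Y' := fun t => 2 * ⟪u t, a.F (u t)⟫_ℝ)
    (g := fun s => 𝒟.γ * ⟪a.A (u s), u s⟫_ℝ) (𝒟.k2_nonneg hC)
    (fun t ht => (hu.2 t ht).norm_sq) ?_ ?_ ?_ t ht
  · simpa [hu.1] using this
  · exact continuousOn_const.mul ((a.A.continuous.comp_continuousOn hu.cont).inner hu.cont)
  · exact fun t _ => mul_nonneg hγ.le (a.Apos _)
  · intro t ht
    have := a.energy hC (u t)
    rw [real_inner_comm]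
    linarith

lemma cauchy {C h h' : ℝ} (hC : 0 ≤ C) (hh : 0 ≤ h) (hh' : 0 ≤ h') {a : Apx 𝒟 C h}
    {a' : Apx 𝒟 C h'} {u0 : H} {u v : ℝ → H} (hu : a.IsSol u0 u) (hv : a'.IsSol u0 v)
    (t : ℝ) (ht : 0 ≤ t) :
    ⟪u t - v t, 𝒟.J (u t - v t)⟫_ℝ + ∫ s in (0:ℝ)..t, 𝒟.γ * ‖u s - v s‖ ^ 2 ≤
      Real.exp ((𝒟.k3 C + 𝒟.k2 C + 𝒟.γ) * t) * (𝒟.k3 C / 𝒟.γ * (h ^ 2 + h' ^ 2) * ‖u0‖ ^ 2) := by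
  have hγ := 𝒟.γpos
  have hk2 := 𝒟.k2_nonneg hC
  have hk3 := 𝒟.k3_nonneg hC
  set κ := 𝒟.k3 C / 𝒟.γ with hκ
  have hκ0 : 0 ≤ κ := by positivity
  have hκγ : κ * 𝒟.γ = 𝒟.k3 C := by rw [hκ]; field_simp
  have hw : ∀ t, 0 ≤ t → HasDerivAt (fun t => u t - v t) (a.F (u t) - a'.F (v t)) t :=
    fun t ht => (hu.2 t ht).sub (hv.2 t ht)
  have hwc : ContinuousOn (fun t => u t - v t) (Ici 0) := hu.cont.sub hv.cont
  have := gron (Y := fun t => ⟪u t - v t, 𝒟.J (u t - v t)⟫_ℝ + (κ * h ^ 2) * ‖u t‖ ^ 2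
      + (κ * h' ^ 2) * ‖v t‖ ^ 2)
    (Y' := fun t => (2 * ⟪a.F (u t) - a'.F (v t), 𝒟.J (u t - v t)⟫_ℝ) +
      (κ * h ^ 2) * (2 * ⟪u t, a.F (u t)⟫_ℝ) + (κ * h' ^ 2) * (2 * ⟪v t, a'.F (v t)⟫_ℝ))
    (g := fun s => 𝒟.γ * ‖u s - v s‖ ^ 2) (K := 𝒟.k3 C + 𝒟.k2 C + 𝒟.γ) (by positivity)
    ?_ ?_ ?_ ?_ t ht
  · simp only [hu.1, hv.1, sub_self, map_zero, inner_zero_right, zero_add] at this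
    have e : κ * h ^ 2 * ‖u0‖ ^ 2 + κ * h' ^ 2 * ‖u0‖ ^ 2 = κ * (h ^ 2 + h' ^ 2) * ‖u0‖ ^ 2 := by
      ring
    rw [e] at this
    have p1 : 0 ≤ κ * h ^ 2 * ‖u t‖ ^ 2 := by positivity
    have p2 : 0 ≤ κ * h' ^ 2 * ‖v t‖ ^ 2 := by positivity
    linarith
  · intro t ht
    have h1 := (hw t ht).inner ℝ (𝒟.J.hasFDerivAt.comp_hasDerivAt t (hw t ht))
    have h2 := (hu.2 t ht).norm_sq.const_mul (κ * h ^ 2)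
    have h3 := (hv.2 t ht).norm_sq.const_mul (κ * h' ^ 2)
    refine HasDerivAt.congr_deriv ((h1.add h2).add h3) ?_
    simp only [Function.comp_apply]
    rw [← 𝒟.Jsymm (u t - v t), real_inner_comm]
    ring
  · exact continuousOn_const.mul (hwc.norm.pow 2)
  · exact fun t _ => by positivity
  · intro t ht
    have h1 := a.pair hC hh hh' a' (u t) (v t)
    have h2 := a.energy hC (u t)
    have h3 := a'.energy hC (v t)
    have h2' : (κ * h ^ 2) * (2 * ⟪u t, a.F (u t)⟫_ℝ) ≤
        (κ * h ^ 2) * (- 𝒟.γ * ⟪a.A (u t), u t⟫_ℝ + 𝒟.k2 C * ‖u t‖ ^ 2) := by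
      rw [real_inner_comm]; gcongr
    have h3' : (κ * h' ^ 2) * (2 * ⟪v t, a'.F (v t)⟫_ℝ) ≤
        (κ * h' ^ 2) * (- 𝒟.γ * ⟪a'.A (v t), v t⟫_ℝ + 𝒟.k2 C * ‖v t‖ ^ 2) := by
      rw [real_inner_comm]; gcongr
    have e2 : (κ * h ^ 2) * (- 𝒟.γ * ⟪a.A (u t), u t⟫_ℝ + 𝒟.k2 C * ‖u t‖ ^ 2) =
      - 𝒟.k3 C * h ^ 2 * ⟪a.A (u t), u t⟫_ℝ + 𝒟.k2 C * (κ * h ^ 2 * ‖u t‖ ^ 2) := by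
      rw [← hκγ]; ring
    have e3 : (κ * h' ^ 2) * (- 𝒟.γ * ⟪a'.A (v t), v t⟫_ℝ + 𝒟.k2 C * ‖v t‖ ^ 2) =
      - 𝒟.k3 C * h' ^ 2 * ⟪a'.A (v t), v t⟫_ℝ + 𝒟.k2 C * (κ * h' ^ 2 * ‖v t‖ ^ 2) := by
      rw [← hκγ]; ring
    have e4 : 𝒟.k3 C * (h ^ 2 * ‖u t‖ ^ 2) = 𝒟.γ * (κ * h ^ 2 * ‖u t‖ ^ 2) := by
      rw [← hκγ]; ring
    have e5 : 𝒟.k3 C * (h' ^ 2 * ‖v t‖ ^ 2) = 𝒟.γ * (κ * h' ^ 2 * ‖v t‖ ^ 2) := by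
      rw [← hκγ]; ring
    have hN := 𝒟.JJ (u t - v t)
    set N := ⟪u t - v t, 𝒟.J (u t - v t)⟫_ℝ
    have p1 : 0 ≤ κ * h ^ 2 * ‖u t‖ ^ 2 := by positivity
    have p2 : 0 ≤ κ * h' ^ 2 * ‖v t‖ ^ 2 := by positivity
    have p3 := mul_nonneg hk3 p1
    have p4 := mul_nonneg hk3 p2
    have p5 := mul_nonneg hk2 hN
    have p6 := mul_nonneg hγ.le hN
    linarith

variable [CompleteSpace H]

/-- representative of `G` -/
def Dat.gt (𝒟 : Dat H ι) (u : H) : H :=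
  - (𝒟.f u - 𝒟.J (𝒟.f u)) + ∑ i, (ContinuousLinearMap.adjoint (𝒟.T i)) (𝒟.b i u)

lemma Dat.G_eq (𝒟 : Dat H ι) (u w : H) : 𝒟.G u w = ⟪𝒟.gt u, w⟫_ℝ := by
  unfold Dat.G Dat.gt
  simp only [inner_add_left, inner_neg_left, inner_sub_left, sum_inner,
    ContinuousLinearMap.adjoint_inner_left, inner_sub_right, 𝒟.Jsymm]

lemma Dat.gt_cont (𝒟 : Dat H ι) : Continuous 𝒟.gt := by
  unfold Dat.gt
  have h1 := 𝒟.fcont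
  have h2 := 𝒟.bcont
  fun_prop

lemma Dat.gt_bound (𝒟 : Dat H ι) : ∃ K, 0 ≤ K ∧ ∀ u, ‖𝒟.gt u‖ ≤ K * ‖u‖ := by
  have hL := 𝒟.Lnonneg
  refine ⟨(1 + ‖𝒟.J‖) * 𝒟.L + ∑ i, ‖ContinuousLinearMap.adjoint (𝒟.T i)‖ * 𝒟.L,
    by positivity, fun u => ?_⟩
  unfold Dat.gt
  refine (norm_add_le _ _).trans ?_
  rw [add_mul, norm_neg, Finset.sum_mul]
  apply add_le_add
  · refine (norm_sub_le _ _).trans ?_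
    have h1 := 𝒟.fn u
    have h2 := (𝒟.J.le_opNorm (𝒟.f u)).trans (mul_le_mul_of_nonneg_left h1 (norm_nonneg _))
    linarith
  · refine (norm_sum_le _ _).trans (Finset.sum_le_sum fun i _ => ?_)
    refine (ContinuousLinearMap.le_opNorm _ _).trans ?_
    rw [mul_assoc]
    gcongr
    exact 𝒟.bn i u

/-- solution of the limit problem at Hilbert space level -/
def Dat.HSol (𝒟 : Dat H ι) (T : ℝ) (u0 : H) (u : ℝ → H) : Prop :=
  (∃ R, ∀ t ∈ Icc 0 T, ‖u t‖ ≤ R) ∧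
  AEStronglyMeasurable u (volume.restrict (Ioc 0 T)) ∧
  ∀ t ∈ Icc 0 T, ∀ ψ, ⟪u t, 𝒟.J ψ⟫_ℝ = ⟪u0, 𝒟.J ψ⟫_ℝ + ∫ s in (0:ℝ)..t, 𝒟.G (u s) ψ

lemma weak_lim {D : Set H} (hD : Dense D) {x : ℕ → H} {R : ℝ} (hR : ∀ n, ‖x n‖ ≤ R)
    (h : ∀ φ ∈ D, CauchySeq fun n => ⟪x n, φ⟫_ℝ) :
    ∃ y, ∀ ψ, Tendsto (fun n => ⟪x n, ψ⟫_ℝ) atTop (𝓝 ⟪y, ψ⟫_ℝ) := by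
  have hR0 : 0 ≤ R := (norm_nonneg _).trans (hR 0)
  have hc : ∀ ψ, CauchySeq fun n => ⟪x n, ψ⟫_ℝ := by
    intro ψ
    rw [Metric.cauchySeq_iff]
    intro e he
    obtain ⟨φ, hφ, hd⟩ := Metric.dense_iff.1 hD ψ (e / (4 * (R + 1))) (by positivity)
    obtain ⟨hφ, hφD⟩ := (⟨hφ, hd⟩ : φ ∈ Metric.ball ψ (e / (4 * (R + 1))) ∧ φ ∈ D)
    rw [mem_ball_iff_norm] at hφ
    obtain ⟨N, hN⟩ := Metric.cauchySeq_iff.1 (h φ hφD) (e / 2) (by positivity)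
    refine ⟨N, fun m hm n hn => ?_⟩
    have h1 := hN m hm n hn
    rw [Real.dist_eq] at h1 ⊢
    have h2 : ∀ n, |⟪x n, φ - ψ⟫_ℝ| ≤ e / 4 := by
      intro n
      refine (abs_real_inner_le_norm _ _).trans ?_
      calc ‖x n‖ * ‖φ - ψ‖ ≤ (R + 1) * (e / (4 * (R + 1))) := by
            gcongr
            linarith [hR n]
        _ = e / 4 := by field_simp
    have h3 := h2 m
    have h4 := h2 n
    rw [inner_sub_right] at h3 h4
    rw [abs_le] at h3 h4
    rw [abs_lt] at h1 ⊢
    constructor <;> linarith [h3.1, h3.2, h4.1, h4.2, h1.1, h1.2]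
  choose l hl using fun ψ => cauchySeq_tendsto_of_complete (hc ψ)
  let Λ := continuousLinearMapOfTendsto (fun n => innerSL ℝ (x n)) (f := l)
    (tendsto_pi_nhds.2 fun ψ => by simpa using hl ψ)
  refine ⟨(InnerProductSpace.toDual ℝ H).symm Λ, fun ψ => ?_⟩
  rw [InnerProductSpace.toDual_symm_apply]
  exact hl ψ

lemma eLpNorm_two_le {α : Type*} [MeasurableSpace α] {μ : Measure α} {f : α → H} (hf : MemLp f 2 μ)
    {r : ℝ} (hr : 0 ≤ r) (h : ∫ x, ‖f x‖ ^ 2 ∂μ ≤ r ^ 2) : eLpNorm f 2 μ ≤ ENNReal.ofReal r := by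
  rw [hf.eLpNorm_eq_integral_rpow_norm (by simp) (by simp)]
  apply ENNReal.ofReal_le_ofReal
  simp only [ENNReal.toReal_ofNat, Real.rpow_two]
  calc (∫ x, ‖f x‖ ^ 2 ∂μ) ^ ((2:ℝ)⁻¹) ≤ (r ^ 2) ^ ((2:ℝ)⁻¹) := by
        gcongr
    _ = r := by
      rw [← Real.rpow_natCast, ← Real.rpow_mul hr]; simp

end abs
end FP

namespace FP
set_option linter.unusedSectionVars false
set_option linter.unusedVariables false

open scoped InnerProductSpace Topology

section abs
variable {H : Type*} [NormedAddCommGroup H] [InnerProductSpace ℝ H] {ι : Type*} [Fintype ι]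
variable {𝒟 : Dat H ι} [CompleteSpace H]

lemma weak_tendsto {α : Type*} {l : Filter α} {D : Set H} (hD : Dense D) {x : α → H} {x0 : H} {R : ℝ}
    (hR : ∀ᶠ n in l, ‖x n‖ ≤ R) (hR0 : ‖x0‖ ≤ R)
    (h : ∀ φ ∈ D, Tendsto (fun n => ⟪x n, φ⟫_ℝ) l (𝓝 ⟪x0, φ⟫_ℝ)) (ψ : H) :
    Tendsto (fun n => ⟪x n, ψ⟫_ℝ) l (𝓝 ⟪x0, ψ⟫_ℝ) := by
  have hR0' : 0 ≤ R := (norm_nonneg _).trans hR0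
  rw [Metric.tendsto_nhds]
  intro e he
  obtain ⟨φ, hφ, hd⟩ := Metric.dense_iff.1 hD ψ (e / (4 * (R + 1))) (by positivity)
  obtain ⟨hφ, hφD⟩ := (⟨hφ, hd⟩ : φ ∈ Metric.ball ψ (e / (4 * (R + 1))) ∧ φ ∈ D)
  rw [mem_ball_iff_norm] at hφ
  have h2 : ∀ z : H, ‖z‖ ≤ R → |⟪z, φ - ψ⟫_ℝ| ≤ e / 4 := by
    intro z hz
    refine (abs_real_inner_le_norm _ _).trans ?_
    calc ‖z‖ * ‖φ - ψ‖ ≤ (R + 1) * (e / (4 * (R + 1))) := by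
          gcongr
          linarith
      _ = e / 4 := by field_simp
  filter_upwards [hR, (Metric.tendsto_nhds.1 (h φ hφD)) (e / 2) (by positivity)] with n hn h1
  rw [Real.dist_eq] at h1 ⊢
  have h3 := h2 _ hn
  have h4 := h2 _ hR0
  rw [inner_sub_right] at h3 h4
  rw [abs_le] at h3 h4
  rw [abs_lt] at h1 ⊢
  constructor <;> linarith [h3.1, h3.2, h4.1, h4.2, h1.1, h1.2]

lemma weak_strong {α : Type*} {l : Filter α} {x y : α → H} {x0 y0 : H} {R : ℝ}
    (hR : ∀ᶠ n in l, ‖x n‖ ≤ R)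
    (h : ∀ φ, Tendsto (fun n => ⟪x n, φ⟫_ℝ) l (𝓝 ⟪x0, φ⟫_ℝ)) (hy : Tendsto y l (𝓝 y0)) :
    Tendsto (fun n => ⟪x n, y n⟫_ℝ) l (𝓝 ⟪x0, y0⟫_ℝ) := by
  have h1 : Tendsto (fun n => ⟪x n, y n - y0⟫_ℝ) l (𝓝 0) := by
    have h2 : Tendsto (fun n => R * ‖y n - y0‖) l (𝓝 (R * 0)) := by
      refine Tendsto.const_mul _ ?_
      simpa using (hy.sub_const y0).norm
    rw [mul_zero] at h2
    refine squeeze_zero_norm' ?_ h2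
    filter_upwards [hR] with n hn
    refine (abs_real_inner_le_norm _ _).trans ?_
    gcongr
  have := h1.add (h y0)
  simpa [inner_sub_right] using this

lemma Dat.HSol.int {T : ℝ} {u0 : H} {u : ℝ → H} (hu : 𝒟.HSol T u0 u) {t : ℝ} (ht : t ∈ Icc 0 T) :
    IntervalIntegrable (fun s => 𝒟.gt (u s)) volume 0 t := by
  obtain ⟨K, hK0, hK⟩ := 𝒟.gt_bound
  obtain ⟨R, hR⟩ := hu.1
  have hR0 : 0 ≤ R := (norm_nonneg _).trans (hR t ht)
  rw [intervalIntegrable_iff_integrableOn_Ioc_of_le ht.1]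
  have hm : AEStronglyMeasurable (fun s => 𝒟.gt (u s)) (volume.restrict (Ioc 0 t)) :=
    𝒟.gt_cont.comp_aestronglyMeasurable (hu.2.1.mono_measure
      (Measure.restrict_mono (Ioc_subset_Ioc_right ht.2) le_rfl))
  refine Integrable.of_bound (C := K * R) hm ?_
  refine (ae_restrict_iff' measurableSet_Ioc).2 (Eventually.of_forall fun s hs => ?_)
  refine (hK _).trans ?_
  gcongr
  exact hR s ⟨hs.1.le, hs.2.trans ht.2⟩

lemma Dat.HSol.J_eq {T : ℝ} {u0 : H} {u : ℝ → H} (hu : 𝒟.HSol T u0 u) {t : ℝ} (ht : t ∈ Icc 0 T) :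
    𝒟.J (u t) = 𝒟.J u0 + ∫ s in (0:ℝ)..t, 𝒟.gt (u s) := by
  refine ext_inner_right ℝ fun ψ => ?_
  rw [𝒟.Jsymm, hu.2.2 t ht ψ, inner_add_left, 𝒟.Jsymm]
  congr 1
  rw [real_inner_comm]
  have := (innerSL ℝ ψ).intervalIntegral_comp_comm (hu.int ht)
  simp only [innerSL_apply_apply] at this
  rw [← this]
  refine intervalIntegral.integral_congr fun s _ => ?_
  rw [𝒟.G_eq, real_inner_comm]

lemma Dat.Jinj (𝒟 : Dat H ι) {x : H} (hx : 𝒟.J x = 0) : x = 0 := by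
  have : ∀ ψ, ⟪x, ψ⟫_ℝ = 0 := by
    intro ψ
    have h1 : (fun ψ => ⟪x, ψ⟫_ℝ) = fun _ => 0 := by
      refine Continuous.ext_on 𝒟.Jdense (by fun_prop) (by fun_prop) ?_
      rintro _ ⟨y, rfl⟩
      simp only
      rw [← 𝒟.Jsymm, hx, inner_zero_left]
    exact congrFun h1 ψ
  exact inner_self_eq_zero.1 (this x)

theorem Dat.HSol.unique {T : ℝ} {u0 : H} {u v : ℝ → H} (hu : 𝒟.HSol T u0 u) (hv : 𝒟.HSol T u0 v)
    {t : ℝ} (ht : t ∈ Icc 0 T) : u t = v t := by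
  obtain ⟨K, hK0, hK⟩ := 𝒟.gt_bound
  obtain ⟨R, hR⟩ := hu.1
  obtain ⟨R', hR'⟩ := hv.1
  have hT0 : 0 ≤ T := ht.1.trans ht.2
  have hTm : T ∈ Icc 0 T := ⟨hT0, le_rfl⟩
  set w : ℝ → H := fun t => u t - v t with hw
  set g : ℝ → H := fun t => 𝒟.gt (u t) - 𝒟.gt (v t) with hg
  set y : ℝ → H := fun t => ∫ s in (0:ℝ)..t, g s with hy
  have hgi : IntervalIntegrable g volume 0 T := (hu.int hTm).sub (hv.int hTm)
  have hJ : ∀ t ∈ Icc 0 T, 𝒟.J (w t) = y t := by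
    intro t ht
    simp only [hw, hy, map_sub, hg]
    rw [hu.J_eq ht, hv.J_eq ht, intervalIntegral.integral_sub (hu.int ht) (hv.int ht)]
    abel
  have hwR : ∀ t ∈ Icc 0 T, ‖w t‖ ≤ R + R' := fun t ht =>
    (norm_sub_le _ _).trans (add_le_add (hR t ht) (hR' t ht))
  have hR0 : 0 ≤ R + R' := (norm_nonneg _).trans (hwR t ht)
  have hgb : ∀ t ∈ Icc 0 T, ‖g t‖ ≤ K * (R + R') := fun t ht => by
    refine (norm_sub_le _ _).trans ?_
    rw [mul_add]
    exact add_le_add ((hK _).trans (mul_le_mul_of_nonneg_left (hR t ht) hK0))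
      ((hK _).trans (mul_le_mul_of_nonneg_left (hR' t ht) hK0))
  have hsub : ∀ {t}, t ∈ Icc 0 T → IntervalIntegrable g volume 0 t := fun ht =>
    (hu.int ht).sub (hv.int ht)
  have hyl : ∀ s ∈ Icc 0 T, ∀ t ∈ Icc 0 T, ‖y t - y s‖ ≤ K * (R + R') * |t - s| := by
    intro s hs t ht
    simp only [hy]
    rw [intervalIntegral.integral_interval_sub_left (hsub ht) (hsub hs)]
    refine intervalIntegral.norm_integral_le_of_norm_le_const fun r hr => hgb r ?_
    have := uIoc_subset_uIcc hr
    exact (uIcc_subset_Icc hs ht) this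
  set N : ℝ → ℝ := fun t => ⟪w t, 𝒟.J (w t)⟫_ℝ with hN
  have hNd : ∀ s ∈ Icc 0 T, ∀ t ∈ Icc 0 T, N t - N s = ⟪w t + w s, y t - y s⟫_ℝ := by
    intro s hs t ht
    simp only [hN]
    rw [hJ t ht, hJ s hs, inner_add_left, inner_sub_right, inner_sub_right]
    have : ⟪w t, y s⟫_ℝ = ⟪w s, y t⟫_ℝ := by
      rw [← hJ t ht, ← hJ s hs, ← 𝒟.Jsymm, real_inner_comm]
    rw [this]; ring
  have hNlip : LipschitzOnWith ⟨(2 * (R + R')) * (K * (R + R')), by positivity⟩ N (uIcc 0 T) := by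
    rw [uIcc_of_le hT0]
    refine LipschitzOnWith.of_dist_le_mul fun t ht s hs => ?_
    rw [Real.dist_eq, Real.dist_eq, hNd s hs t ht]
    refine (abs_real_inner_le_norm _ _).trans ?_
    change _ ≤ (2 * (R + R')) * (K * (R + R')) * |t - s|
    rw [mul_assoc]
    gcongr
    · refine (norm_add_le _ _).trans ?_
      linarith [hwR t ht, hwR s hs]
    · exact hyl s hs t ht
  have hac := hNlip.absolutelyContinuousOnInterval
  set κ := 2 * 𝒟.k1 ^ 2 / 𝒟.γ with hκ
  have hκ0 : 0 ≤ κ := by have := 𝒟.γpos; positivity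
  -- a.e. derivative
  have hder : ∀ᵐ t, t ∈ Ioo 0 T → HasDerivAt N (2 * ⟪w t, g t⟫_ℝ) t := by
    filter_upwards [hgi.ae_hasDerivAt_integral] with t hd ht
    rw [uIcc_of_le hT0] at hd
    have hti : t ∈ Icc 0 T := Ioo_subset_Icc_self ht
    have hdy : HasDerivAt y (g t) t := hd hti 0 ⟨le_rfl, hT0⟩
    have hev : ∀ᶠ s in 𝓝[≠] t, s ∈ Icc 0 T :=
      nhdsWithin_le_nhds (Icc_mem_nhds ht.1 ht.2)
    rw [hasDerivAt_iff_tendsto_slope] at hdy ⊢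
    have hwk : ∀ ψ, Tendsto (fun s => ⟪w s, ψ⟫_ℝ) (𝓝[≠] t) (𝓝 ⟪w t, ψ⟫_ℝ) := by
      refine weak_tendsto 𝒟.Jdense (R := R + R') (hev.mono fun s hs => hwR s hs) (hwR t hti) ?_
      rintro _ ⟨ψ, rfl⟩
      rw [← 𝒟.Jsymm, hJ t hti]
      have : Tendsto (fun s => ⟪y s, ψ⟫_ℝ) (𝓝[≠] t) (𝓝 ⟪y t, ψ⟫_ℝ) :=
        (((hd hti 0 ⟨le_rfl, hT0⟩).continuousAt.tendsto).mono_left nhdsWithin_le_nhds).inner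
          tendsto_const_nhds
      refine this.congr' (hev.mono fun s hs => ?_)
      simp only
      rw [← 𝒟.Jsymm, hJ s hs]
    have := weak_strong (x := fun s => w s + w t) (x0 := w t + w t) (R := 2 * (R + R'))
      (hev.mono fun s hs => (norm_add_le _ _).trans (by linarith [hwR s hs, hwR t hti]))
      (fun φ => by
        simp only [inner_add_left]
        exact (hwk φ).add_const _) hdy
    rw [inner_add_left, ← two_mul] at this
    refine this.congr' (hev.mono fun s hs => ?_)
    rw [slope_def_module, slope_def_module, inner_smul_right, hNd t hti s hs, smul_eq_mul]
  have hae : ∀ᵐ t, t ∈ Ioo 0 T → deriv N t ≤ κ * N t := by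
    filter_upwards [hder] with t hd ht
    rw [(hd ht).deriv]
    have := 𝒟.Gdiff (u t) (v t)
    rw [𝒟.G_eq, 𝒟.G_eq, ← inner_sub_left, real_inner_comm] at this
    have hγ := 𝒟.γpos
    have : 2 * ⟪w t, g t⟫_ℝ ≤ -(3 / 2 * 𝒟.γ) * ‖w t‖ ^ 2 + κ * N t := this
    nlinarith [sq_nonneg ‖w t‖, mul_nonneg hγ.le (sq_nonneg ‖w t‖)]
  -- multiply by exponential
  have hE : AbsolutelyContinuousOnInterval (fun t => Real.exp (-κ * t)) 0 t :=
    ContDiffOn.absolutelyContinuousOnInterval (by fun_prop)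
  have hac' : AbsolutelyContinuousOnInterval N 0 t := by
    refine (hNlip.mono ?_).absolutelyContinuousOnInterval
    rw [uIcc_of_le hT0, uIcc_of_le ht.1]
    exact Icc_subset_Icc_right ht.2
  have hint := (hE.fun_mul hac').integral_deriv_eq_sub
  have hw0 : w 0 = 0 := 𝒟.Jinj (by rw [hJ 0 ⟨le_rfl, hT0⟩]; simp [hy])
  have hN0 : N 0 = 0 := by simp [hN, hw0]
  have hle : ∫ x in (0:ℝ)..t, deriv (fun t => Real.exp (-κ * t) * N t) x ≤ 0 := by
    rw [intervalIntegral.integral_of_le ht.1]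
    apply integral_nonpos_of_ae
    rw [Filter.EventuallyLE, ae_restrict_iff' measurableSet_Ioc]
    have hne : ∀ᵐ s : ℝ, s ≠ T := by simp [ae_iff, measure_singleton]
    filter_upwards [hder, hae, hne] with s h1 h2 h3 hs
    have hs' : s ∈ Ioo 0 T := ⟨hs.1, lt_of_le_of_ne (hs.2.trans ht.2) h3⟩
    have hd : HasDerivAt (fun t => Real.exp (-κ * t)) (Real.exp (-κ * s) * (-κ)) s := by
      simpa using ((hasDerivAt_id s).const_mul (-κ)).exp
    have h4 := (hd.mul (h1 hs')).deriv
    have h5 := h2 hs'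
    rw [(h1 hs').deriv] at h5
    rw [show (fun t => Real.exp (-κ * t) * N t) = ((fun t => Real.exp (-κ * t)) * N) from rfl, h4]
    have := Real.exp_pos (-κ * s)
    simp only [Pi.zero_apply]
    nlinarith
  rw [hint, hN0, mul_zero, sub_zero] at hle
  have hNt : N t ≤ 0 := by
    by_contra! hc
    have := mul_pos (Real.exp_pos (-κ * t)) hc
    linarith
  have h1 := 𝒟.Jle (w t)
  have h2 : ‖𝒟.J (w t)‖ ^ 2 ≤ 0 := h1.trans hNt
  have h3 : 𝒟.J (w t) = 0 := by
    have : ‖𝒟.J (w t)‖ = 0 := by nlinarith [norm_nonneg (𝒟.J (w t))]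
    exact norm_eq_zero.1 this
  exact sub_eq_zero.1 (𝒟.Jinj h3)

theorem limit {C : ℝ} (hC : 0 ≤ C) (a : ∀ n : ℕ, Apx 𝒟 C ((1 / 2 : ℝ) ^ n)) {u0 : H} {u : ℕ → ℝ → H}
    (hu : ∀ n, (a n).IsSol u0 (u n)) :
    ∃ U : ℝ → H, (∀ t, 0 ≤ t → ∀ ψ, Tendsto (fun n => ⟪u n t, ψ⟫_ℝ) atTop (𝓝 ⟪U t, ψ⟫_ℝ)) ∧
      ∀ T, 0 ≤ T → 𝒟.HSol T u0 U := by
  have hγ := 𝒟.γpos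
  have hk2 := 𝒟.k2_nonneg hC
  have hk3 := 𝒟.k3_nonneg hC
  set κ := 𝒟.k3 C + 𝒟.k2 C + 𝒟.γ with hκ
  set E : ℝ → ℝ := fun t => Real.exp (κ * t) * (𝒟.k3 C / 𝒟.γ * ‖u0‖ ^ 2) * 2 with hE
  have hE0 : ∀ t, 0 ≤ E t := fun t => by simp only [hE]; positivity
  have hp : ∀ n : ℕ, (0:ℝ) ≤ (1 / 2 : ℝ) ^ n := fun n => by positivity
  have hca : ∀ k n m : ℕ, k ≤ n → k ≤ m → ∀ t, 0 ≤ t →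
      ⟪u n t - u m t, 𝒟.J (u n t - u m t)⟫_ℝ + ∫ s in (0:ℝ)..t, 𝒟.γ * ‖u n s - u m s‖ ^ 2 ≤
      E t * ((1 / 2 : ℝ) ^ k) ^ 2 := by
    intro k n m hn hm t ht
    refine (cauchy hC (hp n) (hp m) (hu n) (hu m) t ht).trans ?_
    have h1 : ((1 / 2 : ℝ) ^ n) ^ 2 ≤ ((1 / 2 : ℝ) ^ k) ^ 2 := by
      gcongr ?_ ^ 2
      exact pow_le_pow_of_le_one (by norm_num) (by norm_num) hn
    have h2 : ((1 / 2 : ℝ) ^ m) ^ 2 ≤ ((1 / 2 : ℝ) ^ k) ^ 2 := by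
      gcongr ?_ ^ 2
      exact pow_le_pow_of_le_one (by norm_num) (by norm_num) hm
    calc _ ≤ Real.exp (κ * t) * (𝒟.k3 C / 𝒟.γ * (((1 / 2 : ℝ) ^ k) ^ 2 + ((1 / 2 : ℝ) ^ k) ^ 2) * ‖u0‖ ^ 2) := by
          gcongr
      _ = _ := by simp only [hE]; ring
  set R : ℝ → ℝ := fun t => Real.sqrt (Real.exp (𝒟.k2 C * t) * ‖u0‖ ^ 2) with hRdef
  have hAc : ∀ n, ContinuousOn (fun s => 𝒟.γ * ⟪(a n).A (u n s), u n s⟫_ℝ) (Ici 0) := fun n =>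
    continuousOn_const.mul (((a n).A.continuous.comp_continuousOn (hu n).cont).inner (hu n).cont)
  have hR : ∀ n t, 0 ≤ t → ‖u n t‖ ≤ R t := by
    intro n t ht
    apply Real.le_sqrt_of_sq_le
    have h1 := (hu n).energy_int hC t ht
    have h2 : 0 ≤ ∫ s in (0:ℝ)..t, 𝒟.γ * ⟪(a n).A (u n s), u n s⟫_ℝ :=
      intervalIntegral.integral_nonneg ht fun s _ => mul_nonneg hγ.le ((a n).Apos _)
    linarith
  have hRmono : ∀ s t, s ≤ t → R s ≤ R t := fun s t hst => by
    simp only [hRdef]; gcongr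
  have hR0 : ∀ t, 0 ≤ R t := fun t => Real.sqrt_nonneg _
  have hex : ∀ t, ∃ y, 0 ≤ t → ∀ ψ, Tendsto (fun n => ⟪u n t, ψ⟫_ℝ) atTop (𝓝 ⟪y, ψ⟫_ℝ) := by
    intro t
    by_cases ht : 0 ≤ t
    swap
    · exact ⟨0, fun h => absurd h ht⟩
    obtain ⟨y, hy⟩ := weak_lim 𝒟.Jdense (x := fun n => u n t) (R := R t) (fun n => hR n t ht) (by
      rintro _ ⟨φ, rfl⟩
      refine cauchySeq_of_le_geometric (1 / 2) (Real.sqrt (E t) * ‖φ‖) (by norm_num) fun n => ?_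
      rw [Real.dist_eq, ← inner_sub_left, ← 𝒟.Jsymm]
      refine (abs_real_inner_le_norm _ _).trans ?_
      have h1 := hca n n (n + 1) le_rfl (Nat.le_succ n) t ht
      have h2 : 0 ≤ ∫ s in (0:ℝ)..t, 𝒟.γ * ‖u n s - u (n + 1) s‖ ^ 2 :=
        intervalIntegral.integral_nonneg ht fun s _ => by positivity
      have h3 := 𝒟.Jle (u n t - u (n + 1) t)
      have h4 : ‖𝒟.J (u n t - u (n + 1) t)‖ ≤ Real.sqrt (E t) * (1 / 2) ^ n := by
        refine (pow_le_pow_iff_left₀ (norm_nonneg _) (by positivity) two_ne_zero).1 ?_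
        rw [mul_pow, Real.sq_sqrt (hE0 t)]
        linarith
      calc _ ≤ (Real.sqrt (E t) * (1 / 2) ^ n) * ‖φ‖ := by gcongr
        _ = _ := by ring)
    exact ⟨y, fun _ => hy⟩
  choose U hU using hex
  refine ⟨U, hU, fun T hT => ?_⟩
  have hUR : ∀ t, 0 ≤ t → ‖U t‖ ≤ R t := by
    intro t ht
    have h1 := hU t ht (U t)
    have h2 : ⟪U t, U t⟫_ℝ ≤ R t * ‖U t‖ := by
      refine le_of_tendsto h1 (Eventually.of_forall fun n => ?_)
      refine (real_inner_le_norm _ _).trans ?_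
      gcongr
      exact hR n t ht
    rw [real_inner_self_eq_norm_sq] at h2
    by_contra! hc
    have := hR0 t
    nlinarith
  have hum : ∀ n, AEStronglyMeasurable (u n) (volume.restrict (Ioc 0 T)) := fun n =>
    ((hu n).cont.mono (fun x hx => hx.1.le)).aestronglyMeasurable measurableSet_Ioc
  have hulp : ∀ n, MemLp (u n) 2 (volume.restrict (Ioc 0 T)) := fun n => by
    refine MemLp.of_bound (hum n) (R T) ?_
    refine (ae_restrict_iff' measurableSet_Ioc).2 (Eventually.of_forall fun s hs => ?_)
    exact (hR n s hs.1.le).trans (hRmono _ _ hs.2)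
  have hst : ∀ᵐ s ∂(volume.restrict (Ioc 0 T)), Tendsto (fun n => u n s) atTop (𝓝 (U s)) := by
    have h1 := Lp.ae_tendsto_of_cauchy_eLpNorm (μ := volume.restrict (Ioc 0 T)) (f := u) (p := 2) hum
      (by norm_num) (B := fun n => ENNReal.ofReal ((Real.sqrt (E T / 𝒟.γ) + 1) * (1 / 2) ^ n)) ?_ ?_
    · filter_upwards [h1, ae_restrict_mem measurableSet_Ioc] with s ⟨l, hl⟩ hs
      have : l = U s := by
        refine ext_inner_right ℝ fun ψ => ?_
        exact tendsto_nhds_unique (hl.inner tendsto_const_nhds) (hU s hs.1.le ψ)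
      rwa [← this]
    · have hs : Summable fun n : ℕ => (Real.sqrt (E T / 𝒟.γ) + 1) * (1 / 2 : ℝ) ^ n :=
        (summable_geometric_two).mul_left _
      exact hs.tsum_ofReal_ne_top
    · intro k n m hn hm
      have hlt : Real.sqrt (E T / 𝒟.γ) * (1 / 2) ^ k < (Real.sqrt (E T / 𝒟.γ) + 1) * (1 / 2) ^ k := by
        gcongr; linarith
      refine lt_of_le_of_lt (eLpNorm_two_le ((hulp n).sub (hulp m)) (by positivity) ?_)
        ((ENNReal.ofReal_lt_ofReal_iff (by positivity)).2 hlt)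
      have h2 := hca k n m hn hm T hT
      have h3 := 𝒟.JJ (u n T - u m T)
      rw [intervalIntegral.integral_const_mul, intervalIntegral.integral_of_le hT] at h2
      rw [mul_pow, Real.sq_sqrt (div_nonneg (hE0 T) hγ.le), div_mul_eq_mul_div, le_div_iff₀ hγ]
      simp only [Pi.sub_apply]
      linarith
  refine ⟨⟨R T, fun t ht => (hUR t ht.1).trans (hRmono _ _ ht.2)⟩,
    aestronglyMeasurable_of_tendsto_ae atTop hum hst, fun t ht ψ => ?_⟩
  obtain ⟨K, hK0, hK⟩ := 𝒟.gt_bound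
  have hsub : volume.restrict (Ioc 0 t) ≤ volume.restrict (Ioc 0 T) :=
    Measure.restrict_mono (Ioc_subset_Ioc_right ht.2) le_rfl
  have hGc : ∀ n, ContinuousOn (fun s => 𝒟.G (u n s) ψ) (Ici 0) := fun n => by
    simp only [𝒟.G_eq]
    exact (𝒟.gt_cont.comp_continuousOn (hu n).cont).inner continuousOn_const
  have hFc : ∀ n, ContinuousOn (fun s => ⟪(a n).F (u n s), 𝒟.J ψ⟫_ℝ) (Ici 0) := fun n =>
    ((a n).Fcont.comp_continuousOn (hu n).cont).inner continuousOn_const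
  have hsubI : uIcc 0 t ⊆ Ici 0 := by rw [uIcc_of_le ht.1]; exact fun x hx => hx.1
  have hG : Tendsto (fun n => ∫ s in (0:ℝ)..t, 𝒟.G (u n s) ψ) atTop
      (𝓝 (∫ s in (0:ℝ)..t, 𝒟.G (U s) ψ)) := by
    refine intervalIntegral.tendsto_integral_filter_of_dominated_convergence
      (fun _ => K * R T * ‖ψ‖) (Eventually.of_forall fun n => ?_)
      (Eventually.of_forall fun n => ?_) (by simp) ?_
    · rw [uIoc_of_le ht.1]
      exact ((hGc n).mono (fun x hx => hx.1.le)).aestronglyMeasurable measurableSet_Ioc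
    · refine Eventually.of_forall fun s hs => ?_
      rw [uIoc_of_le ht.1] at hs
      rw [𝒟.G_eq]
      refine (abs_real_inner_le_norm _ _).trans ?_
      gcongr
      refine (hK _).trans ?_
      gcongr
      exact (hR n s hs.1.le).trans (hRmono _ _ (hs.2.trans ht.2))
    · have := (ae_restrict_iff' measurableSet_Ioc).1 hst
      filter_upwards [this] with s h1 hs
      rw [uIoc_of_le ht.1] at hs
      simp only [𝒟.G_eq]
      exact (((𝒟.gt_cont.tendsto _).comp (h1 ⟨hs.1, hs.2.trans ht.2⟩))).inner tendsto_const_nhds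
  have hFTC : ∀ n, ∫ s in (0:ℝ)..t, ⟪(a n).F (u n s), 𝒟.J ψ⟫_ℝ =
      ⟪u n t, 𝒟.J ψ⟫_ℝ - ⟪u0, 𝒟.J ψ⟫_ℝ := by
    intro n
    rw [intervalIntegral.integral_eq_sub_of_hasDerivAt (f := fun s => ⟪u n s, 𝒟.J ψ⟫_ℝ) ?_
      ((hFc n).mono hsubI).intervalIntegrable]
    · rw [(hu n).1]
    · intro s hs
      have := ((hu n).2 s (hsubI hs)).inner ℝ (hasDerivAt_const s (𝒟.J ψ))
      simpa using this
  set M := 2 * ((C + 1) * (𝒟.k1 + 1)) ^ 2 * ((𝒟.L + 1) ^ 2) with hM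
  have hM0 : 0 ≤ M := by positivity
  have hM' : ∀ n, ∀ s, 0 ≤ s → |⟪(a n).F (u n s), 𝒟.J ψ⟫_ℝ - 𝒟.G (u n s) ψ| ≤
      (1 / 2) ^ n * ‖ψ‖ * (1 + M * R s ^ 2 + M / 𝒟.γ * (𝒟.γ * ⟪(a n).A (u n s), u n s⟫_ℝ)) := by
    intro n s hs
    refine ((a n).FJ hC (hp n) (u n s) ψ).trans ?_
    have h1 := (a n).e_sq hC (u n s)
    have h2 : ‖u n s‖ ^ 2 ≤ R s ^ 2 := by gcongr; exact hR n s hs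
    have h3 : (a n).e (u n s) ≤ 1 + (a n).e (u n s) ^ 2 := by nlinarith [sq_nonneg ((a n).e (u n s) - 1)]
    have h4 := mul_le_mul_of_nonneg_left h2 hM0
    have h5 : (a n).e (u n s) ≤ 1 + M * R s ^ 2 + M / 𝒟.γ * (𝒟.γ * ⟪(a n).A (u n s), u n s⟫_ℝ) := by
      rw [← mul_assoc, div_mul_cancel₀ _ hγ.ne']
      rw [← hM, mul_add] at h1
      linarith
    calc _ = (1 / 2) ^ n * ‖ψ‖ * (a n).e (u n s) := by ring
      _ ≤ _ := by gcongr
  have herr : Tendsto (fun n => ∫ s in (0:ℝ)..t, (⟪(a n).F (u n s), 𝒟.J ψ⟫_ℝ - 𝒟.G (u n s) ψ)) atTop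
      (𝓝 0) := by
    have hz : Tendsto (fun n : ℕ => (1 / 2 : ℝ) ^ n * (‖ψ‖ * (t * (1 + M * R t ^ 2) + M / 𝒟.γ * R t ^ 2)))
        atTop (𝓝 (0 * (‖ψ‖ * (t * (1 + M * R t ^ 2) + M / 𝒟.γ * R t ^ 2)))) :=
      (tendsto_pow_atTop_nhds_zero_of_lt_one (by norm_num) (by norm_num)).mul_const _
    rw [zero_mul] at hz
    refine squeeze_zero_norm (fun n => ?_) hz
    have hi1 : IntervalIntegrable (fun s => 𝒟.γ * ⟪(a n).A (u n s), u n s⟫_ℝ) volume 0 t :=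
      ((hAc n).mono hsubI).intervalIntegrable
    have h1 := intervalIntegral.norm_integral_le_of_norm_le (μ := volume) ht.1
      (f := fun s => ⟪(a n).F (u n s), 𝒟.J ψ⟫_ℝ - 𝒟.G (u n s) ψ)
      (g := fun s => (1 / 2) ^ n * ‖ψ‖ * ((1 + M * R t ^ 2) + M / 𝒟.γ * (𝒟.γ * ⟪(a n).A (u n s), u n s⟫_ℝ)))
      (Eventually.of_forall fun s hs => by
        refine (hM' n s hs.1.le).trans ?_
        gcongr
        exact hRmono _ _ hs.2) ?_
    · refine h1.trans ?_
      rw [intervalIntegral.integral_const_mul, intervalIntegral.integral_add (by simp) (hi1.const_mul _),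
        intervalIntegral.integral_const_mul, intervalIntegral.integral_const, smul_eq_mul, sub_zero]
      have h2 : ∫ s in (0:ℝ)..t, 𝒟.γ * ⟪(a n).A (u n s), u n s⟫_ℝ ≤ R t ^ 2 := by
        have := (hu n).energy_int hC t ht.1
        simp only [hRdef]
        rw [Real.sq_sqrt (by positivity)]
        nlinarith [sq_nonneg ‖u n t‖]
      calc _ ≤ (1 / 2) ^ n * ‖ψ‖ * (t * (1 + M * R t ^ 2) + M / 𝒟.γ * R t ^ 2) := by gcongr
        _ = _ := by ring
    · exact ((intervalIntegrable_const).add (hi1.const_mul _)).const_mul _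
  have h1 := (hU t ht.1 (𝒟.J ψ))
  have h2 : Tendsto (fun n => ⟪u0, 𝒟.J ψ⟫_ℝ + (∫ s in (0:ℝ)..t, 𝒟.G (u n s) ψ) +
      ∫ s in (0:ℝ)..t, (⟪(a n).F (u n s), 𝒟.J ψ⟫_ℝ - 𝒟.G (u n s) ψ)) atTop
      (𝓝 (⟪u0, 𝒟.J ψ⟫_ℝ + (∫ s in (0:ℝ)..t, 𝒟.G (U s) ψ) + 0)) :=
    (hG.const_add _).add herr
  rw [add_zero] at h2
  refine tendsto_nhds_unique h1 (h2.congr fun n => ?_)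
  rw [intervalIntegral.integral_sub ((hFc n).mono hsubI).intervalIntegrable
    ((hGc n).mono hsubI).intervalIntegrable, hFTC]
  ring

end abs
end FP

namespace FP
set_option linter.unusedSectionVars false
set_option linter.unusedVariables false

open scoped InnerProductSpace Topology BoundedContinuousFunction FourierTransform

/-- space -/
abbrev EE (d : ℕ) := EuclideanSpace ℝ (Fin d)
/-- real L2 -/
abbrev HR (d : ℕ) := Lp ℝ 2 (volume : Measure (EE d))
/-- complex L2 -/
abbrev HC (d : ℕ) := Lp ℂ 2 (volume : Measure (EE d))

section tr
variable {d : ℕ}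

/-- translation -/
def tr {F : Type*} [NormedAddCommGroup F] [NormedSpace ℝ F] (z : EE d) :
    Lp F 2 (volume : Measure (EE d)) →ₗᵢ[ℝ] Lp F 2 (volume : Measure (EE d)) :=
  Lp.compMeasurePreservingₗᵢ ℝ (fun x => x + z) (measurePreserving_add_right volume z)

variable {F : Type*} [NormedAddCommGroup F] [NormedSpace ℝ F]

lemma tr_coe (z : EE d) (f : Lp F 2 (volume : Measure (EE d))) : tr z f =ᵐ[volume] fun x => f (x + z) :=
  Lp.coeFn_compMeasurePreserving f (measurePreserving_add_right volume z)

lemma ae_shift {p : EE d → Prop} (z : EE d) (h : ∀ᵐ x, p x) : ∀ᵐ x, p (x + z) :=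
  (measurePreserving_add_right volume z).quasiMeasurePreserving.ae h

lemma tr_cont (f : Lp F 2 (volume : Measure (EE d))) : Continuous fun z : EE d => tr z f := by
  let g : EE d → C(EE d, EE d) := fun z => ⟨fun x => x + z, by fun_prop⟩
  have hg : Continuous g := by
    refine ContinuousMap.continuous_of_continuous_uncurry _ ?_
    change Continuous fun p : EE d × EE d => p.2 + p.1
    fun_prop
  exact Continuous.compMeasurePreservingLp (continuous_const (y := f)) hg
    (fun z => measurePreserving_add_right volume z) (by simp)

lemma tr_tr_neg (z : EE d) (f : Lp F 2 (volume : Measure (EE d))) : tr z (tr (-z) f) = f := by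
  apply Lp.ext
  filter_upwards [tr_coe z (tr (-z) f), ae_shift z (tr_coe (-z) f)] with x h1 h2
  rw [h1, h2]; simp

lemma inner_tr (z : EE d) (x y : HR d) : ⟪tr z x, y⟫_ℝ = ⟪x, tr (-z) y⟫_ℝ := by
  conv_lhs => rw [← tr_tr_neg z y]
  exact LinearIsometry.inner_map_map _ _ _

/-- average of translations -/
def avg (μ : Measure (EE d)) [IsProbabilityMeasure μ] : HR d →L[ℝ] HR d :=
  LinearMap.mkContinuous
    { toFun := fun f => ∫ z, tr z f ∂μ
      map_add' := fun f g => by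
        simp only [map_add]
        exact integral_add (Integrable.of_bound (tr_cont f).aestronglyMeasurable ‖f‖ (by simp))
          (Integrable.of_bound (tr_cont g).aestronglyMeasurable ‖g‖ (by simp))
      map_smul' := fun c f => by
        simp only [map_smul, RingHom.id_apply]
        exact integral_smul _ _ } 1 (fun f => by
    simp only [LinearMap.coe_mk, AddHom.coe_mk, one_mul]
    refine (norm_integral_le_of_norm_le_const (C := ‖f‖) (by simp)).trans (by simp))

lemma tr_int (μ : Measure (EE d)) [IsProbabilityMeasure μ] (f : HR d) : Integrable (fun z => tr z f) μ :=
  Integrable.of_bound (tr_cont f).aestronglyMeasurable ‖f‖ (by simp)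

lemma avg_apply (μ : Measure (EE d)) [IsProbabilityMeasure μ] (f : HR d) :
    avg μ f = ∫ z, tr z f ∂μ := rfl

lemma inner_avg (μ : Measure (EE d)) [IsProbabilityMeasure μ] (f g : HR d) :
    ⟪avg μ f, g⟫_ℝ = ∫ z, ⟪tr z f, g⟫_ℝ ∂μ := by
  rw [avg_apply, real_inner_comm, ← integral_inner (tr_int μ f)]
  simp only [real_inner_comm]

lemma avg_symm (μ : Measure (EE d)) [IsProbabilityMeasure μ] (hμ : μ.map (fun z => -z) = μ) (f g : HR d) :
    ⟪avg μ f, g⟫_ℝ = ⟪f, avg μ g⟫_ℝ := by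
  rw [real_inner_comm (avg μ g), inner_avg, inner_avg]
  conv_lhs => rw [← hμ]
  rw [integral_map (by fun_prop)]
  · refine integral_congr_ae (Eventually.of_forall fun z => ?_)
    simp only
    rw [inner_tr, neg_neg, real_inner_comm]
  · exact ((tr_cont f).inner continuous_const).aestronglyMeasurable

lemma avg_quad (μ : Measure (EE d)) [IsProbabilityMeasure μ] (hμ : μ.map (fun z => -z) = μ) (f g : HR d) :
    ⟪f - avg μ f, g⟫_ℝ = (1 / 2) * ∫ z, ⟪tr z f - f, tr z g - g⟫_ℝ ∂μ := by
  have h1 : ∀ z, ⟪tr z f - f, tr z g - g⟫_ℝ = 2 * ⟪f, g⟫_ℝ - ⟪tr z f, g⟫_ℝ - ⟪tr z g, f⟫_ℝ := by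
    intro z
    simp only [inner_sub_left, inner_sub_right, LinearIsometry.inner_map_map]
    rw [real_inner_comm (tr z g) f]; ring
  simp only [h1]
  have i1 : ∀ f g : HR d, Integrable (fun z => ⟪tr z f, g⟫_ℝ) μ := fun f g =>
    Integrable.of_bound ((tr_cont f).inner continuous_const).aestronglyMeasurable (‖f‖ * ‖g‖)
      (Eventually.of_forall fun z => by
        refine (abs_real_inner_le_norm _ _).trans (by simp))
  have i2 : Integrable (fun z => 2 * ⟪f, g⟫_ℝ - ⟪tr z f, g⟫_ℝ) μ := (integrable_const _).sub (i1 f g)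
  rw [integral_sub i2 (i1 g f), integral_sub (integrable_const _) (i1 f g),
    ← inner_avg, ← inner_avg, integral_const, real_inner_comm f, ← avg_symm μ hμ f g, inner_sub_left]
  simp
  ring

end tr

section fourier
variable {d : ℕ}

lemma mul_memLp (σ : EE d →ᵇ ℂ) (f : HC d) : MemLp (fun x => σ x * f x) 2 volume :=
  MemLp.of_le_mul (c := ‖σ‖) (Lp.memLp f)
    (σ.continuous.aestronglyMeasurable.mul (Lp.aestronglyMeasurable f))
    (Eventually.of_forall fun x => by
      rw [norm_mul]; gcongr; exact σ.norm_coe_le_norm x)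

/-- multiplication -/
def mulF (σ : EE d →ᵇ ℂ) (f : HC d) : HC d := (mul_memLp σ f).toLp _

lemma mulF_coe (σ : EE d →ᵇ ℂ) (f : HC d) : mulF σ f =ᵐ[volume] fun x => σ x * f x :=
  (mul_memLp σ f).coeFn_toLp

/-- multiplication -/
def mulL (σ : EE d →ᵇ ℂ) : HC d →L[ℂ] HC d :=
  LinearMap.mkContinuous
    { toFun := mulF σ
      map_add' := fun f g => by
        apply Lp.ext
        filter_upwards [mulF_coe σ (f + g), mulF_coe σ f, mulF_coe σ g, Lp.coeFn_add f g,
          Lp.coeFn_add (mulF σ f) (mulF σ g)] with x h1 h2 h3 h4 h5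
        rw [h1, h4, h5]
        simp only [Pi.add_apply]
        rw [h2, h3]; ring
      map_smul' := fun c f => by
        apply Lp.ext
        filter_upwards [mulF_coe σ (c • f), mulF_coe σ f, Lp.coeFn_smul c f,
          Lp.coeFn_smul c (mulF σ f)] with x h1 h2 h3 h4
        rw [h1, h3]
        simp only [RingHom.id_apply]
        rw [h4]
        simp only [Pi.smul_apply, smul_eq_mul]
        rw [h2]; ring } ‖σ‖ (fun f => by
    refine Lp.norm_le_mul_norm_of_ae_le_mul ?_
    filter_upwards [mulF_coe σ f] with x hx
    change ‖mulF σ f x‖ ≤ _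
    rw [hx, norm_mul]
    gcongr
    exact σ.norm_coe_le_norm x)

lemma mulL_coe (σ : EE d →ᵇ ℂ) (f : HC d) : mulL σ f =ᵐ[volume] fun x => σ x * f x :=
  mulF_coe σ f

lemma mulL_add (σ τ : EE d →ᵇ ℂ) (f : HC d) : mulL (σ + τ) f = mulL σ f + mulL τ f := by
  apply Lp.ext
  filter_upwards [mulL_coe (σ + τ) f, mulL_coe σ f, mulL_coe τ f, Lp.coeFn_add (mulL σ f) (mulL τ f)]
    with x h1 h2 h3 h4
  rw [h1, h4]; simp only [Pi.add_apply, h2, h3, BoundedContinuousFunction.add_apply]; ring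

lemma mulL_sub (σ τ : EE d →ᵇ ℂ) (f : HC d) : mulL (σ - τ) f = mulL σ f - mulL τ f := by
  apply Lp.ext
  filter_upwards [mulL_coe (σ - τ) f, mulL_coe σ f, mulL_coe τ f, Lp.coeFn_sub (mulL σ f) (mulL τ f)]
    with x h1 h2 h3 h4
  rw [h1, h4]; simp only [Pi.sub_apply, h2, h3, BoundedContinuousFunction.sub_apply]; ring

lemma mulL_smul (c : ℝ) (σ : EE d →ᵇ ℂ) (f : HC d) : mulL (c • σ) f = c • mulL σ f := by
  apply Lp.ext
  filter_upwards [mulL_coe (c • σ) f, mulL_coe σ f, Lp.coeFn_smul c (mulL σ f)]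
    with x h1 h2 h4
  rw [h1, h4]; simp only [Pi.smul_apply, h2, BoundedContinuousFunction.smul_apply, Complex.real_smul]; ring

lemma mulL_mul (σ τ : EE d →ᵇ ℂ) (f : HC d) : mulL (σ * τ) f = mulL σ (mulL τ f) := by
  apply Lp.ext
  filter_upwards [mulL_coe (σ * τ) f, mulL_coe σ (mulL τ f), mulL_coe τ f]
    with x h1 h2 h3
  rw [h1, h2, h3, BoundedContinuousFunction.mul_apply]; ring

lemma mulL_one (f : HC d) : mulL 1 f = f := by
  apply Lp.ext
  filter_upwards [mulL_coe 1 f] with x h1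
  rw [h1]; simp

lemma mulL_zero (f : HC d) : mulL 0 f = 0 := by
  have := mulL_sub (0 : EE d →ᵇ ℂ) 0 f
  simpa using this

lemma mulL_sum {ι : Type*} (s : Finset ι) (σ : ι → EE d →ᵇ ℂ) (f : HC d) :
    mulL (∑ i ∈ s, σ i) f = ∑ i ∈ s, mulL (σ i) f := by
  classical
  induction s using Finset.induction_on with
  | empty => simp [mulL_zero]
  | insert a s ha ih => rw [Finset.sum_insert ha, Finset.sum_insert ha, mulL_add, ih]

lemma inner_mulL (σ : EE d →ᵇ ℂ) (f g : HC d) : ⟪mulL σ f, g⟫_ℂ = ⟪f, mulL (star σ) g⟫_ℂ := by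
  rw [L2.inner_def, L2.inner_def]
  refine integral_congr_ae ?_
  filter_upwards [mulL_coe σ f, mulL_coe (star σ) g] with x h1 h2
  rw [h1, h2]
  simp [BoundedContinuousFunction.star_apply]
  ring

lemma re_inner_mulL (σ : EE d →ᵇ ℂ) (f : HC d) :
    (⟪mulL σ f, f⟫_ℂ).re = ∫ x, (σ x).re * ‖f x‖ ^ 2 := by
  rw [L2.inner_def]
  have h1 : Integrable fun x => ⟪mulL σ f x, f x⟫_ℂ := L2.integrable_inner _ _
  have := integral_re h1
  simp only [RCLike.re_to_complex] at this
  rw [← this]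
  refine integral_congr_ae ?_
  filter_upwards [mulL_coe σ f] with x h1
  rw [h1, RCLike.inner_apply, map_mul]
  rw [mul_comm (starRingEnd ℂ (σ x)), ← mul_assoc, Complex.mul_conj, Complex.normSq_eq_norm_sq,
    Complex.re_ofReal_mul, Complex.conj_re, mul_comm]

lemma int_mulL (σ : EE d →ᵇ ℂ) (f : HC d) : Integrable fun x => (σ x).re * ‖f x‖ ^ 2 := by
  have h1 : Integrable fun x => ‖f x‖ ^ 2 := (memLp_two_iff_integrable_sq_norm (Lp.aestronglyMeasurable f)).1 (Lp.memLp f)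
  refine h1.bdd_mul (c := ‖σ‖) (Complex.continuous_re.comp σ.continuous).aestronglyMeasurable
    (Eventually.of_forall fun x => (Complex.abs_re_le_norm _).trans (σ.norm_coe_le_norm x))

lemma normsq_mulL (σ : EE d →ᵇ ℂ) (f : HC d) :
    ‖mulL σ f‖ ^ 2 = ∫ x, ‖σ x‖ ^ 2 * ‖f x‖ ^ 2 := by
  have h1 := inner_self_eq_norm_sq (𝕜 := ℂ) (mulL σ f)
  rw [← h1, inner_mulL, ← mulL_mul]
  have h2 := re_inner_mulL (star σ * σ) f
  rw [RCLike.re_to_complex, ← Complex.conj_re, inner_conj_symm, h2]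
  congr 1; ext x; congr 1
  rw [BoundedContinuousFunction.mul_apply, BoundedContinuousFunction.star_apply, mul_comm]
  change (σ x * (starRingEnd ℂ) (σ x)).re = _
  rw [Complex.mul_conj, Complex.normSq_eq_norm_sq, Complex.ofReal_re]

lemma mulL_le_quad {σ a : EE d →ᵇ ℂ} (h : ∀ ξ, ‖σ ξ‖ ^ 2 ≤ (a ξ).re) (f : HC d) :
    ‖mulL σ f‖ ^ 2 ≤ (⟪mulL a f, f⟫_ℂ).re := by
  rw [normsq_mulL, re_inner_mulL]
  refine integral_mono_of_nonneg (Eventually.of_forall fun x => by positivity) (int_mulL a f)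
    (Eventually.of_forall fun x => ?_)
  simp only
  gcongr
  exact h x

lemma mulL_le {σ : EE d →ᵇ ℂ} {C : ℝ} (hC : 0 ≤ C) (h : ∀ ξ, ‖σ ξ‖ ≤ C) (f : HC d) :
    ‖mulL σ f‖ ≤ C * ‖f‖ := by
  refine Lp.norm_le_mul_norm_of_ae_le_mul ?_
  filter_upwards [mulL_coe σ f] with x hx
  rw [hx, norm_mul]
  gcongr
  exact h x

/-- real part and embedding -/
def iC : HR d →L[ℝ] HC d := ContinuousLinearMap.compLpL 2 volume Complex.ofRealCLM
/-- real part -/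
def reC : HC d →L[ℝ] HR d := ContinuousLinearMap.compLpL 2 volume Complex.reCLM

lemma iC_coe (x : HR d) : iC x =ᵐ[volume] fun y => (x y : ℂ) := ContinuousLinearMap.coeFn_compLp _ _
lemma reC_coe (x : HC d) : reC x =ᵐ[volume] fun y => (x y).re := ContinuousLinearMap.coeFn_compLp _ _

lemma reC_iC (x : HR d) : reC (iC x) = x := by
  apply Lp.ext
  filter_upwards [reC_coe (iC x), iC_coe x] with y h1 h2
  rw [h1, h2]; simp

lemma inner_iC (x : HR d) (y : HC d) : (⟪y, iC x⟫_ℂ).re = ⟪reC y, x⟫_ℝ := by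
  rw [L2.inner_def, L2.inner_def]
  have h1 : Integrable fun z => ⟪y z, iC x z⟫_ℂ := L2.integrable_inner _ _
  have := integral_re h1
  simp only [RCLike.re_to_complex] at this
  rw [← this]
  refine integral_congr_ae ?_
  filter_upwards [reC_coe y, iC_coe x] with z h1 h2
  rw [h1, h2]; simp [mul_comm]

/-- Fourier transform of real function -/
def hat : HR d →L[ℝ] HC d :=
  ((Lp.fourierTransformₗᵢ (EE d) ℂ).toContinuousLinearEquiv.toContinuousLinearMap.restrictScalars ℝ).comp iC
/-- back -/
def back : HC d →L[ℝ] HR d :=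
  reC.comp ((Lp.fourierTransformₗᵢ (EE d) ℂ).symm.toContinuousLinearEquiv.toContinuousLinearMap.restrictScalars ℝ)

lemma hat_apply (x : HR d) : hat x = 𝓕 (iC x) := rfl

lemma back_hat (x : HR d) : back (hat x) = x := by
  change reC ((Lp.fourierTransformₗᵢ (EE d) ℂ).symm (Lp.fourierTransformₗᵢ (EE d) ℂ (iC x))) = x
  rw [LinearIsometryEquiv.symm_apply_apply, reC_iC]

lemma inner_back (y : HC d) (x : HR d) : ⟪back y, x⟫_ℝ = (⟪y, hat x⟫_ℂ).re := by
  change ⟪reC ((Lp.fourierTransformₗᵢ (EE d) ℂ).symm y), x⟫_ℝ = (⟪y, Lp.fourierTransformₗᵢ (EE d) ℂ (iC x)⟫_ℂ).re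
  rw [← inner_iC, ← LinearIsometryEquiv.inner_map_map (Lp.fourierTransformₗᵢ (EE d) ℂ),
    LinearIsometryEquiv.apply_symm_apply]

lemma inner_hat (x y : HR d) : (⟪hat x, hat y⟫_ℂ).re = ⟪x, y⟫_ℝ := by
  rw [← inner_back, back_hat]

lemma norm_hat (x : HR d) : ‖hat x‖ = ‖x‖ := by
  have h1 := inner_self_eq_norm_sq (𝕜 := ℂ) (hat x)
  rw [RCLike.re_to_complex, inner_hat, real_inner_self_eq_norm_sq] at h1
  exact ((pow_left_inj₀ (norm_nonneg _) (norm_nonneg _) two_ne_zero).1 h1).symm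

lemma norm_back (y : HC d) : ‖back y‖ ≤ ‖y‖ := by
  by_contra! hc
  have h1 := inner_back y (back y)
  rw [real_inner_self_eq_norm_sq] at h1
  have h2 : (⟪y, hat (back y)⟫_ℂ).re ≤ ‖y‖ * ‖back y‖ := by
    rw [← norm_hat (back y)]
    exact re_inner_le_norm (𝕜 := ℂ) _ _
  nlinarith [norm_nonneg y]

/-- `B` has symbol `σ` -/
def Sym (B : HR d →L[ℝ] HR d) (σ : EE d →ᵇ ℂ) : Prop := ∀ x, hat (B x) = mulL σ (hat x)

/-- multiplier operator -/
def Op (σ : EE d →ᵇ ℂ) : HR d →L[ℝ] HR d := back.comp (((mulL σ).restrictScalars ℝ).comp hat)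

lemma Op_apply (σ : EE d →ᵇ ℂ) (x : HR d) : Op σ x = back (mulL σ (hat x)) := rfl

lemma Op_right {B : HR d →L[ℝ] HR d} {σ : EE d →ᵇ ℂ} (h : Sym B σ) (τ : EE d →ᵇ ℂ) (x : HR d) :
    Op τ (B x) = Op (τ * σ) x := by
  rw [Op_apply, h x, Op_apply, mulL_mul]

lemma Op_left {B B' : HR d →L[ℝ] HR d} {σ : EE d →ᵇ ℂ} (hB : ∀ x y, ⟪B x, y⟫_ℝ = ⟪x, B' y⟫_ℝ)
    (h : Sym B' (star σ)) (τ : EE d →ᵇ ℂ) (x : HR d) :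
    B (Op τ x) = Op (σ * τ) x := by
  refine ext_inner_right ℝ fun y => ?_
  rw [hB, Op_apply, inner_back, h y, Op_apply, inner_back, mulL_mul, inner_mulL σ]

lemma Op_norm_le {σ : EE d →ᵇ ℂ} {C : ℝ} (hC : 0 ≤ C) (h : ∀ ξ, ‖σ ξ‖ ≤ C) (x : HR d) :
    ‖Op σ x‖ ≤ C * ‖x‖ := by
  rw [← norm_hat x]
  exact (norm_back _).trans (mulL_le hC h _)

lemma Op_le_quad {σ a : EE d →ᵇ ℂ} (h : ∀ ξ, ‖σ ξ‖ ^ 2 ≤ (a ξ).re) (x : HR d) :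
    ‖Op σ x‖ ^ 2 ≤ (⟪mulL a (hat x), hat x⟫_ℂ).re :=
  (pow_le_pow_left₀ (norm_nonneg _) (norm_back _) 2).trans (mulL_le_quad h _)

lemma Sym.quad {B : HR d →L[ℝ] HR d} {σ : EE d →ᵇ ℂ} (h : Sym B σ) (x : HR d) :
    (⟪mulL σ (hat x), hat x⟫_ℂ).re = ⟪B x, x⟫_ℝ := by
  rw [← h x, inner_hat]

lemma Op_quad (σ : EE d →ᵇ ℂ) (x y : HR d) : ⟪Op σ x, y⟫_ℝ = (⟪mulL σ (hat x), hat y⟫_ℂ).re := by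
  rw [Op_apply, inner_back]

lemma Sym.eq_Op {B : HR d →L[ℝ] HR d} {σ : EE d →ᵇ ℂ} (h : Sym B σ) (x : HR d) : B x = Op σ x := by
  rw [Op_apply, ← h x, back_hat]

lemma Op_symm {σ : EE d →ᵇ ℂ} (hσ : star σ = σ) (x y : HR d) : ⟪Op σ x, y⟫_ℝ = ⟪x, Op σ y⟫_ℝ := by
  rw [Op_quad, inner_mulL, hσ, real_inner_comm, Op_quad, ← Complex.conj_re, inner_conj_symm]

end fourier
end FP

namespace FP
set_option linter.unusedSectionVars false
set_option linter.unusedVariables false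

open scoped InnerProductSpace Topology BoundedContinuousFunction FourierTransform SchwartzMap

section symb
variable {d : ℕ}

lemma iC_tr (z : EE d) (x : HR d) : iC (tr z x) = tr z (iC x) := by
  apply Lp.ext
  filter_upwards [iC_coe (tr z x), tr_coe z x, tr_coe z (iC x), ae_shift z (iC_coe x)] with y h1 h2 h3 h4
  rw [h1, h2, h3, h4]

/-- bounded continuous symbol -/
abbrev bc (f : EE d → ℂ) (hf : Continuous f) (C : ℝ) (h : ∀ ξ, ‖f ξ‖ ≤ C) : EE d →ᵇ ℂ :=
  BoundedContinuousFunction.ofNormedAddCommGroup f hf C h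

/-- exponential symbol -/
def ex (z : EE d) : EE d →ᵇ ℂ :=
  bc (fun ξ => Complex.exp ((2 * Real.pi * ⟪z, ξ⟫_ℝ : ℝ) * Complex.I)) (by fun_prop) 1
    (fun ξ => by rw [Complex.norm_exp_ofReal_mul_I])

lemma ex_apply (z ξ : EE d) : ex z ξ = Complex.exp ((2 * Real.pi * ⟪z, ξ⟫_ℝ : ℝ) * Complex.I) := rfl

lemma ex_neg (z : EE d) : ex (-z) = star (ex z) := by
  ext ξ
  rw [BoundedContinuousFunction.star_apply, ex_apply, ex_apply]
  change _ = starRingEnd ℂ _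
  rw [← Complex.exp_conj, map_mul, Complex.conj_I, Complex.conj_ofReal]
  simp

lemma sym_trC (z : EE d) (f : HC d) : 𝓕 (tr z f) = mulL (ex z) (𝓕 f) := by
  have hF : Continuous fun f : HC d => (𝓕 f : HC d) := (Lp.fourierTransformₗᵢ (EE d) ℂ).continuous
  refine (SchwartzMap.denseRange_toLpCLM (E := EE d) (F := ℂ) (p := 2) (μ := volume)
    ENNReal.ofNat_ne_top).induction_on (p := fun f => 𝓕 (tr z f) = mulL (ex z) (𝓕 f)) f ?_ ?_
  · exact isClosed_eq (hF.comp (tr z).continuous) ((mulL (ex z)).continuous.comp hF)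
  · intro φ
    have h1 : tr z (φ.toLp 2 volume) = (φ.compSubConstCLM ℝ (-z)).toLp 2 volume := by
      apply Lp.ext
      filter_upwards [tr_coe z (φ.toLp 2 volume), ae_shift z (φ.coeFn_toLp 2 volume),
        (φ.compSubConstCLM ℝ (-z)).coeFn_toLp 2 volume] with x h1 h2 h3
      rw [h1, h2, h3]; simp
    change 𝓕 (tr z (φ.toLp 2 volume)) = mulL (ex z) (𝓕 (φ.toLp 2 volume))
    rw [h1, SchwartzMap.toLp_fourier_eq, SchwartzMap.toLp_fourier_eq]
    apply Lp.ext
    filter_upwards [mulL_coe (ex z) ((𝓕 φ).toLp 2 volume), (𝓕 φ).coeFn_toLp 2 volume,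
      (𝓕 (φ.compSubConstCLM ℝ (-z))).coeFn_toLp 2 volume] with ξ h2 h3 h4
    rw [h2, h3, h4, SchwartzMap.fourier_coe, SchwartzMap.fourier_coe]
    have h5 : ((φ.compSubConstCLM ℝ (-z) : 𝓢(EE d, ℂ)) : EE d → ℂ) = (φ : EE d → ℂ) ∘ fun v => v + z := by
      ext x; simp
    rw [h5]
    have := congrFun (VectorFourier.fourierIntegral_comp_add_right Real.fourierChar volume (innerₗ (EE d)) (φ : EE d → ℂ) z) ξ
    refine this.trans ?_
    rw [Circle.smul_def, smul_eq_mul, ex_apply, Real.fourierChar_apply]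
    rfl

lemma sym_tr (z : EE d) : Sym ((tr z : HR d →ₗᵢ[ℝ] HR d).toContinuousLinearMap) (ex z) := by
  intro x
  change hat (tr z x) = _
  rw [hat_apply, iC_tr, sym_trC]; rfl

lemma Sym.add {B B' : HR d →L[ℝ] HR d} {σ σ' : EE d →ᵇ ℂ} (h : Sym B σ) (h' : Sym B' σ') :
    Sym (B + B') (σ + σ') := fun x => by
  rw [mulL_add, ← h x, ← h' x, ← map_add]; rfl

lemma Sym.sub {B B' : HR d →L[ℝ] HR d} {σ σ' : EE d →ᵇ ℂ} (h : Sym B σ) (h' : Sym B' σ') :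
    Sym (B - B') (σ - σ') := fun x => by
  rw [mulL_sub, ← h x, ← h' x, ← map_sub]; rfl

lemma Sym.smul {B : HR d →L[ℝ] HR d} {σ : EE d →ᵇ ℂ} (c : ℝ) (h : Sym B σ) :
    Sym (c • B) (c • σ) := fun x => by
  rw [mulL_smul, ← h x, ← map_smul]; rfl

lemma Sym.one : Sym (1 : HR d →L[ℝ] HR d) 1 := fun x => by
  rw [mulL_one]; rfl

lemma Sym.sum {ι : Type*} (s : Finset ι) {B : ι → HR d →L[ℝ] HR d} {σ : ι → EE d →ᵇ ℂ} (h : ∀ i, Sym (B i) (σ i)) :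
    Sym (∑ i ∈ s, B i) (∑ i ∈ s, σ i) := fun x => by
  rw [mulL_sum, sum_apply, map_sum]
  exact Finset.sum_congr rfl fun i _ => h i x

lemma sym_avg (μ : Measure (EE d)) [IsProbabilityMeasure μ] (p : EE d →ᵇ ℂ)
    (hp : ∀ ξ, p ξ = ∫ z, ex z ξ ∂μ) : Sym (avg μ) p := by
  intro x
  have h1 : hat (avg μ x) = ∫ z, mulL (ex z) (hat x) ∂μ := by
    rw [avg_apply, ← ContinuousLinearMap.integral_comp_comm _ (tr_int μ x)]
    exact integral_congr_ae (Eventually.of_forall fun z => sym_tr z x)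
  have i1 : Integrable (fun z => mulL (ex z) (hat x)) μ := by
    have := ContinuousLinearMap.integrable_comp (hat (d := d)) (tr_int μ x)
    exact this.congr (Eventually.of_forall fun z => sym_tr z x)
  rw [h1]
  refine ext_inner_left ℂ fun g => ?_
  rw [← integral_inner i1, L2.inner_def]
  have h2 : Integrable (fun ξ => ⟪g ξ, hat x ξ⟫_ℂ) := L2.integrable_inner g (hat x)
  have h3 : Integrable (fun q : EE d × EE d => ex q.1 q.2 * ⟪g q.2, hat x q.2⟫_ℂ) (μ.prod volume) := by
    refine (h2.comp_snd μ).bdd_mul (c := 1) ?_ (Eventually.of_forall fun q => ?_)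
    · refine Continuous.aestronglyMeasurable ?_
      simp only [ex_apply]; fun_prop
    · rw [ex_apply, Complex.norm_exp_ofReal_mul_I]
  have h4 : ∀ z, ⟪g, mulL (ex z) (hat x)⟫_ℂ = ∫ ξ, ex z ξ * ⟪g ξ, hat x ξ⟫_ℂ := by
    intro z
    rw [L2.inner_def]
    refine integral_congr_ae ?_
    filter_upwards [mulL_coe (ex z) (hat x)] with ξ h
    rw [h]; simp [mul_assoc]
  simp only [h4]
  rw [integral_integral_swap h3]
  refine integral_congr_ae ?_
  filter_upwards [mulL_coe p (hat x)] with ξ h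
  rw [h, integral_mul_const, ← hp]; simp [mul_assoc]

/-- gaussian -/
def gm (d : ℕ) (h : ℝ) : Measure (EE d) := (ProbabilityTheory.stdGaussian (EE d)).map (fun z => (√2 * h) • z)

instance (h : ℝ) : IsProbabilityMeasure (gm d h) := Measure.isProbabilityMeasure_map (by fun_prop)

lemma gm_symm (h : ℝ) : (gm d h).map (fun z => -z) = gm d h := by
  have h1 := ProbabilityTheory.stdGaussian_map (E := EE d) (LinearIsometryEquiv.neg ℝ)
  rw [gm, Measure.map_map (by fun_prop) (by fun_prop)]
  conv_rhs => rw [← h1]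
  rw [Measure.map_map (by fun_prop) (by fun_prop)]
  congr 1
  ext z; simp

/-- gaussian symbol -/
def gs (d : ℕ) (h : ℝ) : EE d →ᵇ ℂ :=
  bc (fun ξ => ((Real.exp (-(h ^ 2 * (4 * Real.pi ^ 2 * ‖ξ‖ ^ 2))) : ℝ) : ℂ)) (by fun_prop) 1 (fun ξ => by
    rw [Complex.norm_real, Real.norm_eq_abs, Real.abs_exp, Real.exp_le_one_iff]
    have : 0 ≤ h ^ 2 * (4 * Real.pi ^ 2 * ‖ξ‖ ^ 2) := by positivity
    linarith)

lemma gs_apply (h : ℝ) (ξ : EE d) : gs d h ξ = ((Real.exp (-(h ^ 2 * (4 * Real.pi ^ 2 * ‖ξ‖ ^ 2))) : ℝ) : ℂ) := rfl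

lemma sym_gm (h : ℝ) : Sym (avg (gm d h)) (gs d h) := by
  refine sym_avg _ _ fun ξ => ?_
  have h1 := ProbabilityTheory.charFun_stdGaussian (E := EE d) ((2 * Real.pi * √2 * h) • ξ)
  rw [gm, integral_map (by fun_prop)]
  · rw [charFun_apply] at h1
    rw [gs_apply]
    simp only [ex_apply]
    have h2 : ∀ x : EE d, Complex.exp ((2 * Real.pi * ⟪(√2 * h) • x, ξ⟫_ℝ : ℝ) * Complex.I)
        = Complex.exp ((⟪x, (2 * Real.pi * √2 * h) • ξ⟫_ℝ : ℝ) * Complex.I) := by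
      intro x
      rw [inner_smul_left, inner_smul_right]; simp only [conj_trivial]; congr 3; ring
    simp only [h2]
    rw [h1, Complex.ofReal_exp]
    congr 1
    have : -‖(2 * Real.pi * √2 * h) • ξ‖ ^ 2 / 2 = -(h ^ 2 * (4 * Real.pi ^ 2 * ‖ξ‖ ^ 2)) := by
      rw [norm_smul, mul_pow, Real.norm_eq_abs, sq_abs]
      have : √2 ^ 2 = (2 : ℝ) := Real.sq_sqrt (by norm_num)
      linear_combination (-(2 * Real.pi ^2 * h ^ 2 * ‖ξ‖ ^ 2)) * this
    rw [← this]; push_cast; ring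
  · simp only [ex_apply]
    exact Continuous.aestronglyMeasurable (by fun_prop)

end symb
end FP

namespace FP
set_option linter.unusedSectionVars false
set_option linter.unusedVariables false

open scoped InnerProductSpace Topology BoundedContinuousFunction FourierTransform SchwartzMap

section scal

lemma sc_k {y : ℝ} (hy : 0 ≤ y) : 0 ≤ 1 - Real.exp (-y) ∧ 1 - Real.exp (-y) ≤ y ∧
    min 1 y ≤ 2 * (1 - Real.exp (-y)) ∧ y - (1 - Real.exp (-y)) ≤ y ^ 2 / 2 := by
  have h1 : Real.exp (-y) ≤ 1 := Real.exp_le_one_iff.2 (by linarith)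
  have h2 := Real.add_one_le_exp (-y)
  have h3 : Real.exp (-y) * Real.exp y = 1 := by rw [← Real.exp_add]; simp
  have h4 := Real.quadratic_le_exp_of_nonneg hy
  have h5 := Real.exp_pos (-y)
  have h6 : Real.exp (-y) * (1 + y + y ^ 2 / 2) ≤ 1 := (mul_le_mul_of_nonneg_left h4 h5.le).trans h3.le
  refine ⟨by linarith, by linarith, ?_, ?_⟩
  · have h7 : Real.exp (-y) * (1 + y) ≤ 1 := le_trans (mul_le_mul_of_nonneg_left (by nlinarith) h5.le) h6
    rcases le_total y 1 with h | h
    · rw [min_eq_right h]; nlinarith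
    · rw [min_eq_left h]; nlinarith
  · have h8 : 0 < 1 + y + y ^ 2 / 2 := by positivity
    have : Real.exp (-y) * (1 + y + y ^ 2 / 2) ≤ (1 - y + y ^ 2 / 2) * (1 + y + y ^ 2 / 2) := by nlinarith [sq_nonneg (y^2)]
    have := le_of_mul_le_mul_right this h8
    linarith

lemma sc_Q {h x : ℝ} (hh : 0 < h) (hx : 0 ≤ x) :
    (((1 - Real.exp (-(h ^ 2 * x))) / h ^ 2 - x) / (1 + x)) ^ 2 ≤ 2 * h ^ 2 * ((1 - Real.exp (-(h ^ 2 * x))) / h ^ 2) := by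
  obtain ⟨h1, h2, h3, h4⟩ := sc_k (y := h ^ 2 * x) (by positivity)
  set k := 1 - Real.exp (-(h ^ 2 * x)) with hk
  set y := h ^ 2 * x with hy
  have hy0 : 0 ≤ y := by positivity
  have key : (y - k) ^ 2 ≤ 2 * k * y ^ 2 := by
    rcases le_total y 1 with h | h
    · rw [min_eq_right h] at h3
      have : (y - k) ^ 2 ≤ (y ^ 2 / 2) * y := by rw [sq]; gcongr <;> linarith
      nlinarith [mul_le_mul_of_nonneg_right h3 (sq_nonneg y), pow_nonneg hy0 3]
    · rw [min_eq_left h] at h3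
      have : (y - k) ^ 2 ≤ y ^ 2 := by gcongr <;> linarith
      nlinarith [mul_le_mul_of_nonneg_right h3 (sq_nonneg y)]
  have e1 : 2 * h ^ 2 * (k / h ^ 2) = 2 * k := by field_simp
  have e2 : k / h ^ 2 - x = -(y - k) / h ^ 2 := by rw [hy]; field_simp; ring
  rw [e1, e2, div_pow, div_pow, div_le_iff₀ (by positivity), div_le_iff₀ (by positivity), neg_sq]
  refine key.trans ?_
  rw [hy, mul_pow]
  have : x ^ 2 ≤ (1 + x) ^ 2 := by gcongr; linarith
  have h5 : 0 ≤ 2 * k * (h ^ 2) ^ 2 := by positivity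
  nlinarith [mul_le_mul_of_nonneg_left this h5]

lemma sc_sin (s : ℝ) : |Real.sin s - s| ≤ 2 * s ^ 2 := by
  rcases le_total |s| 1 with h | h
  · have h1 := Real.sin_bound h
    have h2 : |Real.sin s - s| ≤ |Real.sin s - (s - s ^ 3 / 6)| + |s ^ 3 / 6| := by
      rw [show Real.sin s - s = (Real.sin s - (s - s ^ 3 / 6)) - s ^ 3 / 6 by ring]
      exact abs_sub _ _
    rw [abs_div, abs_pow] at h2
    rw [← sq_abs s]
    have h0 := abs_nonneg s
    have h3 : |s| ^ 3 ≤ |s| ^ 2 := pow_le_pow_of_le_one h0 h (by norm_num)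
    have h4 : |s| ^ 4 ≤ |s| ^ 2 := pow_le_pow_of_le_one h0 h (by norm_num)
    norm_num at h2
    nlinarith [sq_nonneg |s|]
  · have h1 : |Real.sin s - s| ≤ |Real.sin s| + |s| := abs_sub _ _
    have h2 := Real.abs_sin_le_one s
    rw [← sq_abs s]; nlinarith

lemma sc_D {h θ x : ℝ} (hh : 0 < h) (hx : θ ^ 2 ≤ x) :
    (Real.sin (h * θ) / h) ^ 2 ≤ 2 * ((1 - Real.exp (-(h ^ 2 * x))) / h ^ 2) := by
  have hx0 : 0 ≤ x := (sq_nonneg _).trans hx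
  obtain ⟨h1, h2, h3, h4⟩ := sc_k (y := h ^ 2 * x) (by positivity)
  rw [div_pow, ← mul_div_assoc]
  gcongr
  refine le_trans (le_min ?_ ?_) h3
  · exact Real.sin_sq_le_one _
  · refine (Real.sin_sq_le_sq).trans ?_
    rw [mul_pow]; gcongr

end scal

section ops
variable {d : ℕ}

/-- frequency -/
def fx (ξ : EE d) : ℝ := 4 * Real.pi ^ 2 * ‖ξ‖ ^ 2

lemma fx_nonneg (ξ : EE d) : 0 ≤ fx ξ := by unfold fx; positivity

/-- theta -/
def th (i : Fin d) (ξ : EE d) : ℝ := 2 * Real.pi * ξ i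

lemma th_sum (ξ : EE d) : ∑ i, th i ξ ^ 2 = fx ξ := by
  unfold th fx
  rw [EuclideanSpace.norm_sq_eq, Finset.mul_sum]
  refine Finset.sum_congr rfl fun i _ => ?_
  rw [Real.norm_eq_abs, sq_abs]; ring

lemma th_le (i : Fin d) (ξ : EE d) : th i ξ ^ 2 ≤ fx ξ := by
  rw [← th_sum]
  exact Finset.single_le_sum (f := fun i => th i ξ ^ 2) (fun i _ => sq_nonneg _) (Finset.mem_univ i)

/-- J symbol -/
def js (d : ℕ) : EE d →ᵇ ℂ := bc (fun ξ => (((1 + fx ξ)⁻¹ : ℝ) : ℂ))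
  (by
    refine Complex.continuous_ofReal.comp (Continuous.inv₀ (by unfold fx; fun_prop) fun ξ => ?_)
    have := fx_nonneg ξ; positivity) 1 (fun ξ => by
    have := fx_nonneg ξ
    rw [Complex.norm_real, Real.norm_eq_abs, abs_of_nonneg (by positivity)]
    exact inv_le_one_of_one_le₀ (by linarith))

lemma js_apply (ξ : EE d) : js d ξ = (((1 + fx ξ)⁻¹ : ℝ) : ℂ) := rfl

lemma ts_sq (i : Fin d) (ξ : EE d) : (th i ξ * (1 + fx ξ)⁻¹) ^ 2 ≤ (1 + fx ξ)⁻¹ := by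
  have h0 := fx_nonneg ξ
  rw [mul_pow, inv_pow, ← div_eq_mul_inv, div_le_iff₀ (by positivity)]
  have : (1 + fx ξ)⁻¹ * (1 + fx ξ) ^ 2 = 1 + fx ξ := by field_simp
  rw [this]; linarith [th_le i ξ]

/-- T symbol -/
def ts (i : Fin d) : EE d →ᵇ ℂ := bc (fun ξ => ((th i ξ * (1 + fx ξ)⁻¹ : ℝ) : ℂ) * Complex.I)
  (by
    refine (Complex.continuous_ofReal.comp (Continuous.mul ?_ (Continuous.inv₀ (by unfold fx; fun_prop) fun ξ => ?_))).mul continuous_const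
    · unfold th; fun_prop
    have := fx_nonneg ξ; positivity) 1 (fun ξ => by
    have h0 := fx_nonneg ξ
    rw [norm_mul, Complex.norm_I, mul_one, Complex.norm_real, Real.norm_eq_abs, ← sq_le_one_iff_abs_le_one]
    exact (ts_sq i ξ).trans (inv_le_one_of_one_le₀ (by linarith)))

lemma ts_apply (i : Fin d) (ξ : EE d) : ts i ξ = ((th i ξ * (1 + fx ξ)⁻¹ : ℝ) : ℂ) * Complex.I := rfl

/-- resolvent -/
def Jop (d : ℕ) : HR d →L[ℝ] HR d := Op (js d)
/-- derivative of resolvent -/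
def Top (i : Fin d) : HR d →L[ℝ] HR d := Op (ts i)

lemma star_js : star (js d) = js d := by
  ext ξ
  rw [BoundedContinuousFunction.star_apply, js_apply]
  exact Complex.conj_ofReal _

lemma Jop_symm (x y : HR d) : ⟪Jop d x, y⟫_ℝ = ⟪x, Jop d y⟫_ℝ := Op_symm star_js x y

lemma Jop_le (x : HR d) : ‖Jop d x‖ ^ 2 ≤ ⟪x, Jop d x⟫_ℝ := by
  rw [real_inner_comm]
  unfold Jop
  rw [Op_quad]
  refine Op_le_quad (fun ξ => ?_) x
  have h0 := fx_nonneg ξ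
  rw [js_apply, Complex.norm_real, Real.norm_eq_abs, sq_abs, Complex.ofReal_re]
  have h1 : (1 + fx ξ)⁻¹ ≤ 1 := inv_le_one_of_one_le₀ (by linarith)
  have h2 : 0 ≤ (1 + fx ξ)⁻¹ := by positivity
  nlinarith

lemma Top_le (i : Fin d) (x : HR d) : ‖Top i x‖ ^ 2 ≤ ⟪x, Jop d x⟫_ℝ := by
  rw [real_inner_comm]
  unfold Jop Top
  rw [Op_quad]
  refine Op_le_quad (fun ξ => ?_) x
  rw [ts_apply, js_apply, norm_mul, Complex.norm_I, mul_one, Complex.norm_real, Real.norm_eq_abs, sq_abs, Complex.ofReal_re]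
  exact ts_sq i ξ

lemma hat_inj {x : HR d} (h : hat x = 0) : x = 0 := by rw [← back_hat x, h, map_zero]

lemma Jop_dense : DenseRange (Jop d) := by
  have h1 : ((Jop d).range)ᗮ = ⊥ := by
    rw [Submodule.eq_bot_iff]
    intro y hy
    rw [Submodule.mem_orthogonal] at hy
    have h2 : ⟪Jop d y, y⟫_ℝ = 0 := hy _ ⟨y, rfl⟩
    unfold Jop at h2
    rw [Op_quad, re_inner_mulL, integral_eq_zero_iff_of_nonneg] at h2
    · apply hat_inj
      rw [Lp.eq_zero_iff_ae_eq_zero]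
      filter_upwards [h2] with ξ hξ
      have h0 := fx_nonneg ξ
      simp only [js_apply, Complex.ofReal_re, Pi.zero_apply] at hξ
      have : 0 < (1 + fx ξ)⁻¹ := by positivity
      have h3 := (mul_eq_zero.1 hξ).resolve_left this.ne'
      simpa using h3
    · intro ξ
      have h0 := fx_nonneg ξ
      simp only [js_apply, Complex.ofReal_re, Pi.zero_apply]
      positivity
    · exact int_mulL _ _
  have h2 := (Submodule.topologicalClosure_eq_top_iff (K := (Jop d).range)).2 h1
  have h3 : Dense ((Jop d).range : Set (HR d)) := Submodule.dense_iff_topologicalClosure_eq_top.2 h2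
  exact h3

lemma Op_sub (σ τ : EE d →ᵇ ℂ) (x : HR d) : Op (σ - τ) x = Op σ x - Op τ x := by
  rw [Op_apply, mulL_sub, map_sub]; rfl

lemma Op_one (x : HR d) : Op 1 x = x := by
  rw [Op_apply, mulL_one, back_hat]

/-- translation CLM -/
abbrev trL (z : EE d) : HR d →L[ℝ] HR d := (tr z : HR d →ₗᵢ[ℝ] HR d).toContinuousLinearMap

/-- diffusion -/
def Aop (d : ℕ) (h : ℝ) : HR d →L[ℝ] HR d := (h ^ 2)⁻¹ • (1 - avg (gm d h))
/-- central difference -/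
def Dop (h : ℝ) (i : Fin d) : HR d →L[ℝ] HR d :=
  (2 * h)⁻¹ • (trL (EuclideanSpace.single i h) - trL (-EuclideanSpace.single i h))
/-- viscosity -/
def Vop (d : ℕ) (κ h : ℝ) : HR d →L[ℝ] HR d :=
  (κ / h) • ∑ i, (trL (EuclideanSpace.single i h) + trL (-EuclideanSpace.single i h) - (2 : ℝ) • 1)

/-- A symbol -/
def as (d : ℕ) (h : ℝ) : EE d →ᵇ ℂ := (h ^ 2)⁻¹ • (1 - gs d h)
/-- D symbol -/
def ds (h : ℝ) (i : Fin d) : EE d →ᵇ ℂ := (2 * h)⁻¹ • (ex (EuclideanSpace.single i h) - ex (-EuclideanSpace.single i h))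
/-- V symbol -/
def vs (d : ℕ) (κ h : ℝ) : EE d →ᵇ ℂ :=
  (κ / h) • ∑ i, (ex (EuclideanSpace.single i h) + ex (-EuclideanSpace.single i h) - (2 : ℝ) • 1)

lemma sym_A (h : ℝ) : Sym (Aop d h) (as d h) := (Sym.one.sub (sym_gm h)).smul _
lemma sym_D (h : ℝ) (i : Fin d) : Sym (Dop h i) (ds h i) := ((sym_tr _).sub (sym_tr _)).smul _
lemma sym_V (κ h : ℝ) : Sym (Vop d κ h) (vs d κ h) :=
  (Sym.sum _ fun i => ((sym_tr _).add (sym_tr _)).sub (Sym.one.smul 2)).smul _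

lemma as_apply (h : ℝ) (ξ : EE d) : as d h ξ = (((1 - Real.exp (-(h ^ 2 * fx ξ))) / h ^ 2 : ℝ) : ℂ) := by
  unfold as
  rw [BoundedContinuousFunction.smul_apply, BoundedContinuousFunction.sub_apply, gs_apply, Complex.real_smul]
  unfold fx
  simp; ring

lemma inner_single (i : Fin d) (h : ℝ) (ξ : EE d) : 2 * Real.pi * ⟪(EuclideanSpace.single i h : EE d), ξ⟫_ℝ = h * th i ξ := by
  rw [EuclideanSpace.inner_single_left]; unfold th; simp; ring

lemma ds_apply {h : ℝ} (hh : 0 < h) (i : Fin d) (ξ : EE d) : ds h i ξ = ((Real.sin (h * th i ξ) / h : ℝ) : ℂ) * Complex.I := by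
  unfold ds
  rw [BoundedContinuousFunction.smul_apply, BoundedContinuousFunction.sub_apply, Complex.real_smul,
    ex_apply, ex_apply, inner_neg_left, mul_neg, inner_single, Complex.exp_mul_I, Complex.exp_mul_I]
  simp only [Complex.ofReal_neg, Complex.cos_neg, Complex.sin_neg]
  push_cast
  field_simp
  ring

lemma vs_apply (κ h : ℝ) (ξ : EE d) : vs d κ h ξ = (((κ / h) * ∑ i, (2 * Real.cos (h * th i ξ) - 2) : ℝ) : ℂ) := by
  unfold vs
  rw [BoundedContinuousFunction.smul_apply, BoundedContinuousFunction.sum_apply, Complex.real_smul]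
  simp only [BoundedContinuousFunction.sub_apply, BoundedContinuousFunction.add_apply,
    ex_apply, inner_neg_left, mul_neg, inner_single, Complex.exp_mul_I]
  simp only [Complex.ofReal_neg, Complex.cos_neg, Complex.sin_neg]
  push_cast
  congr 1
  refine Finset.sum_congr rfl fun i _ => ?_
  simp
  ring

lemma star_as (h : ℝ) : star (as d h) = as d h := by
  ext ξ
  rw [BoundedContinuousFunction.star_apply, as_apply]
  exact Complex.conj_ofReal _

lemma star_vs (κ h : ℝ) : star (vs d κ h) = vs d κ h := by
  ext ξ
  rw [BoundedContinuousFunction.star_apply, vs_apply]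
  exact Complex.conj_ofReal _

lemma Sym.symm {B : HR d →L[ℝ] HR d} {σ : EE d →ᵇ ℂ} (h : Sym B σ) (hσ : star σ = σ) (x y : HR d) :
    ⟪B x, y⟫_ℝ = ⟪x, B y⟫_ℝ := by
  rw [h.eq_Op, h.eq_Op]; exact Op_symm hσ x y

lemma Aop_symm (h : ℝ) (x y : HR d) : ⟪Aop d h x, y⟫_ℝ = ⟪x, Aop d h y⟫_ℝ := (sym_A h).symm (star_as h) x y
lemma Vop_symm (κ h : ℝ) (x y : HR d) : ⟪Vop d κ h x, y⟫_ℝ = ⟪x, Vop d κ h y⟫_ℝ := (sym_V κ h).symm (star_vs κ h) x y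

lemma Dop_apply (h : ℝ) (i : Fin d) (x : HR d) :
    Dop h i x = (2 * h)⁻¹ • (tr (EuclideanSpace.single i h) x - tr (-EuclideanSpace.single i h) x) := rfl

lemma Dop_symm (h : ℝ) (i : Fin d) (x y : HR d) : ⟪Dop h i x, y⟫_ℝ = - ⟪x, Dop h i y⟫_ℝ := by
  rw [Dop_apply, Dop_apply, inner_smul_left, inner_smul_right, inner_sub_left, inner_sub_right, inner_tr, inner_tr]
  simp only [neg_neg, conj_trivial]
  ring

lemma Vop_apply (κ h : ℝ) (x : HR d) : Vop d κ h x = (κ / h) • ∑ i : Fin d, (tr (EuclideanSpace.single i h) x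
    + tr (-EuclideanSpace.single i h) x - (2 : ℝ) • x) := by
  unfold Vop
  rw [_root_.smul_apply, _root_.sum_apply]; rfl

lemma Vop_neg {κ h : ℝ} (hκ : 0 ≤ κ) (hh : 0 < h) (x : HR d) : ⟪Vop d κ h x, x⟫_ℝ ≤ 0 := by
  rw [Vop_apply, inner_smul_left, sum_inner]
  have h1 : ∀ z : EE d, ⟪tr z x, x⟫_ℝ ≤ ⟪x, x⟫_ℝ := fun z => by
    rw [real_inner_self_eq_norm_sq, sq]
    refine (real_inner_le_norm _ _).trans (by simp)
  refine mul_nonpos_of_nonneg_of_nonpos (by simp only [conj_trivial]; positivity) (Finset.sum_nonpos fun i _ => ?_)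
  rw [inner_sub_left, inner_add_left, inner_smul_left]
  simp only [conj_trivial]
  linarith [h1 (EuclideanSpace.single i h), h1 (-EuclideanSpace.single i h)]

/-- Q symbol -/
def qs (d : ℕ) (h : ℝ) : EE d →ᵇ ℂ := as d h * js d - (1 - js d)

lemma qs_apply (h : ℝ) (ξ : EE d) : qs d h ξ = ((((1 - Real.exp (-(h ^ 2 * fx ξ))) / h ^ 2 - fx ξ) / (1 + fx ξ) : ℝ) : ℂ) := by
  unfold qs
  have h0 := fx_nonneg ξ
  have h1 : 1 + fx ξ ≠ 0 := by positivity
  rw [BoundedContinuousFunction.sub_apply, BoundedContinuousFunction.mul_apply, BoundedContinuousFunction.sub_apply,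
    as_apply, js_apply, show (1 : EE d →ᵇ ℂ) ξ = 1 from rfl, ← Complex.ofReal_one, ← Complex.ofReal_sub, ← Complex.ofReal_mul,
    ← Complex.ofReal_sub]
  congr 1
  rw [div_eq_mul_inv _ (1 + fx ξ), sub_mul _ (fx ξ)]
  congr 1
  field_simp
  ring

lemma Q_eq (h : ℝ) (x : HR d) : Aop d h (Jop d x) - (x - Jop d x) = Op (qs d h) x := by
  unfold qs Jop
  rw [Op_sub, Op_sub, Op_one, ← Op_left (Aop_symm h) (by rw [star_as]; exact sym_A h)]

lemma Q_symm (h : ℝ) (x y : HR d) :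
    ⟪x, Aop d h (Jop d y) - (y - Jop d y)⟫_ℝ = ⟪Aop d h (Jop d x) - (x - Jop d x), y⟫_ℝ := by
  rw [Q_eq, Q_eq, Op_symm]
  ext ξ
  rw [BoundedContinuousFunction.star_apply, qs_apply]
  exact Complex.conj_ofReal _

lemma Q_le {h : ℝ} (hh : 0 < h) (x : HR d) :
    ‖Aop d h (Jop d x) - (x - Jop d x)‖ ^ 2 ≤ 2 * h ^ 2 * ⟪Aop d h x, x⟫_ℝ := by
  have h1 : 2 * h ^ 2 * ⟪Aop d h x, x⟫_ℝ = (⟪mulL ((2 * h ^ 2) • as d h) (hat x), hat x⟫_ℂ).re := by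
    rw [((sym_A h).smul (2 * h ^ 2)).quad, _root_.smul_apply, inner_smul_left]; simp
  rw [Q_eq, h1]
  refine Op_le_quad (fun ξ => ?_) x
  rw [qs_apply, BoundedContinuousFunction.smul_apply, as_apply, Complex.real_smul, ← Complex.ofReal_mul, Complex.ofReal_re,
    Complex.norm_real, Real.norm_eq_abs, sq_abs]
  exact sc_Q hh (fx_nonneg ξ)

lemma D_le {h : ℝ} (hh : 0 < h) (i : Fin d) (x : HR d) :
    ‖Dop h i x‖ ^ 2 ≤ 2 * ⟪Aop d h x, x⟫_ℝ := by
  have h1 : 2 * ⟪Aop d h x, x⟫_ℝ = (⟪mulL ((2 : ℝ) • as d h) (hat x), hat x⟫_ℂ).re := by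
    rw [((sym_A h).smul 2).quad, _root_.smul_apply, inner_smul_left]; simp
  rw [(sym_D h i).eq_Op, h1]
  refine Op_le_quad (fun ξ => ?_) x
  rw [ds_apply hh, BoundedContinuousFunction.smul_apply, as_apply, Complex.real_smul, ← Complex.ofReal_mul, Complex.ofReal_re,
    norm_mul, Complex.norm_I, mul_one, Complex.norm_real, Real.norm_eq_abs, sq_abs]
  exact sc_D hh (th_le i ξ)

lemma DJ_le {h : ℝ} (hh : 0 < h) (i : Fin d) (x : HR d) :
    ‖Dop h i (Jop d x) - Top i x‖ ≤ 2 * h * ‖x‖ := by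
  have h1 : Dop h i (Jop d x) = Op (ds h i * js d) x := by
    refine Op_left (B' := (-1 : ℝ) • Dop h i) (fun x y => ?_) ?_ _ _
    · rw [Dop_symm, _root_.smul_apply, inner_smul_right]; ring
    · have := (sym_D h i).smul (-1)
      convert this using 1
      ext ξ
      rw [BoundedContinuousFunction.star_apply, BoundedContinuousFunction.smul_apply, ds_apply hh]
      change starRingEnd ℂ _ = _
      rw [map_mul, Complex.conj_I, Complex.conj_ofReal, Complex.real_smul]; push_cast; ring
  unfold Top
  rw [h1, ← Op_sub]
  refine Op_norm_le (by positivity) (fun ξ => ?_) x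
  have h0 := fx_nonneg ξ
  have e : (ds h i * js d - ts i) ξ = (((Real.sin (h * th i ξ) - h * th i ξ) / h * (1 + fx ξ)⁻¹ : ℝ) : ℂ) * Complex.I := by
    rw [BoundedContinuousFunction.sub_apply, BoundedContinuousFunction.mul_apply, ds_apply hh, js_apply, ts_apply]
    rw [sub_div, mul_div_cancel_left₀ _ hh.ne']
    push_cast
    ring
  rw [e, norm_mul, Complex.norm_I, mul_one, Complex.norm_real, Real.norm_eq_abs, abs_mul, abs_div, abs_of_pos hh,
    abs_of_nonneg (a := (1 + fx ξ)⁻¹) (by positivity), ← div_eq_mul_inv, div_le_iff₀ (by positivity), div_le_iff₀ hh]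
  refine (sc_sin _).trans ?_
  have := th_le i ξ
  rw [mul_pow]
  nlinarith [mul_le_mul_of_nonneg_left this (sq_nonneg h), sq_nonneg h]

lemma VJ_le {κ h : ℝ} (hκ : 0 ≤ κ) (hh : 0 < h) (x : HR d) :
    ‖Vop d κ h (Jop d x)‖ ≤ κ * h * ‖x‖ := by
  have h1 : Vop d κ h (Jop d x) = Op (vs d κ h * js d) x :=
    Op_left (Vop_symm κ h) (by rw [star_vs]; exact sym_V κ h) _ _
  rw [h1]
  refine Op_norm_le (by positivity) (fun ξ => ?_) x
  have h0 := fx_nonneg ξ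
  rw [BoundedContinuousFunction.mul_apply, vs_apply, js_apply, ← Complex.ofReal_mul, Complex.norm_real, Real.norm_eq_abs, abs_mul,
    abs_of_nonneg (a := (1 + fx ξ)⁻¹) (by positivity), ← div_eq_mul_inv, div_le_iff₀ (by positivity), abs_mul,
    abs_of_nonneg (a := κ / h) (by positivity)]
  have h2 : |∑ i, (2 * Real.cos (h * th i ξ) - 2)| ≤ h ^ 2 * fx ξ := by
    refine (Finset.abs_sum_le_sum_abs _ _).trans ?_
    rw [← th_sum, Finset.mul_sum]
    refine Finset.sum_le_sum fun i _ => ?_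
    have h3 := Real.one_sub_sq_div_two_le_cos (x := h * th i ξ)
    have h4 := Real.cos_le_one (h * th i ξ)
    rw [abs_le]; constructor <;> nlinarith [sq_nonneg (h * th i ξ)]
  calc κ / h * |∑ i, (2 * Real.cos (h * th i ξ) - 2)| ≤ κ / h * (h ^ 2 * fx ξ) := by gcongr
    _ = κ * h * fx ξ := by field_simp
    _ ≤ _ := by gcongr; linarith

lemma A_quad (h : ℝ) (x y : HR d) :
    ⟪Aop d h x, y⟫_ℝ = (h ^ 2)⁻¹ * ((1 / 2) * ∫ z, ⟪tr z x - x, tr z y - y⟫_ℝ ∂(gm d h)) := by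
  rw [← avg_quad _ (gm_symm h)]
  unfold Aop
  rw [_root_.smul_apply, inner_smul_left]; rfl

lemma A_int (h : ℝ) (x y : HR d) : Integrable (fun z => ⟪tr z x - x, tr z y - y⟫_ℝ) (gm d h) := by
  refine Integrable.of_bound (C := (‖x‖ + ‖x‖) * (‖y‖ + ‖y‖)) ?_ (Eventually.of_forall fun z => ?_)
  · exact (((tr_cont x).sub continuous_const).inner ((tr_cont y).sub continuous_const)).aestronglyMeasurable
  · refine (abs_real_inner_le_norm _ _).trans ?_
    gcongr
    · exact (norm_sub_le _ _).trans (by simp)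
    · exact (norm_sub_le _ _).trans (by simp)

lemma A_pos (h : ℝ) (x : HR d) : 0 ≤ ⟪Aop d h x, x⟫_ℝ := by
  rw [A_quad]
  have : 0 ≤ ∫ z, ⟪tr z x - x, tr z x - x⟫_ℝ ∂(gm d h) := integral_nonneg fun z => real_inner_self_nonneg
  positivity

lemma A_f {h γ : ℝ} {f : HR d → HR d} (hf : ∀ x y, γ * ‖x - y‖ ^ 2 ≤ ⟪f x - f y, x - y⟫_ℝ)
    (hft : ∀ z x, tr z (f x) = f (tr z x)) (x : HR d) : γ * ⟪Aop d h x, x⟫_ℝ ≤ ⟪Aop d h (f x), x⟫_ℝ := by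
  rw [A_quad, A_quad, show ∀ a b c : ℝ, γ * (a * (b * c)) = a * (b * (γ * c)) by intros; ring, ← integral_const_mul γ]
  refine mul_le_mul_of_nonneg_left (mul_le_mul_of_nonneg_left ?_ (by norm_num)) (by positivity)
  refine integral_mono ((A_int h x x).const_mul γ) (A_int h _ _) fun z => ?_
  simp only
  rw [hft, real_inner_self_eq_norm_sq]
  exact hf _ _

lemma A_ff {h L : ℝ} {f : HR d → HR d} (hf : ∀ x y, ‖f x - f y‖ ≤ L * ‖x - y‖)
    (hft : ∀ z x, tr z (f x) = f (tr z x)) (x : HR d) : ⟪Aop d h (f x), f x⟫_ℝ ≤ L ^ 2 * ⟪Aop d h x, x⟫_ℝ := by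
  rw [A_quad, A_quad, show ∀ a b c : ℝ, L ^ 2 * (a * (b * c)) = a * (b * (L ^ 2 * c)) by intros; ring, ← integral_const_mul (L ^ 2)]
  refine mul_le_mul_of_nonneg_left (mul_le_mul_of_nonneg_left ?_ (by norm_num)) (by positivity)
  refine integral_mono (A_int h _ _) ((A_int h x x).const_mul _) fun z => ?_
  simp only
  rw [hft, real_inner_self_eq_norm_sq, real_inner_self_eq_norm_sq, ← mul_pow]
  exact pow_le_pow_left₀ (norm_nonneg _) (hf _ _) 2

/-- the data -/
def mkDat (f : HR d → HR d) (b : Fin d → HR d → HR d) (γ L : ℝ) (hγ : 0 < γ) (hL : 0 ≤ L)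
    (fmono : ∀ x y, γ * ‖x - y‖ ^ 2 ≤ ⟪f x - f y, x - y⟫_ℝ)
    (flip : ∀ x y, ‖f x - f y‖ ≤ L * ‖x - y‖)
    (blip : ∀ i x y, ‖b i x - b i y‖ ≤ L * ‖x - y‖)
    (f0 : f 0 = 0) (b0 : ∀ i, b i 0 = 0) : Dat (HR d) (Fin d) where
  J := Jop d
  T := Top
  f := f
  b := b
  γ := γ
  L := L
  Jsymm := Jop_symm
  Jle := Jop_le
  Tle := Top_le
  Jdense := Jop_dense
  γpos := hγ
  Lnonneg := hL
  fmono := fmono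
  flip := flip
  blip := blip
  f0 := f0
  b0 := b0

/-- the approximation -/
def mkApx (𝒟 : Dat (HR d) (Fin d)) (hJ : 𝒟.J = Jop d) (hT : 𝒟.T = Top)
    (hft : ∀ z x, tr z (𝒟.f x) = 𝒟.f (tr z x)) {κ h : ℝ} (hκ : 0 ≤ κ) (hh : 0 < h) : Apx 𝒟 (2 + κ) h where
  A := Aop d h
  D := Dop h
  V := Vop d κ h
  Asymm := Aop_symm h
  Dsymm := Dop_symm h
  Vsymm := Vop_symm κ h
  Vneg := Vop_neg hκ hh
  Qsymm := by rw [hJ]; exact Q_symm h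
  Qle := by
    rw [hJ]; intro x
    refine (Q_le hh x).trans ?_
    have := A_pos h x
    gcongr; linarith
  DJ := by
    rw [hJ, hT]; intro i x
    refine (DJ_le hh i x).trans ?_
    gcongr; linarith
  VJ := by
    rw [hJ]; intro x
    refine (VJ_le hκ hh x).trans ?_
    gcongr; linarith
  Dle := by
    intro i x
    refine (D_le hh i x).trans ?_
    have := A_pos h x
    gcongr; linarith
  Apos := A_pos h
  Af := A_f 𝒟.fmono hft
  Aff := A_ff 𝒟.flip hft

end ops
end FP

namespace FP
set_option linter.unusedSectionVars false
set_option linter.unusedVariables false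

open scoped InnerProductSpace Topology

section nem
variable {d : ℕ}

/-- Lipschitz nonlinearity -/
def NL (g : EE d → ℝ → ℝ) (L : ℝ) : Prop :=
  Continuous (fun p : EE d × ℝ => g p.1 p.2) ∧ (∀ x r s, |g x r - g x s| ≤ L * |r - s|) ∧ ∀ x, g x 0 = 0

open Classical in
/-- Nemytskii operator -/
def nem (g : EE d → ℝ → ℝ) (u : HR d) : HR d :=
  if h : MemLp (fun x => g x (u x)) 2 volume then h.toLp _ else 0

lemma NL.memLp {g : EE d → ℝ → ℝ} {L : ℝ} (hg : NL g L) (u : HR d) : MemLp (fun x => g x (u x)) 2 volume := by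
  refine MemLp.of_le_mul (c := L) (Lp.memLp u) ?_ (Eventually.of_forall fun x => ?_)
  · exact hg.1.comp_aestronglyMeasurable (aestronglyMeasurable_id.prodMk (Lp.aestronglyMeasurable u))
  · have := hg.2.1 x (u x) 0
    rwa [hg.2.2, sub_zero, sub_zero] at this

lemma NL.coe {g : EE d → ℝ → ℝ} {L : ℝ} (hg : NL g L) (u : HR d) : nem g u =ᵐ[volume] fun x => g x (u x) := by
  rw [nem, dif_pos (hg.memLp u)]
  exact (hg.memLp u).coeFn_toLp

lemma NL.lip {g : EE d → ℝ → ℝ} {L : ℝ} (hg : NL g L) (u v : HR d) : ‖nem g u - nem g v‖ ≤ L * ‖u - v‖ := by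
  refine Lp.norm_le_mul_norm_of_ae_le_mul ?_
  filter_upwards [hg.coe u, hg.coe v, Lp.coeFn_sub u v, Lp.coeFn_sub (nem g u) (nem g v)] with x h1 h2 h3 h4
  rw [h3, h4, Pi.sub_apply, Pi.sub_apply, h1, h2]
  exact hg.2.1 x _ _

lemma NL.zero {g : EE d → ℝ → ℝ} {L : ℝ} (hg : NL g L) : nem g 0 = 0 := by
  rw [Lp.eq_zero_iff_ae_eq_zero]
  filter_upwards [hg.coe 0, Lp.coeFn_zero ℝ 2 (volume : Measure (EE d))] with x h1 h2
  rw [h1, h2]; exact hg.2.2 x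

lemma nem_tr {g : ℝ → ℝ} {L : ℝ} (hg : NL (fun (_ : EE d) => g) L) (z : EE d) (u : HR d) :
    tr z (nem (fun _ => g) u) = nem (fun _ => g) (tr z u) := by
  apply Lp.ext
  filter_upwards [tr_coe z (nem (fun _ => g) u), ae_shift z (hg.coe u), hg.coe (tr z u), tr_coe z u] with x h1 h2 h3 h4
  rw [h1, h2, h3, h4]

lemma nem_mono {g : ℝ → ℝ} {L γ : ℝ} (hg : NL (fun (_ : EE d) => g) L)
    (h : ∀ r s, γ * (r - s) ^ 2 ≤ (g r - g s) * (r - s)) (u v : HR d) :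
    γ * ‖u - v‖ ^ 2 ≤ ⟪nem (fun _ => g) u - nem (fun _ => g) v, u - v⟫_ℝ := by
  rw [← real_inner_self_eq_norm_sq, L2.inner_def, L2.inner_def, ← integral_const_mul]
  refine integral_mono_ae ((L2.integrable_inner _ _).const_mul _) (L2.integrable_inner _ _) ?_
  filter_upwards [hg.coe u, hg.coe v, Lp.coeFn_sub u v, Lp.coeFn_sub (nem (fun _ => g) u) (nem (fun _ => g) v)] with x h1 h2 h3 h4
  rw [h3, h4, Pi.sub_apply, Pi.sub_apply, h1, h2, real_inner_eq_re_inner, RCLike.inner_apply, RCLike.inner_apply]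
  simpa [sq, mul_comm] using h (u x) (v x)

/-- coefficients -/
structure Coef (d : ℕ) where
  f : ℝ → ℝ
  B : Fin d → EE d → ℝ → ℝ
  γ : ℝ
  L : ℝ
  c : ℝ
  γpos : 0 < γ
  Lnn : 0 ≤ L
  cnn : 0 ≤ c
  f0 : f 0 = 0
  fmono : ∀ r s, s ≤ r → γ * (r - s) ≤ f r - f s
  flip : ∀ r s, s ≤ r → f r - f s ≤ L * (r - s)
  Bc : ∀ i, Continuous fun p : EE d × ℝ => B i p.1 p.2
  B0 : ∀ i x, B i x 0 = 0
  Blip : ∀ i x r s, |B i x r - B i x s| ≤ L * |r - s|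
  Bx : ∀ i x y r, |B i x r - B i y r| ≤ c * |r| * ‖x - y‖

variable (K : Coef d)

lemma Coef.flip' (r s : ℝ) : |K.f r - K.f s| ≤ K.L * |r - s| := by
  rcases le_total s r with h | h
  · have h1 := K.fmono r s h
    have h2 := K.flip r s h
    rw [abs_of_nonneg (sub_nonneg.2 h), abs_of_nonneg (le_trans (mul_nonneg K.γpos.le (sub_nonneg.2 h)) h1)]; exact h2
  · have h1 := K.fmono s r h
    have h2 := K.flip s r h
    rw [abs_sub_comm, abs_sub_comm r, abs_of_nonneg (sub_nonneg.2 h), abs_of_nonneg (le_trans (mul_nonneg K.γpos.le (sub_nonneg.2 h)) h1)]; exact h2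

lemma Coef.fNL : NL (fun (_ : EE d) => K.f) K.L := by
  refine ⟨?_, fun _ => K.flip', fun _ => K.f0⟩
  have : LipschitzWith ⟨K.L, K.Lnn⟩ K.f := LipschitzWith.of_dist_le_mul fun x y => by
    rw [Real.dist_eq, Real.dist_eq]; exact K.flip' x y
  exact this.continuous.comp continuous_snd

lemma Coef.BNL (i : Fin d) : NL (K.B i) K.L := ⟨K.Bc i, K.Blip i, K.B0 i⟩

/-- abstract data -/
def Coef.dat : Dat (HR d) (Fin d) :=
  mkDat (nem fun _ => K.f) (fun i => nem (K.B i)) K.γ K.L K.γpos K.Lnn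
    (nem_mono K.fNL fun r s => by
      rcases le_total s r with h | h
      · have := mul_le_mul_of_nonneg_right (K.fmono r s h) (sub_nonneg.2 h); nlinarith
      · have := mul_le_mul_of_nonneg_right (K.fmono s r h) (sub_nonneg.2 h); nlinarith)
    K.fNL.lip (fun i => (K.BNL i).lip) K.fNL.zero (fun i => (K.BNL i).zero)

/-- approximation -/
def Coef.apx {h : ℝ} (hh : 0 < h) : Apx K.dat (2 + K.L) h :=
  mkApx K.dat rfl rfl (fun z x => nem_tr K.fNL z x) K.Lnn hh

/-- finite sets -/
def FS (d : ℕ) := {s : Set (EE d) // MeasurableSet s ∧ volume s ≠ ⊤}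
/-- indicator -/
def eS (s : FS d) : HR d := indicatorConstLp 2 s.2.1 s.2.2 1

lemma eS_inner (s : FS d) (v : HR d) : ⟪eS s, v⟫_ℝ = ∫ x in s.1, v x := L2.inner_indicatorConstLp_one s.2.1 s.2.2 v

lemma eS_intOn (s : FS d) (v : HR d) : IntegrableOn v s.1 :=
  integrableOn_Lp_of_measure_ne_top v fact_one_le_two_ennreal.elim s.2.2

lemma eS_le {v : HR d} {k : ℝ} (h : ∀ᵐ x, v x ≤ k) (s : FS d) : ⟪eS s, v⟫_ℝ ≤ k * volume.real s.1 := by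
  rw [eS_inner]
  have : ∫ x in s.1, k = k * volume.real s.1 := by simp [mul_comm]
  rw [← this]
  refine integral_mono_ae (eS_intOn s v) (integrableOn_const s.2.2) ?_
  exact ae_restrict_of_ae h

lemma le_of_eS {v : HR d} {k : ℝ} (h : ∀ s : FS d, ⟪eS s, v⟫_ℝ ≤ k * volume.real s.1) : ∀ᵐ x, v x ≤ k := by
  have := ae_nonneg_of_forall_setIntegral_nonneg_of_sigmaFinite (μ := (volume : Measure (EE d))) (f := fun x => k - v x)
    (fun s hs hs' => (integrableOn_const hs'.ne).sub (eS_intOn ⟨s, hs, hs'.ne⟩ v)) (fun s hs hs' => by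
      have h1 := h (⟨s, hs, hs'.ne⟩ : FS d)
      rw [eS_inner (⟨s, hs, hs'.ne⟩ : FS d) v] at h1
      have : ∫ x in s, k = k * volume.real s := by simp [mul_comm]
      have h2 : ∫ x in s, (k - v x) = (∫ x in s, k) - ∫ x in s, v x :=
        integral_sub (μ := volume.restrict s) (f := fun _ => k) (g := fun x => v x)
          (integrableOn_const hs'.ne) (eS_intOn (⟨s, hs, hs'.ne⟩ : FS d) v)
      rw [h2, this]
      exact sub_nonneg.2 h1)
  filter_upwards [this] with x hx
  simp only [Pi.zero_apply] at hx
  linarith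

/-- one step -/
def Coef.S {h : ℝ} (hh : 0 < h) (τ : ℝ) (u : HR d) : HR d := u + τ • (K.apx hh).F u

/-- local piece -/
def Coef.v0 (h τ : ℝ) (u : HR d) : HR d := u - (τ * (h ^ 2)⁻¹) • nem (fun _ => K.f) u - (2 * d * K.L * τ / h) • u
/-- flux piece -/
def Coef.vp (e : ℝ) (i : Fin d) (u : HR d) : HR d := K.L • u + (e / 2) • nem (K.B i) u

lemma Coef.S_eq {h : ℝ} (hh : 0 < h) (τ : ℝ) (u : HR d) : K.S hh τ u =
    K.v0 h τ u + (τ * (h ^ 2)⁻¹) • avg (gm d h) (nem (fun _ => K.f) u) +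
      (τ / h) • ∑ i, (tr (EuclideanSpace.single i h) (K.vp (-1) i u) + tr (-EuclideanSpace.single i h) (K.vp 1 i u)) := by
  have hA : (K.apx hh).A = Aop d h := rfl
  have hD : (K.apx hh).D = Dop h := rfl
  have hV : (K.apx hh).V = Vop d K.L h := rfl
  have hf : K.dat.f = nem fun _ => K.f := rfl
  have hb : K.dat.b = fun i => nem (K.B i) := rfl
  unfold Coef.S Apx.F Coef.v0 Coef.vp
  rw [hA, hD, hV, hf, hb, Vop_apply]
  simp only [Dop_apply, map_add, map_smul]
  have hA2 : Aop d h (nem (fun _ => K.f) u) = (h ^ 2)⁻¹ • (nem (fun _ => K.f) u - avg (gm d h) (nem (fun _ => K.f) u)) := rfl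
  rw [hA2]
  have e1 : ∑ i : Fin d, (tr (EuclideanSpace.single i h) u + tr (-EuclideanSpace.single i h) u - (2 : ℝ) • u)
     = ∑ i : Fin d, (tr (EuclideanSpace.single i h) u + tr (-EuclideanSpace.single i h) u) - (2 * d : ℝ) • u := by
    rw [Finset.sum_sub_distrib, Finset.sum_const, Finset.card_univ, Fintype.card_fin, ← Nat.cast_smul_eq_nsmul ℝ, smul_smul, mul_comm (d : ℝ)]
  rw [e1]
  have e2 : ∑ i : Fin d, (K.L • tr (EuclideanSpace.single i h) u + (-1 / 2 : ℝ) • tr (EuclideanSpace.single i h) (nem (K.B i) u)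
      + (K.L • tr (-EuclideanSpace.single i h) u + (1 / 2 : ℝ) • tr (-EuclideanSpace.single i h) (nem (K.B i) u)))
     = K.L • ∑ i : Fin d, (tr (EuclideanSpace.single i h) u + tr (-EuclideanSpace.single i h) u)
       - h • ∑ i : Fin d, (2 * h)⁻¹ • (tr (EuclideanSpace.single i h) (nem (K.B i) u) - tr (-EuclideanSpace.single i h) (nem (K.B i) u)) := by
    rw [Finset.smul_sum, Finset.smul_sum, ← Finset.sum_sub_distrib]
    refine Finset.sum_congr rfl fun i _ => ?_
    have : h * (2 * h)⁻¹ = 1 / 2 := by field_simp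
    rw [smul_smul, this]
    module
  rw [e2]
  match_scalars <;> field_simp <;> ring

lemma Coef.mono_eps {g : ℝ → ℝ} (hg : Monotone g) {e k r : ℝ} (he : e = 1 ∨ e = -1) (h : e * r ≤ k) :
    e * g r ≤ e * g (e * k) := by
  rcases he with rfl | rfl
  · simpa using hg (by simpa using h)
  · have := hg (show -1 * k ≤ r by linarith)
    linarith

lemma Coef.vp_mono (e : ℝ) (he : e = 1 ∨ e = -1) (i : Fin d) (x : EE d) : Monotone fun r => K.L * r + e / 2 * K.B i x r := by
  intro r s hrs
  have h1 := abs_le.1 (K.Blip i x r s)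
  rw [abs_sub_comm r s, abs_of_nonneg (sub_nonneg.2 hrs)] at h1
  have h2 := mul_nonneg K.Lnn (sub_nonneg.2 hrs)
  simp only
  rcases he with rfl | rfl <;> nlinarith [h1.1, h1.2]

lemma Coef.v0_mono {h τ : ℝ} (hh : 0 < h) (hτ : 0 ≤ τ) (hcfl : τ * (h ^ 2)⁻¹ * K.L + 2 * d * K.L * τ / h ≤ 1) :
    Monotone fun r => r - τ * (h ^ 2)⁻¹ * K.f r - 2 * d * K.L * τ / h * r := by
  intro r s hrs
  have h1 := mul_le_mul_of_nonneg_left (K.flip s r hrs) (show 0 ≤ τ * (h ^ 2)⁻¹ by positivity)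
  have h2 := mul_le_mul_of_nonneg_right hcfl (sub_nonneg.2 hrs)
  simp only
  nlinarith

lemma Coef.f_mono : Monotone K.f := fun r s hrs => by
  have := K.fmono s r hrs
  have := mul_nonneg K.γpos.le (sub_nonneg.2 hrs)
  linarith

lemma Coef.v0_coe (h τ : ℝ) (u : HR d) : K.v0 h τ u =ᵐ[volume] fun x => u x - τ * (h ^ 2)⁻¹ * K.f (u x) - 2 * d * K.L * τ / h * u x := by
  unfold Coef.v0
  filter_upwards [K.fNL.coe u, Lp.coeFn_sub (u - (τ * (h ^ 2)⁻¹) • nem (fun _ => K.f) u) ((2 * d * K.L * τ / h) • u),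
    Lp.coeFn_sub u ((τ * (h ^ 2)⁻¹) • nem (fun _ => K.f) u), Lp.coeFn_smul (τ * (h ^ 2)⁻¹) (nem (fun _ => K.f) u),
    Lp.coeFn_smul (2 * d * K.L * τ / h) u] with x h1 h2 h3 h4 h5
  rw [h2, Pi.sub_apply, h3, Pi.sub_apply, h4, h5, Pi.smul_apply, Pi.smul_apply, h1]; simp

lemma Coef.vp_coe (e : ℝ) (i : Fin d) (u : HR d) : K.vp e i u =ᵐ[volume] fun x => K.L * u x + e / 2 * K.B i x (u x) := by
  unfold Coef.vp
  filter_upwards [(K.BNL i).coe u, Lp.coeFn_add (K.L • u) ((e / 2) • nem (K.B i) u),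
    Lp.coeFn_smul K.L u, Lp.coeFn_smul (e / 2) (nem (K.B i) u)] with x h1 h2 h3 h4
  rw [h2, Pi.add_apply, h3, h4, Pi.smul_apply, Pi.smul_apply, h1]; simp

lemma eS_le' {v : HR d} {e k : ℝ} (h : ∀ᵐ x, e * v x ≤ k) (s : FS d) : e * ⟪eS s, v⟫_ℝ ≤ k * volume.real s.1 := by
  have h1 : ∀ᵐ x, (e • v) x ≤ k := by
    filter_upwards [h, Lp.coeFn_smul e v] with x h1 h2
    rw [h2]; exact h1
  have := eS_le h1 s
  rwa [inner_smul_right] at this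

lemma Coef.step_inf {h τ : ℝ} (hh : 0 < h) (hτ : 0 ≤ τ) (hcfl : τ * (h ^ 2)⁻¹ * K.L + 2 * d * K.L * τ / h ≤ 1)
    {e k : ℝ} (he : e = 1 ∨ e = -1) (hk : 0 ≤ k) {u : HR d} (hu : ∀ᵐ x, e * u x ≤ k) (s : FS d) :
    e * ⟪eS s, K.S hh τ u⟫_ℝ ≤ (k + τ * (d * K.c * k)) * volume.real s.1 := by
  have hee : e * e = 1 := by rcases he with rfl | rfl <;> norm_num
  have habs : |e * k| = k := by rcases he with rfl | rfl <;> simp [abs_of_nonneg hk]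
  have h1 : e * ⟪eS s, K.v0 h τ u⟫_ℝ ≤ (k - τ * (h ^ 2)⁻¹ * (e * K.f (e * k)) - 2 * d * K.L * τ / h * k) * volume.real s.1 := by
    refine eS_le' ?_ s
    filter_upwards [hu, K.v0_coe h τ u] with x h1 h2
    rw [h2]
    refine (mono_eps (K.v0_mono hh hτ hcfl) he h1).trans (le_of_eq ?_)
    linear_combination (k - 2 * d * K.L * τ / h * k) * hee
  have h2 : e * ⟪eS s, avg (gm d h) (nem (fun _ => K.f) u)⟫_ℝ ≤ (e * K.f (e * k)) * volume.real s.1 := by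
    rw [real_inner_comm, inner_avg, ← integral_const_mul]
    have : ∫ z, (e * K.f (e * k)) * volume.real s.1 ∂(gm d h) = (e * K.f (e * k)) * volume.real s.1 := by simp
    rw [← this]
    refine integral_mono ?_ (integrable_const _) fun z => ?_
    · refine Integrable.const_mul ?_ _
      refine Integrable.of_bound ((tr_cont _).inner continuous_const).aestronglyMeasurable (‖nem (fun _ => K.f) u‖ * ‖eS s‖)
        (Eventually.of_forall fun z => (abs_real_inner_le_norm _ _).trans (by simp))
    · simp only
      rw [real_inner_comm]
      refine eS_le' ?_ s
      filter_upwards [tr_coe z (nem (fun _ => K.f) u), ae_shift z (K.fNL.coe u), ae_shift z hu] with x h1 h2 h3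
      rw [h1, h2]
      exact mono_eps K.f_mono he h3
  have h3 : ∀ i : Fin d, e * ⟪eS s, tr (EuclideanSpace.single i h) (K.vp (-1) i u) + tr (-EuclideanSpace.single i h) (K.vp 1 i u)⟫_ℝ
      ≤ (2 * K.L * k + h * (K.c * k)) * volume.real s.1 := by
    intro i
    refine eS_le' ?_ s
    set z : EE d := EuclideanSpace.single i h with hz
    filter_upwards [Lp.coeFn_add (tr z (K.vp (-1) i u)) (tr (-z) (K.vp 1 i u)), tr_coe z (K.vp (-1) i u), tr_coe (-z) (K.vp 1 i u),
      ae_shift z (K.vp_coe (-1) i u), ae_shift (-z) (K.vp_coe 1 i u), ae_shift z hu, ae_shift (-z) hu] with x a1 a2 a3 a4 a5 a6 a7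
    rw [a1, Pi.add_apply, a2, a3, a4, a5, mul_add]
    have b1 := mono_eps (K.vp_mono (-1) (Or.inr rfl) i (x + z)) he a6
    have b2 := mono_eps (K.vp_mono 1 (Or.inl rfl) i (x + -z)) he a7
    have b3 := K.Bx i (x + -z) (x + z) (e * k)
    have b4 : ‖x + -z - (x + z)‖ ≤ 2 * h := by
      rw [show x + -z - (x + z) = -(z + z) by abel, norm_neg]
      refine (norm_add_le _ _).trans ?_
      rw [hz, PiLp.norm_single, Real.norm_eq_abs, abs_of_pos hh]; linarith
    rw [habs] at b3
    have b5 : K.c * k * ‖x + -z - (x + z)‖ ≤ K.c * k * (2 * h) := mul_le_mul_of_nonneg_left b4 (mul_nonneg K.cnn hk)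
    have b6 := abs_le.1 (b3.trans b5)
    have b7 : e * (K.L * (e * k)) = K.L * k := by linear_combination (K.L * k) * hee
    have b8 : e * (K.B i (x + -z) (e * k) - K.B i (x + z) (e * k)) ≤ K.c * k * (2 * h) := by
      rcases he with rfl | rfl <;> linarith [b6.1, b6.2]
    linarith
  rw [K.S_eq hh, inner_add_right, inner_add_right, inner_smul_right, inner_smul_right, inner_sum]
  have h4 : e * ∑ i : Fin d, ⟪eS s, tr (EuclideanSpace.single i h) (K.vp (-1) i u) + tr (-EuclideanSpace.single i h) (K.vp 1 i u)⟫_ℝ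
      ≤ d * ((2 * K.L * k + h * (K.c * k)) * volume.real s.1) := by
    rw [Finset.mul_sum]
    refine (Finset.sum_le_sum fun i _ => h3 i).trans (by simp)
  have h5 := mul_le_mul_of_nonneg_left h2 (show 0 ≤ τ * (h ^ 2)⁻¹ by positivity)
  have h6 := mul_le_mul_of_nonneg_left h4 (show 0 ≤ τ / h by positivity)
  have h7 : τ / h * (d * ((2 * K.L * k + h * (K.c * k)) * volume.real s.1)) =
     (2 * d * K.L * τ / h * k + τ * (d * K.c * k)) * volume.real s.1 := by field_simp
  rw [h7] at h6
  linarith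

end nem
end FP

namespace FP
set_option linter.unusedSectionVars false
set_option linter.unusedVariables false

open scoped InnerProductSpace Topology

section wt
variable {d : ℕ}

/-- weight -/
def wt (κ s : ℝ) (y : EE d) : ℝ := κ + (1 - (1 + s * ‖y‖ ^ 2)⁻¹)
/-- weight slope -/
def wq (s : ℝ) (y : EE d) : ℝ := s * ((1 + s * ‖y‖ ^ 2)⁻¹) ^ 2

lemma wt_cont {κ s : ℝ} (hs : 0 ≤ s) : Continuous (wt κ s : EE d → ℝ) := by
  unfold wt
  refine continuous_const.add (continuous_const.sub (Continuous.inv₀ (by fun_prop) fun y => ?_))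
  positivity

lemma wq_cont {s : ℝ} (hs : 0 ≤ s) : Continuous (wq s : EE d → ℝ) := by
  unfold wq
  refine continuous_const.mul (Continuous.pow (Continuous.inv₀ (by fun_prop) fun y => ?_) 2)
  positivity

lemma wt_nn {κ s : ℝ} (hκ : 0 ≤ κ) (hs : 0 ≤ s) (y : EE d) : 0 ≤ wt κ s y := by
  have : (1 + s * ‖y‖ ^ 2)⁻¹ ≤ 1 := inv_le_one_of_one_le₀ (by nlinarith [mul_nonneg hs (sq_nonneg ‖y‖)])
  unfold wt; linarith

lemma wt_le {κ s : ℝ} (hs : 0 ≤ s) (y : EE d) : wt κ s y ≤ κ + 1 := by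
  have : 0 ≤ (1 + s * ‖y‖ ^ 2)⁻¹ := by positivity
  unfold wt; linarith

lemma wq_nn {s : ℝ} (hs : 0 ≤ s) (y : EE d) : 0 ≤ wq s y := by unfold wq; positivity

lemma wq_le {s : ℝ} (hs : 0 ≤ s) (y : EE d) : wq s y ≤ s := by
  have h1 : (1 + s * ‖y‖ ^ 2)⁻¹ ≤ 1 := inv_le_one_of_one_le₀ (by nlinarith [mul_nonneg hs (sq_nonneg ‖y‖)])
  have h2 : 0 ≤ (1 + s * ‖y‖ ^ 2)⁻¹ := by positivity
  unfold wq
  nlinarith [pow_le_one₀ (n := 2) h2 h1]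

lemma wq_norm {s : ℝ} (hs : 0 ≤ s) (y : EE d) : wq s y * ‖y‖ ≤ √s := by
  have h2 : 0 < 1 + s * ‖y‖ ^ 2 := by positivity
  have h3 := Real.sq_sqrt hs
  have h4 := Real.sqrt_nonneg s
  have h5 := norm_nonneg y
  have h6 : (1 + s * ‖y‖ ^ 2)⁻¹ ≤ 1 := inv_le_one_of_one_le₀ (by nlinarith [mul_nonneg hs (sq_nonneg ‖y‖)])
  have h7 : 0 ≤ (1 + s * ‖y‖ ^ 2)⁻¹ := by positivity
  have h8 : √s * ‖y‖ * (1 + s * ‖y‖ ^ 2)⁻¹ ≤ 1 := by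
    rw [← div_eq_mul_inv, div_le_one h2]
    nlinarith [sq_nonneg (√s * ‖y‖ - 1)]
  have h9 : wq s y * ‖y‖ = √s * (√s * ‖y‖ * (1 + s * ‖y‖ ^ 2)⁻¹) * (1 + s * ‖y‖ ^ 2)⁻¹ := by
    unfold wq; linear_combination (-(1 + s * ‖y‖ ^ 2)⁻¹ ^ 2 * ‖y‖) * h3
  rw [h9]
  have h10 : √s * (√s * ‖y‖ * (1 + s * ‖y‖ ^ 2)⁻¹) ≤ √s := by nlinarith
  have h11 : 0 ≤ √s * (√s * ‖y‖ * (1 + s * ‖y‖ ^ 2)⁻¹) := by positivity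
  nlinarith

lemma wt_shift {κ s : ℝ} (hs : 0 ≤ s) (y z : EE d) :
    wt κ s (y - z) ≤ wt κ s y + wq s y * (-(2 * ⟪y, z⟫_ℝ) + ‖z‖ ^ 2) := by
  have h1 : ‖y - z‖ ^ 2 - ‖y‖ ^ 2 = -(2 * ⟪y, z⟫_ℝ) + ‖z‖ ^ 2 := by rw [norm_sub_sq_real]; ring
  rw [← h1]
  unfold wt wq
  have ha : 0 < 1 + s * ‖y‖ ^ 2 := by positivity
  have hb : 0 < 1 + s * ‖y - z‖ ^ 2 := by positivity
  set A := 1 + s * ‖y‖ ^ 2 with hA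
  set B := 1 + s * ‖y - z‖ ^ 2 with hB
  have h2 : s * A⁻¹ ^ 2 * (‖y - z‖ ^ 2 - ‖y‖ ^ 2) = A⁻¹ ^ 2 * (B - A) := by rw [hA, hB]; ring
  rw [h2]
  have h3 : κ + (1 - A⁻¹) + A⁻¹ ^ 2 * (B - A) - (κ + (1 - B⁻¹)) = (B - A) ^ 2 * (A⁻¹ ^ 2 * B⁻¹) := by field_simp; ring
  have h4 : 0 ≤ (B - A) ^ 2 * (A⁻¹ ^ 2 * B⁻¹) := by positivity
  linarith

lemma inner_le_int {χ : EE d → ℝ} {g v : HR d} (hg : ∀ᵐ x, |g x| ≤ χ x) (hi : Integrable fun x => χ x * |v x|) :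
    ⟪g, v⟫_ℝ ≤ ∫ x, χ x * |v x| := by
  rw [L2.inner_def]
  refine integral_mono_ae (L2.integrable_inner _ _) hi ?_
  filter_upwards [hg] with x hx
  rw [real_inner_eq_re_inner, RCLike.inner_apply]
  simp only [conj_trivial, RCLike.re_to_real]
  calc v x * g x ≤ |v x * g x| := le_abs_self _
    _ = |g x| * |v x| := by rw [abs_mul, mul_comm]
    _ ≤ _ := mul_le_mul_of_nonneg_right hx (abs_nonneg _)

lemma wt_int {χ : EE d → ℝ} (hχ : Continuous χ) {C : ℝ} (h0 : ∀ x, 0 ≤ χ x) (h1 : ∀ x, χ x ≤ C) {u : HR d} {R : ℝ}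
    (H : ∀ g : HR d, (∀ᵐ x, |g x| ≤ χ x) → ⟪g, u⟫_ℝ ≤ R) :
    Integrable (fun x => χ x * |u x|) ∧ ∫ x, χ x * |u x| ≤ R := by
  have hum : AEStronglyMeasurable (fun x => χ x * |u x|) volume :=
    hχ.aestronglyMeasurable.mul (Lp.aestronglyMeasurable u).norm
  have hcov : AECover (volume : Measure (EE d)) atTop fun n : ℕ => Metric.ball (0 : EE d) n :=
    aecover_ball tendsto_natCast_atTop_atTop
  have hfin : ∀ n : ℕ, volume (Metric.ball (0 : EE d) n) ≠ ⊤ := fun n => measure_ball_lt_top.ne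
  have hC : 0 ≤ C := (h0 0).trans (h1 0)
  have hfi : ∀ n : ℕ, IntegrableOn (fun x => χ x * |u x|) (Metric.ball (0 : EE d) n) volume := fun n => by
    have := (eS_intOn (⟨_, measurableSet_ball, hfin n⟩ : FS d) u).norm.const_mul C
    refine Integrable.mono this hum.restrict (Eventually.of_forall fun x => ?_)
    simp only [norm_mul, norm_abs_eq_norm, Real.norm_eq_abs]
    rw [abs_of_nonneg (h0 x), abs_of_nonneg hC]
    exact mul_le_mul_of_nonneg_right (h1 x) (abs_nonneg _)
  have hb : ∀ n : ℕ, ∫ x in Metric.ball (0 : EE d) n, χ x * |u x| ≤ R := fun n => by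
    let k : EE d → ℝ := (Metric.ball (0 : EE d) n).indicator fun x => χ x * (SignType.sign (u x) : ℝ)
    have hkb : ∀ x, |k x| ≤ (Metric.ball (0 : EE d) n).indicator χ x := fun x => by
      by_cases hx : x ∈ Metric.ball (0 : EE d) n
      · simp only [k, indicator_of_mem hx, abs_mul, abs_of_nonneg (h0 x)]
        refine mul_le_of_le_one_right (h0 x) ?_
        rcases lt_trichotomy (u x) 0 with h | h | h <;> simp [h]
      · simp only [k, indicator_of_notMem hx, abs_zero]; exact le_rfl
    have hkm : AEStronglyMeasurable k volume := by
      refine AEStronglyMeasurable.indicator ?_ measurableSet_ball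
      refine hχ.aestronglyMeasurable.mul ?_
      have : Measurable fun r : ℝ => ((SignType.sign r : SignType) : ℝ) := by
        have : (fun r : ℝ => ((SignType.sign r : SignType) : ℝ)) = fun r => if 0 < r then 1 else if r < 0 then -1 else 0 := by
          funext r
          rcases lt_trichotomy r 0 with h | h | h
          · simp [h, h.not_gt]
          · simp [h]
          · simp [h]
        rw [this]
        exact Measurable.ite measurableSet_Ioi measurable_const (Measurable.ite measurableSet_Iio measurable_const measurable_const)
      exact (this.comp_aemeasurable (Lp.aestronglyMeasurable u).aemeasurable).aestronglyMeasurable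
    have hkm2 : MemLp k 2 volume := by
      refine MemLp.mono (memLp_indicator_const 2 (measurableSet_ball (x := (0 : EE d)) (ε := n)) C (Or.inr (hfin n))) hkm
        (Eventually.of_forall fun x => ?_)
      refine (hkb x).trans ?_
      by_cases hx : x ∈ Metric.ball (0 : EE d) n
      · simp only [indicator_of_mem hx]; exact (h1 x).trans (le_abs_self _)
      · simp only [indicator_of_notMem hx, norm_zero, le_refl]
    have h2 := H (hkm2.toLp k) (by
      filter_upwards [hkm2.coeFn_toLp] with x hx
      rw [hx]
      refine (hkb x).trans (indicator_le_self' (fun _ _ => h0 x) x))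
    rw [L2.inner_def] at h2
    refine le_trans (le_of_eq ?_) h2
    rw [← integral_indicator measurableSet_ball]
    refine integral_congr_ae ?_
    filter_upwards [hkm2.coeFn_toLp] with x hx
    rw [hx, real_inner_eq_re_inner, RCLike.inner_apply]
    by_cases hx : x ∈ Metric.ball (0 : EE d) n
    · simp only [k, indicator_of_mem hx, conj_trivial, RCLike.re_to_real]
      rw [← sign_mul_self (u x)]
      ring
    · simp [k, indicator_of_notMem hx]
  have hI : Integrable (fun x => χ x * |u x|) := hcov.integrable_of_integral_norm_bounded R hfi
    (Eventually.of_forall fun n => by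
      refine le_trans (le_of_eq ?_) (hb n)
      refine integral_congr_ae (Eventually.of_forall fun x => ?_)
      exact abs_of_nonneg (mul_nonneg (h0 x) (abs_nonneg _)))
  exact ⟨hI, le_of_tendsto (hcov.integral_tendsto_of_countably_generated hI) (Eventually.of_forall hb)⟩

lemma wt_mul_int {κ s : ℝ} (hκ : 0 ≤ κ) (hs : 0 ≤ s) {v : EE d → ℝ} (hv : Integrable v) :
    Integrable fun x => wt κ s x * |v x| := by
  refine hv.abs.bdd_mul (c := κ + 1) (wt_cont hs).aestronglyMeasurable (Eventually.of_forall fun x => ?_)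
  rw [Real.norm_eq_abs, abs_of_nonneg (wt_nn hκ hs x)]; exact wt_le hs x

/-- barycenter -/
def bary (s : ℝ) (v : EE d → ℝ) : EE d := ∫ y, (wq s y * |v y|) • y

lemma bary_int {s : ℝ} (hs : 0 ≤ s) {v : EE d → ℝ} (hv : Integrable v) : Integrable fun y => (wq s y * |v y|) • y := by
  refine Integrable.mono (hv.abs.const_mul (√s)) (((wq_cont hs).aestronglyMeasurable.mul hv.1.norm).smul aestronglyMeasurable_id)
    (Eventually.of_forall fun y => ?_)
  rw [norm_smul, norm_mul, Real.norm_eq_abs, abs_of_nonneg (wq_nn hs y), Real.norm_eq_abs, Real.norm_eq_abs, abs_abs, abs_mul, abs_abs,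
    abs_of_nonneg (Real.sqrt_nonneg s)]
  calc wq s y * |v y| * ‖y‖ = (wq s y * ‖y‖) * |v y| := by ring
    _ ≤ _ := mul_le_mul_of_nonneg_right (wq_norm hs y) (abs_nonneg _)

lemma bary_norm {s : ℝ} (hs : 0 ≤ s) {v : EE d → ℝ} (hv : Integrable v) : ‖bary s v‖ ≤ √s * ∫ y, |v y| := by
  rw [← integral_const_mul]
  refine norm_integral_le_of_norm_le (hv.abs.const_mul (√s)) (Eventually.of_forall fun y => ?_)
  rw [norm_smul, norm_mul, Real.norm_eq_abs, abs_of_nonneg (wq_nn hs y), Real.norm_eq_abs, abs_abs]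
  calc wq s y * |v y| * ‖y‖ = (wq s y * ‖y‖) * |v y| := by ring
    _ ≤ _ := mul_le_mul_of_nonneg_right (wq_norm hs y) (abs_nonneg _)

lemma wt_tr {κ s : ℝ} (hκ : 0 ≤ κ) (hs : 0 ≤ s) {g v : HR d} (hg : ∀ᵐ x, |g x| ≤ wt κ s x) (hv : Integrable v) (z : EE d) :
    ⟪g, tr z v⟫_ℝ ≤ (∫ x, wt κ s x * |v x|) + (-2 * ⟪bary s v, z⟫_ℝ + ‖z‖ ^ 2 * (s * ∫ x, |v x|)) := by
  have h1 : ⟪g, tr z v⟫_ℝ = ⟪tr (-z) g, v⟫_ℝ := by rw [inner_tr, neg_neg]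
  rw [h1]
  have hi1 := wt_mul_int hκ hs hv
  have hi2 : Integrable fun y => wt κ s (y - z) * |v y| := by
    refine hv.abs.bdd_mul (c := κ + 1) ((wt_cont hs).comp (by fun_prop)).aestronglyMeasurable (Eventually.of_forall fun x => ?_)
    rw [Real.norm_eq_abs, abs_of_nonneg (wt_nn hκ hs _)]; exact wt_le hs _
  refine (inner_le_int (χ := fun y => wt κ s (y - z)) ?_ hi2).trans ?_
  · filter_upwards [tr_coe (-z) g, ae_shift (-z) hg] with x h1 h2
    rw [h1, sub_eq_add_neg]; exact h2
  have hi3 : Integrable fun y => ⟪z, (wq s y * |v y|) • y⟫_ℝ := (bary_int hs hv).const_inner z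
  have hi4 := hv.abs.const_mul (‖z‖ ^ 2 * s)
  have h2 : ∫ y, ((-2) * ⟪z, (wq s y * |v y|) • y⟫_ℝ + ‖z‖ ^ 2 * s * |v y|) = -2 * ⟪bary s v, z⟫_ℝ + ‖z‖ ^ 2 * (s * ∫ x, |v x|) := by
    rw [integral_add (hi3.const_mul (-2)) hi4, integral_const_mul, integral_const_mul, integral_inner (bary_int hs hv),
      real_inner_comm, bary, mul_assoc]
  have hi5 : Integrable fun y => (-2) * ⟪z, (wq s y * |v y|) • y⟫_ℝ + ‖z‖ ^ 2 * s * |v y| := (hi3.const_mul (-2)).add hi4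
  rw [← h2, ← integral_add hi1 hi5]
  refine integral_mono hi2 (hi1.add hi5) fun y => ?_
  simp only [Pi.add_apply]
  have h3 := mul_le_mul_of_nonneg_right (wt_shift (κ := κ) hs y z) (abs_nonneg (v y))
  have h4 : wq s y * ‖z‖ ^ 2 * |v y| ≤ s * ‖z‖ ^ 2 * |v y| :=
    mul_le_mul_of_nonneg_right (mul_le_mul_of_nonneg_right (wq_le hs y) (sq_nonneg _)) (abs_nonneg _)
  rw [inner_smul_right, real_inner_comm]
  linarith

/-- second moment -/
def m2 (d : ℕ) : ℝ := ∫ z : EE d, ‖z‖ ^ 2 ∂(ProbabilityTheory.stdGaussian (EE d))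

lemma m2_nn : 0 ≤ m2 d := integral_nonneg fun z => sq_nonneg _

lemma gm_sq (h : ℝ) : Integrable (fun z : EE d => ‖z‖ ^ 2) (gm d h) ∧ ∫ z, ‖z‖ ^ 2 ∂(gm d h) = 2 * h ^ 2 * m2 d := by
  have hm : Measurable fun z : EE d => (√2 * h) • z := by fun_prop
  have e : (fun z : EE d => ‖(√2 * h) • z‖ ^ 2) = fun z => 2 * h ^ 2 * ‖z‖ ^ 2 := by
    funext z
    rw [norm_smul, Real.norm_eq_abs, mul_pow, sq_abs, mul_pow, Real.sq_sqrt (by norm_num)]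
  constructor
  · unfold gm
    rw [integrable_map_measure (by fun_prop) hm.aemeasurable]
    show Integrable (fun z : EE d => ‖(√2 * h) • z‖ ^ 2) _
    rw [e]
    exact ((ProbabilityTheory.IsGaussian.memLp_two_id (μ := ProbabilityTheory.stdGaussian (EE d))).norm.integrable_sq).const_mul _
  · unfold gm
    rw [integral_map hm.aemeasurable (by fun_prop), e, integral_const_mul, m2]

lemma wt_avg {κ s : ℝ} (hκ : 0 ≤ κ) (hs : 0 ≤ s) {g v : HR d} (hg : ∀ᵐ x, |g x| ≤ wt κ s x) (hv : Integrable v) (h : ℝ) :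
    ⟪g, avg (gm d h) v⟫_ℝ ≤ (∫ x, wt κ s x * |v x|) + 2 * h ^ 2 * m2 d * (s * ∫ x, |v x|) := by
  rw [real_inner_comm, inner_avg]
  have hlin : Integrable (fun z : EE d => ⟪bary s v, z⟫_ℝ) (gm d h) := by
    refine Integrable.mono ((integrable_const (‖bary s v‖ ^ 2)).add (gm_sq h).1) (by fun_prop) (Eventually.of_forall fun z => ?_)
    refine (abs_real_inner_le_norm _ _).trans ?_
    simp only [Pi.add_apply]
    rw [Real.norm_eq_abs, abs_of_nonneg (by positivity)]
    nlinarith [sq_nonneg (‖bary s v‖ - ‖z‖), sq_nonneg (‖bary s v‖), sq_nonneg (‖z‖)]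
  have hodd : ∫ z : EE d, ⟪bary s v, z⟫_ℝ ∂(gm d h) = 0 := by
    have h1 : ∫ z : EE d, ⟪bary s v, z⟫_ℝ ∂((gm d h).map fun z => -z) = ∫ z : EE d, ⟪bary s v, -z⟫_ℝ ∂(gm d h) :=
      integral_map (by fun_prop) (by fun_prop)
    rw [gm_symm] at h1
    simp only [inner_neg_right, integral_neg] at h1
    linarith
  have hi5 : Integrable (fun z : EE d => -2 * ⟪bary s v, z⟫_ℝ + ‖z‖ ^ 2 * (s * ∫ x, |v x|)) (gm d h) :=
    (hlin.const_mul _).add ((gm_sq h).1.mul_const _)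
  have h2 : ∫ z : EE d, ((∫ x, wt κ s x * |v x|) + (-2 * ⟪bary s v, z⟫_ℝ + ‖z‖ ^ 2 * (s * ∫ x, |v x|))) ∂(gm d h) =
      (∫ x, wt κ s x * |v x|) + 2 * h ^ 2 * m2 d * (s * ∫ x, |v x|) := by
    rw [integral_add (integrable_const _) hi5, integral_add (hlin.const_mul _) ((gm_sq h).1.mul_const _), integral_const_mul, hodd, integral_mul_const, (gm_sq h).2]
    simp
  rw [← h2]
  refine integral_mono ?_ ((integrable_const _).add hi5) fun z => ?_
  · exact Integrable.of_bound ((tr_cont _).inner continuous_const).aestronglyMeasurable (‖v‖ * ‖g‖)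
      (Eventually.of_forall fun z => (abs_real_inner_le_norm _ _).trans (by simp))
  · simp only
    rw [real_inner_comm]
    exact wt_tr hκ hs hg hv z

end wt
end FP

namespace FP
set_option linter.unusedSectionVars false
set_option linter.unusedVariables false

open scoped InnerProductSpace Topology

section ex
variable {d : ℕ} (K : Coef d)

lemma abs_mono {g : ℝ → ℝ} (hg : Monotone g) (h0 : g 0 = 0) (r : ℝ) : |g r| = SignType.sign r * g r := by
  rcases lt_trichotomy r 0 with h | h | h
  · rw [abs_of_nonpos (h0 ▸ hg h.le)]; simp [h]
  · simp [h, h0]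
  · rw [abs_of_nonneg (h0 ▸ hg h.le)]; simp [h]

lemma Coef.v0_abs {h τ : ℝ} (hh : 0 < h) (hτ : 0 ≤ τ) (hcfl : τ * (h ^ 2)⁻¹ * K.L + 2 * d * K.L * τ / h ≤ 1) (u : HR d) :
    ∀ᵐ x, |K.v0 h τ u x| = |u x| - τ * (h ^ 2)⁻¹ * |nem (fun _ => K.f) u x| - 2 * d * K.L * τ / h * |u x| := by
  filter_upwards [K.v0_coe h τ u, K.fNL.coe u] with x h1 h2
  rw [h1, h2, abs_mono (K.v0_mono hh hτ hcfl) (by simp [K.f0]) (u x), abs_mono K.f_mono K.f0]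
  have h3 := sign_mul_self (u x)
  linear_combination (1 - 2 * d * K.L * τ / h) * h3

lemma Coef.vp_abs (i : Fin d) (u : HR d) : ∀ᵐ x, |K.vp (-1) i u x| + |K.vp 1 i u x| = 2 * K.L * |u x| := by
  filter_upwards [K.vp_coe (-1) i u, K.vp_coe 1 i u] with x h1 h2
  rw [h1, h2, abs_mono (K.vp_mono (-1) (Or.inr rfl) i x) (by simp [K.B0]) (u x), abs_mono (K.vp_mono 1 (Or.inl rfl) i x) (by simp [K.B0]) (u x)]
  have h3 := sign_mul_self (u x)
  linear_combination (2 * K.L) * h3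

lemma Coef.f_int {u : HR d} (hu : Integrable u) : Integrable (nem (fun _ => K.f) u) ∧ ∫ x, |nem (fun _ => K.f) u x| ≤ K.L * ∫ x, |u x| := by
  have h : ∀ᵐ x, |nem (fun _ => K.f) u x| ≤ K.L * |u x| := by
    filter_upwards [K.fNL.coe u] with x hx
    have := K.flip' (u x) 0
    rwa [K.f0, sub_zero, sub_zero, ← hx] at this
  have h1 : Integrable (nem (fun _ => K.f) u) := (hu.abs.const_mul K.L).mono' (Lp.aestronglyMeasurable _) h
  exact ⟨h1, (integral_mono_ae h1.abs (hu.abs.const_mul K.L) h).trans (integral_const_mul _ _).le⟩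

lemma Coef.vp_int {e : ℝ} (he : e = 1 ∨ e = -1) (i : Fin d) {u : HR d} (hu : Integrable u) :
    Integrable (K.vp e i u) ∧ ∫ x, |K.vp e i u x| ≤ 2 * K.L * ∫ x, |u x| := by
  have h : ∀ᵐ x, |K.vp e i u x| ≤ 2 * K.L * |u x| := by
    filter_upwards [K.vp_abs i u] with x hx
    rcases he with rfl | rfl <;> linarith [abs_nonneg (K.vp (-1) i u x), abs_nonneg (K.vp 1 i u x)]
  have h1 : Integrable (K.vp e i u) := (hu.abs.const_mul (2 * K.L)).mono' (Lp.aestronglyMeasurable _) h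
  exact ⟨h1, (integral_mono_ae h1.abs (hu.abs.const_mul (2 * K.L)) h).trans (integral_const_mul _ _).le⟩

lemma Coef.step_L1 {h τ : ℝ} (hh : 0 < h) (hh1 : h ≤ 1) (hτ : 0 ≤ τ) (hcfl : τ * (h ^ 2)⁻¹ * K.L + 2 * d * K.L * τ / h ≤ 1)
    {κ s : ℝ} (hκ : 0 ≤ κ) (hs : 0 ≤ s) {g u : HR d} (hg : ∀ᵐ x, |g x| ≤ wt κ s x) (hu : Integrable u) :
    ⟪g, K.S hh τ u⟫_ℝ ≤ (∫ x, wt κ s x * |u x|) + τ * ((2 * m2 d * K.L + 8 * d * K.L) * (√s + s) * ∫ x, |u x|) := by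
  obtain ⟨hf, hf'⟩ := K.f_int hu
  have hv0 : Integrable (K.v0 h τ u) := by
    have := ((hu.sub (hf.const_mul (τ * (h ^ 2)⁻¹))).sub (hu.const_mul (2 * d * K.L * τ / h)))
    refine this.congr ?_
    filter_upwards [K.v0_coe h τ u, K.fNL.coe u] with x h1 h2
    simp only [Pi.sub_apply]
    rw [h1, h2]
  set I := ∫ x, |u x| with hI
  have hInn : 0 ≤ I := integral_nonneg fun x => abs_nonneg _
  set N := ∫ x, wt κ s x * |u x| with hN
  set Nf := ∫ x, wt κ s x * |nem (fun _ => K.f) u x| with hNf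
  have iN := wt_mul_int hκ hs hu
  have iNf := wt_mul_int hκ hs hf
  have h1 : ⟪g, K.v0 h τ u⟫_ℝ ≤ N - τ * (h ^ 2)⁻¹ * Nf - 2 * d * K.L * τ / h * N := by
    refine (inner_le_int hg (wt_mul_int hκ hs hv0)).trans (le_of_eq ?_)
    rw [hN, hNf, ← integral_const_mul, ← integral_const_mul]
    have i1 := iNf.const_mul (τ * (h ^ 2)⁻¹)
    have i2 := iN.const_mul (2 * d * K.L * τ / h)
    have i3 : Integrable fun x => wt κ s x * |u x| - τ * (h ^ 2)⁻¹ * (wt κ s x * |nem (fun _ => K.f) u x|) := iN.sub i1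
    rw [← integral_sub iN i1, ← integral_sub i3 i2]
    refine integral_congr_ae ?_
    filter_upwards [K.v0_abs hh hτ hcfl u] with x hx
    rw [hx]; ring
  have h2 := wt_avg hκ hs hg hf h
  have h3 : ∀ i : Fin d, ⟪g, tr (EuclideanSpace.single i h) (K.vp (-1) i u) + tr (-EuclideanSpace.single i h) (K.vp 1 i u)⟫_ℝ
      ≤ 2 * K.L * N + h * (8 * K.L * (√s + s) * I) := by
    intro i
    have key : ∀ e : ℝ, (e = 1 ∨ e = -1) → ∀ z : EE d, ‖z‖ = h →
        ⟪g, tr z (K.vp e i u)⟫_ℝ ≤ (∫ x, wt κ s x * |K.vp e i u x|) + h * (4 * K.L * (√s + s) * I) := by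
      intro e he z hz
      obtain ⟨a1, a2⟩ := K.vp_int he i hu
      have b1 := wt_tr hκ hs hg a1 z
      have b2 := (abs_le.1 (abs_real_inner_le_norm (bary s (K.vp e i u)) z)).1
      have b3 := bary_norm hs a1
      rw [hz] at b1 b2
      have b4 := mul_le_mul_of_nonneg_right b3 hh.le
      have b5 := mul_le_mul_of_nonneg_left a2 (Real.sqrt_nonneg s)
      have b6 := mul_le_mul_of_nonneg_left a2 hs
      have b7 := mul_le_mul_of_nonneg_left b6 (sq_nonneg h)
      have b8 := mul_le_mul_of_nonneg_left b5 hh.le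
      have b9 : h ^ 2 * (s * (2 * K.L * I)) ≤ h * (s * (2 * K.L * I)) := by
        have : 0 ≤ s * (2 * K.L * I) := mul_nonneg hs (mul_nonneg (mul_nonneg (by norm_num) K.Lnn) hInn)
        have h12 : h ^ 2 ≤ h := by nlinarith
        exact mul_le_mul_of_nonneg_right h12 this
      have b10 : 0 ≤ h * (s * (2 * K.L * I)) := mul_nonneg hh.le (mul_nonneg hs (mul_nonneg (mul_nonneg (by norm_num) K.Lnn) hInn))
      linarith
    have hn : ‖(EuclideanSpace.single i h : EE d)‖ = h := by
      rw [PiLp.norm_single, Real.norm_eq_abs, abs_of_pos hh]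
    rw [inner_add_right]
    have c1 := key (-1) (Or.inr rfl) _ hn
    have c2 := key 1 (Or.inl rfl) (-EuclideanSpace.single i h) (by rw [norm_neg, hn])
    have c3 : (∫ x, wt κ s x * |K.vp (-1) i u x|) + (∫ x, wt κ s x * |K.vp 1 i u x|) = 2 * K.L * N := by
      rw [hN, ← integral_const_mul, ← integral_add (wt_mul_int hκ hs (K.vp_int (Or.inr rfl) i hu).1) (wt_mul_int hκ hs (K.vp_int (Or.inl rfl) i hu).1)]
      refine integral_congr_ae ?_
      filter_upwards [K.vp_abs i u] with x hx
      linear_combination wt κ s x * hx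
    linarith
  rw [K.S_eq hh, inner_add_right, inner_add_right, inner_smul_right, inner_smul_right, inner_sum]
  have h4 : ∑ i : Fin d, ⟪g, tr (EuclideanSpace.single i h) (K.vp (-1) i u) + tr (-EuclideanSpace.single i h) (K.vp 1 i u)⟫_ℝ
      ≤ d * (2 * K.L * N + h * (8 * K.L * (√s + s) * I)) :=
    (Finset.sum_le_sum fun i _ => h3 i).trans (by rw [Finset.sum_const, Finset.card_univ, Fintype.card_fin, nsmul_eq_mul])
  have h5 := mul_le_mul_of_nonneg_left h2 (show 0 ≤ τ * (h ^ 2)⁻¹ by positivity)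
  have h6 := mul_le_mul_of_nonneg_left h4 (show 0 ≤ τ / h by positivity)
  have h7 : τ / h * (d * (2 * K.L * N + h * (8 * K.L * (√s + s) * I))) =
     2 * d * K.L * τ / h * N + τ * (8 * d * K.L * (√s + s) * I) := by field_simp
  rw [h7] at h6
  have h8 : τ * (h ^ 2)⁻¹ * (Nf + 2 * h ^ 2 * m2 d * (s * ∫ x, |nem (fun _ => K.f) u x|)) =
     τ * (h ^ 2)⁻¹ * Nf + τ * (2 * m2 d * (s * ∫ x, |nem (fun _ => K.f) u x|)) := by field_simp
  rw [← hNf, h8] at h5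
  have h9 : τ * (2 * m2 d * (s * ∫ x, |nem (fun _ => K.f) u x|)) ≤ τ * (2 * m2 d * ((√s + s) * (K.L * I))) := by
    refine mul_le_mul_of_nonneg_left (mul_le_mul_of_nonneg_left ?_ (by linarith [m2_nn (d := d)])) hτ
    refine (mul_le_mul_of_nonneg_left hf' hs).trans ?_
    exact mul_le_mul_of_nonneg_right (by linarith [Real.sqrt_nonneg s]) (mul_nonneg K.Lnn hInn)
  linarith

/-- growth constant -/
def Coef.C1 : ℝ := 2 * m2 d * K.L + 8 * d * K.L

lemma Coef.C1_nn : 0 ≤ K.C1 := by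
  have h1 := m2_nn (d := d); have h2 := K.Lnn
  unfold Coef.C1; positivity

/-- index set of linear constraints -/
abbrev Ix (d : ℕ) := (FS d × Bool) ⊕ {p : ℝ × ℝ × HR d // 0 ≤ p.1 ∧ 0 ≤ p.2.1 ∧ ∀ᵐ x, |p.2.2 x| ≤ wt p.1 p.2.1 x}

/-- sign -/
def sg (b : Bool) : ℝ := if b then 1 else -1

lemma sg_or (b : Bool) : sg b = 1 ∨ sg b = -1 := by cases b <;> simp [sg]

lemma linf_iff {k : ℝ} {u : HR d} (h : ∀ s : FS d, ∀ b, ⟪sg b • eS s, u⟫_ℝ ≤ k * volume.real s.1) (b : Bool) : ∀ᵐ x, sg b * u x ≤ k := by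
  have : ∀ᵐ x, (sg b • u) x ≤ k := le_of_eS fun s => by
    have := h s b
    rwa [inner_smul_left, conj_trivial, ← inner_smul_right] at this
  filter_upwards [this, Lp.coeFn_smul (sg b) u] with x h1 h2
  rw [h2] at h1; exact h1

theorem Coef.exists_apx {h : ℝ} (hh : 0 < h) (hh1 : h ≤ 1) {M : ℝ} (hM : 0 ≤ M) (u0 : HR d) (h0 : ∀ᵐ x, |u0 x| ≤ M) (hi : Integrable u0) :
    ∃ u, (K.apx hh).IsSol u0 u ∧ ∀ t, 0 ≤ t → (∀ s : FS d, ∀ b, ⟪sg b • eS s, u t⟫_ℝ ≤ M * Real.exp (d * K.c * t) * volume.real s.1) ∧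
      ∀ κ s : ℝ, 0 ≤ κ → 0 ≤ s → ∀ g : HR d, (∀ᵐ x, |g x| ≤ wt κ s x) →
       ⟪g, u t⟫_ℝ ≤ (∫ x, wt κ s x * |u0 x|) + K.C1 * (√s + s) * (∫ x, |u0 x|) * t := by
  set l : ℝ := (h ^ 2)⁻¹ * K.L + 2 * d * K.L / h + 1 with hl
  have hLn := K.Lnn
  have hl0 : 0 < l := by positivity
  have hcfl : l⁻¹ * (h ^ 2)⁻¹ * K.L + 2 * d * K.L * l⁻¹ / h ≤ 1 := by
    have : l⁻¹ * (h ^ 2)⁻¹ * K.L + 2 * d * K.L * l⁻¹ / h = (l - 1) / l := by rw [hl]; field_simp; ring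
    rw [this, div_le_one hl0]; linarith
  have hτ : 0 ≤ l⁻¹ := by positivity
  obtain ⟨LF, hLF0, hLF⟩ : ∃ LF, 0 ≤ LF ∧ ∀ x y, ‖(K.apx hh).F x - (K.apx hh).F y‖ ≤ LF * ‖x - y‖ := by
    let a := K.apx hh
    refine ⟨‖a.A‖ * K.dat.L + ∑ i, ‖a.D i‖ * K.dat.L + ‖a.V‖, ?_, fun x y => ?_⟩
    · have := K.dat.Lnonneg
      positivity
    have e : a.F x - a.F y = -a.A (K.dat.f x - K.dat.f y) - ∑ i, a.D i (K.dat.b i x - K.dat.b i y) + a.V (x - y) := by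
      unfold Apx.F
      simp only [map_sub, Finset.sum_sub_distrib]
      abel
    show ‖a.F x - a.F y‖ ≤ _
    rw [e]
    refine (norm_add_le _ _).trans ?_
    rw [add_mul, add_mul, Finset.sum_mul]
    refine add_le_add ((norm_sub_le _ _).trans (add_le_add ?_ ((norm_sum_le _ _).trans (Finset.sum_le_sum fun i _ => ?_)))) (a.V.le_opNorm _)
    · rw [norm_neg, mul_assoc]
      exact (a.A.le_opNorm _).trans (mul_le_mul_of_nonneg_left (K.dat.flip x y) (norm_nonneg _))
    · rw [mul_assoc]
      exact ((a.D i).le_opNorm _).trans (mul_le_mul_of_nonneg_left (K.dat.blip i x y) (norm_nonneg _))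
  let a := ∫ x, |u0 x|
  let g : Ix d → HR d := fun i => match i with
    | Sum.inl p => sg p.2 • eS p.1
    | Sum.inr p => p.1.2.2
  let ρ : Ix d → ℝ → ℝ := fun i t => match i with
    | Sum.inl p => M * Real.exp (d * K.c * t) * volume.real p.1.1
    | Sum.inr p => (∫ x, wt p.1.1 p.1.2.1 x * |u0 x|) + K.C1 * (√p.1.2.1 + p.1.2.1) * a * t
  let ρ' : Ix d → ℝ → ℝ := fun i t => match i with
    | Sum.inl p => M * (Real.exp (d * K.c * t) * (d * K.c)) * volume.real p.1.1
    | Sum.inr p => K.C1 * (√p.1.2.1 + p.1.2.1) * a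
  have hcnn := K.cnn
  have hC1 := K.C1_nn
  have ha : 0 ≤ a := integral_nonneg fun x => abs_nonneg _
  have hsS : ∀ x y, ‖K.S hh l⁻¹ x - K.S hh l⁻¹ y‖ ≤ (1 + l⁻¹ * LF) * ‖x - y‖ := fun x y => by
    have e : K.S hh l⁻¹ x - K.S hh l⁻¹ y = (x - y) + l⁻¹ • ((K.apx hh).F x - (K.apx hh).F y) := by
      unfold Coef.S; module
    rw [e]
    refine (norm_add_le _ _).trans ?_
    rw [norm_smul, Real.norm_eq_abs, abs_of_nonneg hτ]
    have := mul_le_mul_of_nonneg_left (hLF x y) hτ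
    linarith
  obtain ⟨u, hu0, hu1, hu2⟩ := ode_inv (S := K.S hh l⁻¹) (K := 1 + l⁻¹ * LF) (by positivity) hsS hl0 g ρ ρ' (by
      rintro (p | p) t
      · have h1 : HasDerivAt (fun t : ℝ => d * K.c * t) (d * K.c) t := by simpa using (hasDerivAt_id t).const_mul (d * K.c)
        exact ((h1.exp).const_mul M).mul_const _
      · have h1 := ((hasDerivAt_id t).const_mul (K.C1 * (√p.1.2.1 + p.1.2.1) * a)).const_add (∫ x, wt p.1.1 p.1.2.1 x * |u0 x|)
        rw [mul_one] at h1
        exact h1) (by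
      rintro (p | p)
      · simp only [ρ']; fun_prop
      · simp only [ρ']; fun_prop) u0 (by
      rintro (p | p)
      · simp only [g, ρ, mul_zero, Real.exp_zero, mul_one]
        rw [inner_smul_left, conj_trivial]
        refine eS_le' ?_ _
        filter_upwards [h0] with x hx
        rcases sg_or p.2 with h | h <;> rw [h] <;> linarith [abs_le.1 hx]
      · simp only [g, ρ, mul_zero, add_zero]
        exact inner_le_int p.2.2.2 (wt_mul_int p.2.1 p.2.2.1 hi)) (by
      rintro (p | p) t ht
      · simp only [ρ]
        gcongr
      · simp only [ρ]
        have := p.2.2.1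
        have : 0 ≤ K.C1 * (√p.1.2.1 + p.1.2.1) * a * t := by positivity
        simpa) (by
      intro t ht x hx i
      have hinf : ∀ b, ∀ᵐ y, sg b * x y ≤ M * Real.exp (d * K.c * t) := linf_iff fun s b => hx (Sum.inl (s, b))
      have hw : ∀ κ s : ℝ, 0 ≤ κ → 0 ≤ s → Integrable (fun y => wt κ s y * |x y|) ∧
         ∫ y, wt κ s y * |x y| ≤ (∫ x, wt κ s x * |u0 x|) + K.C1 * (√s + s) * a * t := fun κ s hκ hs =>
        wt_int (wt_cont hs) (wt_nn hκ hs) (wt_le hs) fun g' hg' => hx (Sum.inr ⟨(κ, s, g'), hκ, hs, hg'⟩)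
      have h10 := hw 1 0 zero_le_one le_rfl
      have e10 : ∀ y : EE d, wt 1 0 y = 1 := fun y => by simp [wt]
      simp only [e10, one_mul, Real.sqrt_zero, add_zero, mul_zero, zero_mul] at h10
      have hxi : Integrable x := (integrable_norm_iff (Lp.aestronglyMeasurable x)).1 h10.1
      rcases i with p | p
      · have := K.step_inf hh hτ hcfl (sg_or p.2) (by positivity) (hinf p.2) p.1
        simp only [g, ρ, ρ']
        rw [inner_smul_left, conj_trivial]
        refine this.trans (le_of_eq ?_)
        ring
      · have := K.step_L1 hh hh1 hτ hcfl p.2.1 p.2.2.1 p.2.2.2 hxi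
        have h2 := (hw _ _ p.2.1 p.2.2.1).2
        simp only [g, ρ, ρ']
        refine this.trans (add_le_add h2 (mul_le_mul_of_nonneg_left ?_ hτ))
        have := p.2.2.1
        exact mul_le_mul_of_nonneg_left h10.2 (by positivity))
  refine ⟨u, ⟨hu0, fun t ht => ?_⟩, fun t ht => ⟨fun s b => hu2 t ht (Sum.inl (s, b)), fun κ s hκ hs g' hg' => hu2 t ht (Sum.inr ⟨(κ, s, g'), hκ, hs, hg'⟩)⟩⟩
  refine (hu1 t ht).congr_deriv ?_
  unfold Coef.S
  rw [add_sub_cancel_left, smul_smul, mul_inv_cancel₀ hl0.ne', one_smul]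

theorem Coef.exists_sol {M : ℝ} (hM : 0 ≤ M) (u0 : HR d) (h0 : ∀ᵐ x, |u0 x| ≤ M) (hi : Integrable u0) :
    ∃ U : ℝ → HR d, (∀ T, 0 ≤ T → K.dat.HSol T u0 U) ∧ ∀ t, 0 ≤ t → (∀ᵐ x, |U t x| ≤ M * Real.exp (d * K.c * t)) ∧ Integrable (U t) ∧
      (∫ x, |U t x|) ≤ (∫ x, |u0 x|) ∧ ∀ s, 0 ≤ s →
       ∫ x, wt 0 s x * |U t x| ≤ (∫ x, wt 0 s x * |u0 x|) + K.C1 * (√s + s) * (∫ x, |u0 x|) * t := by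
  have hh : ∀ n : ℕ, (0 : ℝ) < (1 / 2 : ℝ) ^ n := fun n => by positivity
  choose u hu hu' using fun n : ℕ => K.exists_apx (hh n) (pow_le_one₀ (by norm_num) (by norm_num)) hM u0 h0 hi
  obtain ⟨U, hU, hU2⟩ := limit (C := 2 + K.L) (by linarith [K.Lnn]) (fun n => K.apx (hh n)) hu
  refine ⟨U, hU2, fun t ht => ?_⟩
  have lim : ∀ g : HR d, ∀ R, (∀ n, ⟪g, u n t⟫_ℝ ≤ R) → ⟪g, U t⟫_ℝ ≤ R := fun g R h => by
    rw [real_inner_comm]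
    refine le_of_tendsto (hU t ht g) (Eventually.of_forall fun n => ?_)
    rw [real_inner_comm]; exact h n
  have h1 := linf_iff (u := U t) fun s b => lim _ _ fun n => (hu' n t ht).1 s b
  have hw : ∀ κ s : ℝ, 0 ≤ κ → 0 ≤ s → Integrable (fun y => wt κ s y * |U t y|) ∧
      ∫ y, wt κ s y * |U t y| ≤ (∫ x, wt κ s x * |u0 x|) + K.C1 * (√s + s) * (∫ x, |u0 x|) * t := fun κ s hκ hs =>
    wt_int (wt_cont hs) (wt_nn hκ hs) (wt_le hs) fun g' hg' => lim _ _ fun n => (hu' n t ht).2 κ s hκ hs g' hg'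
  have h10 := hw 1 0 zero_le_one le_rfl
  have e10 : ∀ y : EE d, wt 1 0 y = 1 := fun y => by simp [wt]
  simp only [e10, one_mul, Real.sqrt_zero, add_zero, mul_zero, zero_mul] at h10
  refine ⟨?_, (integrable_norm_iff (Lp.aestronglyMeasurable _)).1 h10.1, h10.2, fun s hs => (hw 0 s le_rfl hs).2⟩
  filter_upwards [h1 true, h1 false] with x a b
  simp only [sg, if_true, Bool.false_eq_true, if_false] at a b
  exact abs_le.2 ⟨by linarith, by linarith⟩

end ex
end FP

namespace FP
set_option linter.unusedSectionVars false
set_option linter.unusedVariables false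

open scoped InnerProductSpace Topology BoundedContinuousFunction FourierTransform SchwartzMap ContDiff LineDeriv
variable {d : ℕ}

/-- test functions -/
def TF (φ : EE d → ℝ) : Prop := ContDiff ℝ ∞ φ ∧ HasCompactSupport φ

def pd (i : Fin d) (φ : EE d → ℝ) (x : EE d) : ℝ := fderiv ℝ φ x (EuclideanSpace.single i 1)

lemma lap_eq (φ : EE d → ℝ) (x : EE d) : lap φ x = ∑ i, pd i (pd i φ) x := rfl

lemma TF.pd {φ : EE d → ℝ} (h : TF φ) (i : Fin d) : TF (pd i φ) := by
  refine ⟨?_, h.2.fderiv_apply ℝ _⟩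
  have := h.1.fderiv_right (m := ∞) (by simp)
  exact this.clm_apply contDiff_const

lemma TF.add {φ ψ : EE d → ℝ} (h : TF φ) (h' : TF ψ) : TF (fun x => φ x + ψ x) := ⟨h.1.add h'.1, h.2.add h'.2⟩
lemma TF.smul {φ : EE d → ℝ} (h : TF φ) (c : ℝ) : TF (fun x => c * φ x) := ⟨contDiff_const.mul h.1, h.2.mul_left⟩
lemma TF.sub {φ ψ : EE d → ℝ} (h : TF φ) (h' : TF ψ) : TF (fun x => φ x - ψ x) := ⟨h.1.sub h'.1, h.2.sub h'.2⟩

lemma TF.sum {φ : Fin d → EE d → ℝ} (h : ∀ i, TF (φ i)) (s : Finset (Fin d)) : TF (fun x => ∑ i ∈ s, φ i x) := by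
  classical
  induction s using Finset.induction_on with
  | empty => simp only [Finset.sum_empty]; exact ⟨contDiff_const, HasCompactSupport.zero⟩
  | insert a s ha ih => simp only [Finset.sum_insert ha]; exact (h a).add ih

lemma TF.lap {φ : EE d → ℝ} (h : TF φ) : TF (lap φ) := TF.sum (fun i => (h.pd i).pd i) _

/-- total `L²` class -/
def ct (φ : EE d → ℝ) : HR d := by
  classical exact if h : MemLp φ 2 volume then h.toLp φ else 0

lemma ct_coe {φ : EE d → ℝ} (h : MemLp φ 2 volume) : ct φ =ᵐ[volume] φ := by
  unfold ct; rw [dif_pos h]; exact h.coeFn_toLp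

lemma TF.memLp {φ : EE d → ℝ} (h : TF φ) : MemLp φ 2 volume := h.1.continuous.memLp_of_hasCompactSupport h.2

lemma TF.coe {φ : EE d → ℝ} (h : TF φ) : ct φ =ᵐ[volume] φ := ct_coe h.memLp

lemma TF.tr {φ : EE d → ℝ} (h : TF φ) (z : EE d) : TF (fun x => φ (x + z)) :=
  ⟨h.1.comp (contDiff_id.add contDiff_const), h.2.comp_homeomorph (Homeomorph.addRight z)⟩

/-- complex Schwartz version -/
def TF.S {φ : EE d → ℝ} (h : TF φ) : 𝓢(EE d, ℂ) :=
  HasCompactSupport.toSchwartzMap (f := fun x => (φ x : ℂ)) (h.2.comp_left (g := fun r : ℝ => (r : ℂ)) (by simp))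
    (Complex.ofRealCLM.contDiff.comp h.1)

lemma TF.hat {φ : EE d → ℝ} (h : TF φ) : ∀ᵐ ξ, hat (ct φ) ξ = (𝓕 h.S) ξ := by
  have : iC (ct φ) = h.S.toLp 2 := by
    refine Lp.ext ?_
    filter_upwards [iC_coe (ct φ), h.coe, h.S.coeFn_toLp 2] with x h1 h2 h3
    rw [h1, h2, h3]; rfl
  rw [hat_apply, this, SchwartzMap.toLp_fourier_eq]
  exact SchwartzMap.coeFn_toLp (𝓕 h.S) 2 volume

lemma TF.hat_pd {φ : EE d → ℝ} (h : TF φ) (i : Fin d) :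
    ∀ᵐ ξ, FP.hat (ct (FP.pd i φ)) ξ = (th i ξ : ℂ) * Complex.I * FP.hat (ct φ) ξ := by
  have e : (h.pd i).S = ∂_{(EuclideanSpace.single i 1 : EE d)} h.S := by
    ext x
    rw [SchwartzMap.lineDerivOp_apply_eq_fderiv]
    have := (Complex.ofRealCLM.hasFDerivAt.comp x ((h.1.differentiable (by simp)) x).hasFDerivAt).fderiv
    exact (congrArg (fun A => A (EuclideanSpace.single i 1 : EE d)) this).symm
  filter_upwards [h.hat, (h.pd i).hat] with ξ h1 h2
  rw [h1, h2, e, SchwartzMap.fourier_lineDerivOp_eq]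
  have : (fun x : EE d => inner ℝ x (EuclideanSpace.single i 1 : EE d)).HasTemperateGrowth :=
    ((innerSL ℝ).flip (EuclideanSpace.single i 1 : EE d)).hasTemperateGrowth
  rw [_root_.smul_apply, SchwartzMap.smulLeftCLM_apply_apply this]
  simp [th, EuclideanSpace.inner_single_right]
  ring

/-- `φ - Δφ` -/
def SS (φ : EE d → ℝ) : HR d := ct (fun x => φ x - lap φ x)

lemma TF.SS_coe {φ : EE d → ℝ} (h : TF φ) : SS φ =ᵐ[volume] fun x => φ x - _root_.lap φ x := (h.sub h.lap).coe

lemma TF.SS_eq {φ : EE d → ℝ} (h : TF φ) : SS φ = ct φ - ∑ i, ct (FP.pd i (FP.pd i φ)) := by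
  refine Lp.ext ?_
  filter_upwards [h.SS_coe, Lp.coeFn_sub (ct φ) (∑ i, ct (FP.pd i (FP.pd i φ))), h.coe,
    Lp.coeFn_finsetSum Finset.univ (fun i => ct (FP.pd i (FP.pd i φ))), 
    ae_all_iff.2 fun i => ((h.pd i).pd i).coe] with x h1 h2 h3 h4 h5
  rw [h1, h2, Pi.sub_apply, h3, h4, lap_eq, Finset.sum_apply]
  congr 1
  exact Finset.sum_congr rfl fun i _ => (h5 i).symm

lemma TF.hat_SS {φ : EE d → ℝ} (h : TF φ) :
    ∀ᵐ ξ, FP.hat (SS φ) ξ = ((1 + fx ξ : ℝ) : ℂ) * FP.hat (ct φ) ξ := by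
  rw [h.SS_eq, map_sub, map_sum]
  filter_upwards [Lp.coeFn_sub (FP.hat (ct φ)) (∑ i, FP.hat (ct (FP.pd i (FP.pd i φ)))), 
    Lp.coeFn_finsetSum Finset.univ (fun i => FP.hat (ct (FP.pd i (FP.pd i φ)))),
    ae_all_iff.2 fun i => h.hat_pd i, ae_all_iff.2 fun i => (h.pd i).hat_pd i] with ξ h1 h2 h3 h4
  rw [h1, Pi.sub_apply, h2, Finset.sum_apply]
  simp_rw [h4, h3, ← th_sum]
  push_cast
  have : ∀ i, (th i ξ : ℂ) * Complex.I * ((th i ξ : ℂ) * Complex.I * FP.hat (ct φ) ξ) = - ((th i ξ : ℂ) ^ 2 * FP.hat (ct φ) ξ) := by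
    intro i; linear_combination ((th i ξ : ℂ) ^ 2 * FP.hat (ct φ) ξ) * Complex.I_sq
  simp_rw [this, Finset.sum_neg_distrib, ← Finset.sum_mul]; ring

lemma TF.mulJ {φ : EE d → ℝ} (h : TF φ) : mulL (js d) (FP.hat (SS φ)) = FP.hat (ct φ) := by
  refine Lp.ext ?_
  filter_upwards [mulL_coe (js d) (FP.hat (SS φ)), h.hat_SS] with ξ h1 h2
  have : (1 + fx ξ) ≠ 0 := by have := fx_nonneg ξ; positivity
  rw [h1, h2, js_apply, ← mul_assoc, ← Complex.ofReal_mul, inv_mul_cancel₀ this]; simp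

lemma TF.J {φ : EE d → ℝ} (h : TF φ) : Jop d (SS φ) = ct φ := by
  rw [Jop, Op_apply, h.mulJ, back_hat]

lemma TF.T {φ : EE d → ℝ} (h : TF φ) (i : Fin d) : Top i (SS φ) = ct (FP.pd i φ) := by
  have : mulL (ts i) (FP.hat (SS φ)) = FP.hat (ct (FP.pd i φ)) := by
    refine Lp.ext ?_
    filter_upwards [mulL_coe (ts i) (FP.hat (SS φ)), h.hat_SS, h.hat_pd i] with ξ h1 h2 h3
    have : (1 + fx ξ) ≠ 0 := by have := fx_nonneg ξ; positivity
    have e : (((1 + fx ξ)⁻¹ : ℝ) : ℂ) * ((1 + fx ξ : ℝ) : ℂ) = 1 := by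
      rw [← Complex.ofReal_mul, inv_mul_cancel₀ this]; simp
    rw [h1, h2, h3, ts_apply, Complex.ofReal_mul]
    linear_combination (th i ξ : ℂ) * Complex.I * FP.hat (ct φ) ξ * e
  rw [Top, Op_apply, this, back_hat]

lemma tr_fun (φ : EE d → ℝ) (z : EE d) (i : Fin d) : pd i (fun x => φ (x + z)) = fun x => pd i φ (x + z) := by
  funext x; unfold pd; rw [fderiv_comp_add_right]

lemma lap_tr (φ : EE d → ℝ) (z : EE d) (x : EE d) : lap (fun x => φ (x + z)) x = lap φ (x + z) := by
  simp_rw [lap_eq, tr_fun]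

lemma TF.SS_tr {φ : EE d → ℝ} (h : TF φ) (z : EE d) : FP.tr z (SS φ) = SS (fun x => φ (x + z)) := by
  refine Lp.ext ?_
  filter_upwards [tr_coe z (SS φ), ae_shift z h.SS_coe, (h.tr z).SS_coe] with x h1 h2 h3
  rw [h1, h2, h3, lap_tr]

lemma inner_ct {φ : EE d → ℝ} (h : MemLp φ 2 volume) (v : HR d) : ⟪v, ct φ⟫_ℝ = ∫ x, v x * φ x := by
  rw [L2.inner_def]
  refine integral_congr_ae ?_
  filter_upwards [ct_coe h] with x hx
  rw [hx]; simp [mul_comm]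

lemma zero_of_ct (v : HR d) (h : ∀ φ : EE d → ℝ, TF φ → ⟪v, ct φ⟫_ℝ = 0) : v = 0 := by
  refine Lp.ext ?_
  refine EventuallyEq.trans ?_ (Lp.coeFn_zero _ _ _).symm
  refine ae_eq_zero_of_integral_contDiff_smul_eq_zero ?_ ?_
  · exact (Lp.memLp v).locallyIntegrable (by norm_num)
  · intro g hg hc
    have h1 : TF g := ⟨hg, hc⟩
    have := h g h1
    rw [inner_ct h1.memLp] at this
    simpa [mul_comm] using this

lemma one_add_fx_gs (ξ : EE d) : ‖((1 + fx ξ : ℝ) : ℂ) * gs d 1 ξ‖ ≤ 1 := by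
  rw [gs_apply, ← Complex.ofReal_mul, Complex.norm_real]
  have h0 := fx_nonneg ξ
  have e : (1:ℝ) ^ 2 * (4 * Real.pi ^ 2 * ‖ξ‖ ^ 2) = fx ξ := by unfold fx; ring
  rw [e, Real.norm_of_nonneg (by positivity), Real.exp_neg, ← div_eq_mul_inv, div_le_one (Real.exp_pos _)]
  linarith [Real.add_one_le_exp (fx ξ)]

def ws (d : ℕ) : EE d →ᵇ ℂ := bc (fun ξ => ((1 + fx ξ : ℝ) : ℂ) * gs d 1 ξ)
  (by unfold fx; fun_prop) 1 one_add_fx_gs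

lemma zero_of_SS (v : HR d) (h : ∀ φ : EE d → ℝ, TF φ → ⟪v, SS φ⟫_ℝ = 0) : v = 0 := by
  have hs : js d * ws d = gs d 1 := by
    ext ξ
    have : (1 + fx ξ) ≠ 0 := by have := fx_nonneg ξ; positivity
    change js d ξ * (((1 + fx ξ : ℝ) : ℂ) * gs d 1 ξ) = _
    rw [js_apply, ← mul_assoc, ← Complex.ofReal_mul, inv_mul_cancel₀ this]; simp
  have key : ∀ φ : EE d → ℝ, TF φ → ⟪avg (gm d 1) v, SS φ⟫_ℝ = 0 := by
    intro φ hφ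
    rw [inner_avg]
    refine integral_eq_zero_of_ae (Eventually.of_forall fun z => ?_)
    simp only [Pi.zero_apply]
    rw [inner_tr, hφ.SS_tr, h _ (hφ.tr _)]
  have w0 : Op (ws d) v = 0 := zero_of_ct _ fun φ hφ => by
    rw [Op_quad, ← hφ.mulJ, ← star_js, ← inner_mulL, ← mulL_mul, hs, ← sym_gm, inner_hat, key φ hφ]
  have h2 : ⟪Op (ws d) v, v⟫_ℝ = 0 := by rw [w0, inner_zero_left]
  have hp : ∀ ξ, 0 < (ws d ξ).re := by
    intro ξ
    change 0 < (((1 + fx ξ : ℝ) : ℂ) * gs d 1 ξ).re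
    have := fx_nonneg ξ
    rw [gs_apply, ← Complex.ofReal_mul, Complex.ofReal_re]; positivity
  rw [Op_quad, re_inner_mulL, integral_eq_zero_iff_of_nonneg] at h2
  · apply hat_inj
    rw [Lp.eq_zero_iff_ae_eq_zero]
    filter_upwards [h2] with ξ hξ
    have h3 := (mul_eq_zero.1 hξ).resolve_left (hp ξ).ne'
    simpa using h3
  · intro ξ; have := (hp ξ).le; simp only [Pi.zero_apply]; positivity
  · exact int_mulL _ _

end FP

namespace FP
set_option linter.unusedSectionVars false
set_option linter.unusedVariables false

open scoped InnerProductSpace Topology ContDiff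
variable {d : ℕ}

lemma normsq_ct {θ : EE d → ℝ} (h : MemLp θ 2 volume) : ‖ct θ‖ ^ 2 = ∫ x, θ x ^ 2 := by
  rw [← real_inner_self_eq_norm_sq, inner_ct h]
  refine integral_congr_ae ?_
  filter_upwards [ct_coe h] with x hx
  rw [hx]; ring

lemma ct_sub {θ η : EE d → ℝ} (h : MemLp θ 2 volume) (h' : MemLp η 2 volume) :
    ct (fun x => θ x - η x) = ct θ - ct η := by
  refine Lp.ext ?_
  filter_upwards [Lp.coeFn_sub (ct θ) (ct η), ct_coe h, ct_coe h', ct_coe (h.sub h')] with x h1 h2 h3 h4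
  rw [h1, Pi.sub_apply, h2, h3]; exact h4

lemma ct_smul {θ : EE d → ℝ} (h : MemLp θ 2 volume) (c : ℝ) : ct (fun x => c * θ x) = c • ct θ := by
  refine Lp.ext ?_
  filter_upwards [Lp.coeFn_smul c (ct θ), ct_coe h, ct_coe (h.const_mul c)] with x h1 h2 h3
  rw [h1, Pi.smul_apply, h2, h3]; rfl

lemma ct_small {θ : EE d → ℝ} (h : MemLp θ 2 volume) {ρ ε : ℝ} (hε : 0 ≤ ε) (h1 : ∀ x, |θ x| ≤ ε)
    (h2 : ∀ x, ρ < ‖x‖ → θ x = 0) : ‖ct θ‖ ≤ ε * √(volume.real (Metric.closedBall (0 : EE d) ρ)) := by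
  have hfin : volume (Metric.closedBall (0 : EE d) ρ) ≠ ⊤ := measure_closedBall_lt_top.ne
  refine le_of_sq_le_sq ?_ (by positivity)
  rw [normsq_ct h, mul_pow, Real.sq_sqrt measureReal_nonneg]
  have : ∫ x, (Metric.closedBall (0 : EE d) ρ).indicator (fun _ => ε ^ 2) x = ε ^ 2 * volume.real (Metric.closedBall (0 : EE d) ρ) := by
    rw [integral_indicator Metric.isClosed_closedBall.measurableSet]; simp [mul_comm]
  rw [← this]
  refine integral_mono h.integrable_sq ?_ fun x => ?_
  · exact (integrable_indicator_iff Metric.isClosed_closedBall.measurableSet).2 (integrableOn_const hfin)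
  · by_cases hx : x ∈ Metric.closedBall (0 : EE d) ρ
    · simp only [indicator_of_mem hx]; exact sq_le_sq.2 ((h1 x).trans (le_abs_self _))
    · simp only [indicator_of_notMem hx]; rw [h2 x (by simpa using hx)]; simp

/-- space-time test functions -/
def TF2 (Φ : ℝ × EE d → ℝ) : Prop := ContDiff ℝ ∞ Φ ∧ HasCompactSupport Φ

lemma TF2.D {Φ : ℝ × EE d → ℝ} (h : TF2 Φ) (v : ℝ × EE d) : TF2 (fun p => fderiv ℝ Φ p v) :=
  ⟨(h.1.fderiv_right (m := ∞) (by simp)).clm_apply contDiff_const, h.2.fderiv_apply ℝ _⟩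

lemma TF2.supp {Φ : ℝ × EE d → ℝ} (h : TF2 Φ) : ∃ ρ, ∀ p ∈ tsupport Φ, ‖p‖ ≤ ρ := by
  obtain ⟨ρ, hρ⟩ := (Metric.isBounded_iff_subset_closedBall (0 : ℝ × EE d)).1 h.2.isBounded
  exact ⟨ρ, fun p hp => by simpa using hρ hp⟩

lemma TF2.slice {Φ : ℝ × EE d → ℝ} (h : TF2 Φ) (t : ℝ) : TF (fun x => Φ (t, x)) := by
  refine ⟨h.1.comp (contDiff_const.prodMk contDiff_id), ?_⟩
  obtain ⟨ρ, hρ⟩ := h.supp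
  refine HasCompactSupport.intro (isCompact_closedBall (0 : EE d) ρ) fun x hx => ?_
  by_contra hc
  have := hρ (t, x) (subset_tsupport _ hc)
  have h2 := (norm_snd_le (t, x)).trans this
  simp at hx h2; linarith

lemma TF2.hasDeriv_t {Φ : ℝ × EE d → ℝ} (h : TF2 Φ) (t : ℝ) (x : EE d) :
    HasDerivAt (fun s => Φ (s, x)) (fderiv ℝ Φ (t, x) (1, 0)) t := by
  have h1 := ((h.1.differentiable (by simp)) (t, x)).hasFDerivAt
  have h2 : HasDerivAt (fun s : ℝ => (s, x)) ((1 : ℝ), (0 : EE d)) t := (hasDerivAt_id t).prodMk (hasDerivAt_const t x)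
  exact h1.comp_hasDerivAt t h2

lemma TF2.pd {Φ : ℝ × EE d → ℝ} (h : TF2 Φ) (t : ℝ) (i : Fin d) :
    pd i (fun x => Φ (t, x)) = fun x => fderiv ℝ Φ (t, x) (0, EuclideanSpace.single i 1) := by
  funext x
  have h1 := ((h.1.differentiable (by simp)) (t, x)).hasFDerivAt
  have h2 : HasFDerivAt (fun y : EE d => (t, y)) (ContinuousLinearMap.inr ℝ ℝ (EE d)) x := hasFDerivAt_prodMk_right t x
  have := (h1.comp x h2).fderiv
  unfold FP.pd
  exact (congrArg (fun A => A (EuclideanSpace.single i 1 : EE d)) this)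

def Lap2 (Φ : ℝ × EE d → ℝ) (p : ℝ × EE d) : ℝ :=
  ∑ i, fderiv ℝ (fun q => fderiv ℝ Φ q (0, EuclideanSpace.single i 1)) p (0, EuclideanSpace.single i 1)

lemma TF2.lap {Φ : ℝ × EE d → ℝ} (h : TF2 Φ) (t : ℝ) (x : EE d) :
    lap (fun x => Φ (t, x)) x = Lap2 Φ (t, x) := by
  simp_rw [lap_eq, h.pd, (h.D _).pd]; rfl

lemma TF2.sub {Φ Ψ : ℝ × EE d → ℝ} (h : TF2 Φ) (h' : TF2 Ψ) : TF2 (fun x => Φ x - Ψ x) := ⟨h.1.sub h'.1, h.2.sub h'.2⟩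

lemma TF2.lap2 {Φ : ℝ × EE d → ℝ} (h : TF2 Φ) : TF2 (Lap2 Φ) := by
  classical
  have : ∀ s : Finset (Fin d), TF2 (fun p => ∑ i ∈ s, fderiv ℝ (fun q => fderiv ℝ Φ q (0, EuclideanSpace.single i 1)) p (0, EuclideanSpace.single i 1)) := by
    intro s
    induction s using Finset.induction_on with
    | empty => simp only [Finset.sum_empty]; exact ⟨contDiff_const, HasCompactSupport.zero⟩
    | insert a s ha ih =>
      simp only [Finset.sum_insert ha]
      have h1 := (h.D (0, EuclideanSpace.single a 1)).D (0, EuclideanSpace.single a 1)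
      exact ⟨h1.1.add ih.1, h1.2.add ih.2⟩
  exact this _

lemma TF2.hasDeriv {Φ : ℝ × EE d → ℝ} (h : TF2 Φ) (t : ℝ) :
    HasDerivAt (fun s => ct (fun x => Φ (s, x))) (ct (fun x => fderiv ℝ Φ (t, x) (1, 0))) t := by
  obtain ⟨ρ, hρ⟩ := h.supp
  have hD := h.D (1, 0)
  set N := √(volume.real (Metric.closedBall (0 : EE d) ρ))
  have hN : 0 ≤ N := Real.sqrt_nonneg _
  have hz : ∀ s x, ρ < ‖x‖ → (s, x) ∉ tsupport Φ := by
    intro s x hx hc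
    have := (norm_snd_le (s, x)).trans (hρ _ hc)
    simp at this; linarith
  have huc : UniformContinuous (fun p => fderiv ℝ Φ p (1, 0)) := hD.2.uniformContinuous_of_continuous hD.1.continuous
  rw [hasDerivAt_iff_isLittleO, Asymptotics.isLittleO_iff]
  intro c hc
  obtain ⟨δ, hδ, hδ2⟩ := Metric.uniformContinuous_iff.1 huc (c / (N + 1)) (by positivity)
  filter_upwards [Metric.ball_mem_nhds t hδ] with s hs
  have e1 : ct (fun x => Φ (s, x)) - ct (fun x => Φ (t, x)) - (s - t) • ct (fun x => fderiv ℝ Φ (t, x) (1, 0))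
      = ct (fun x => (Φ (s, x) - Φ (t, x)) - (s - t) * fderiv ℝ Φ (t, x) (1, 0)) := by
    have m1 := (h.slice s).memLp; have m2 := (h.slice t).memLp
    have m3 := (hD.slice t).memLp
    rw [ct_sub (θ := fun x => Φ (s, x) - Φ (t, x)) (m1.sub m2) (m3.const_mul _), ct_sub m1 m2, ct_smul m3]
  rw [e1]
  have := ct_small (θ := fun x => (Φ (s, x) - Φ (t, x)) - (s - t) * fderiv ℝ Φ (t, x) (1, 0)) 
    (((h.slice s).memLp.sub (h.slice t).memLp).sub ((hD.slice t).memLp.const_mul _)) (ρ := ρ) 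
    (ε := c / (N + 1) * |s - t|) (by positivity) ?_ ?_
  · refine this.trans ?_
    rw [Real.norm_eq_abs]
    have h1 : c / (N + 1) * N ≤ c := by
      rw [div_mul_eq_mul_div, div_le_iff₀ (by positivity)]; nlinarith
    calc c / (N + 1) * |s - t| * N = c / (N + 1) * N * |s - t| := by ring
      _ ≤ _ := mul_le_mul_of_nonneg_right h1 (abs_nonneg _)
  · intro x
    have hd : ∀ r ∈ Metric.ball t δ, HasDerivWithinAt (fun r => Φ (r, x) - r * fderiv ℝ Φ (t, x) (1, 0))
        (fderiv ℝ Φ (r, x) (1, 0) - 1 * fderiv ℝ Φ (t, x) (1, 0)) (Metric.ball t δ) r := fun r _ =>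
      ((h.hasDeriv_t r x).sub ((hasDerivAt_id r).mul_const _)).hasDerivWithinAt
    have := Convex.norm_image_sub_le_of_norm_hasDerivWithin_le hd (C := c / (N + 1)) ?_ (convex_ball t δ) (Metric.mem_ball_self hδ) hs
    · simp only [Real.norm_eq_abs] at this
      convert this using 2; ring
    · intro r hr
      have := hδ2 (a := (r, x)) (b := (t, x)) (by simpa [Prod.dist_eq] using hr)
      rw [one_mul]; exact this.le
  · intro x hx
    have a1 := image_eq_zero_of_notMem_tsupport (hz s x hx)
    have a2 := image_eq_zero_of_notMem_tsupport (hz t x hx)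
    have a3 : fderiv ℝ Φ (t, x) = 0 := image_eq_zero_of_notMem_tsupport (f := fderiv ℝ Φ) fun hc => hz t x hx (tsupport_fderiv_subset ℝ hc)
    simp [a1, a2, a3]

lemma ibp {H : Type*} [NormedAddCommGroup H] [InnerProductSpace ℝ H] [CompleteSpace H] {T C : ℝ} (hT : 0 ≤ T)
    {g Ψ Ψ' : ℝ → H} (y0 : H) (hg : IntervalIntegrable g volume 0 T) (hC : ∀ s ∈ Icc 0 T, ‖g s‖ ≤ C)
    (hΨ : ∀ t, HasDerivAt Ψ (Ψ' t) t) (hΨ' : Continuous Ψ') (h0 : Ψ 0 = 0) (h1 : Ψ T = 0) :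
    ∫ t in (0:ℝ)..T, (⟪y0 + ∫ s in (0:ℝ)..t, g s, Ψ' t⟫_ℝ + ⟪g t, Ψ t⟫_ℝ) = 0 := by
  have hC0 : 0 ≤ C := (norm_nonneg _).trans (hC 0 ⟨le_rfl, hT⟩)
  set y : ℝ → H := fun t => y0 + ∫ s in (0:ℝ)..t, g s with hy
  have hsub : ∀ t ∈ Icc 0 T, IntervalIntegrable g volume 0 t := fun t ht =>
    hg.mono_set (by rw [uIcc_of_le ht.1, uIcc_of_le hT]; exact Icc_subset_Icc_right ht.2)
  have ylip : ∀ s ∈ Icc 0 T, ∀ t ∈ Icc 0 T, ‖y s - y t‖ ≤ C * |s - t| := by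
    intro s hs t ht
    have : y s - y t = ∫ r in t..s, g r := by
      simp only [hy, add_sub_add_left_eq_sub]
      exact intervalIntegral.integral_interval_sub_left (hsub s hs) (hsub t ht)
    rw [this]
    refine intervalIntegral.norm_integral_le_of_norm_le_const fun r hr => hC r ?_
    exact (convex_Icc (0:ℝ) T).ordConnected.uIcc_subset ht hs (uIoc_subset_uIcc hr)
  obtain ⟨D, hD⟩ := isCompact_Icc.exists_bound_of_continuousOn (s := Icc 0 T) hΨ'.continuousOn
  have hD0 : 0 ≤ D := (norm_nonneg _).trans (hD 0 ⟨le_rfl, hT⟩)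
  have Ψlip : ∀ s ∈ Icc 0 T, ∀ t ∈ Icc 0 T, ‖Ψ s - Ψ t‖ ≤ D * |s - t| := fun s hs t ht =>
    Convex.norm_image_sub_le_of_norm_hasDerivWithin_le (fun r _ => (hΨ r).hasDerivWithinAt) hD (convex_Icc 0 T) ht hs
  have yb : ∀ s ∈ Icc 0 T, ‖y s‖ ≤ ‖y0‖ + C * T := by
    intro s hs
    have h2 := ylip s hs 0 ⟨le_rfl, hT⟩
    have h3 : y 0 = y0 := by simp [hy]
    have h4 : C * |s - 0| ≤ C * T := mul_le_mul_of_nonneg_left (by rw [sub_zero, abs_of_nonneg hs.1]; exact hs.2) hC0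
    have h5 := norm_le_norm_add_norm_sub' (y s) (y 0)
    rw [h3] at h5 h2; linarith
  have Ψb : ∀ s ∈ Icc 0 T, ‖Ψ s‖ ≤ D * T := by
    intro s hs
    have h2 := Ψlip s hs 0 ⟨le_rfl, hT⟩
    rw [h0, sub_zero, sub_zero, abs_of_nonneg hs.1] at h2
    exact h2.trans (mul_le_mul_of_nonneg_left hs.2 hD0)
  have hL : LipschitzOnWith (Real.toNNReal (C * (D * T) + (‖y0‖ + C * T) * D)) (fun t => ⟪y t, Ψ t⟫_ℝ) (uIcc 0 T) := by
    rw [uIcc_of_le hT]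
    refine LipschitzOnWith.of_dist_le_mul fun s hs t ht => ?_
    rw [Real.coe_toNNReal _ (by positivity), Real.dist_eq, Real.dist_eq]
    have e : ⟪y s, Ψ s⟫_ℝ - ⟪y t, Ψ t⟫_ℝ = ⟪y s - y t, Ψ s⟫_ℝ + ⟪y t, Ψ s - Ψ t⟫_ℝ := by
      rw [inner_sub_left, inner_sub_right]; ring
    rw [e]
    have a1 := (abs_real_inner_le_norm (y s - y t) (Ψ s)).trans (mul_le_mul (ylip s hs t ht) (Ψb s hs) (norm_nonneg _) (by positivity))
    have a2 := (abs_real_inner_le_norm (y t) (Ψ s - Ψ t)).trans (mul_le_mul (yb t ht) (Ψlip s hs t ht) (norm_nonneg _) (by positivity))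
    refine (abs_add_le _ _).trans ((add_le_add a1 a2).trans (le_of_eq (by ring)))
  have hac := hL.absolutelyContinuousOnInterval.integral_deriv_eq_sub
  rw [h0, h1] at hac
  simp only [inner_zero_right, sub_zero] at hac
  refine Eq.trans ?_ hac
  refine intervalIntegral.integral_congr_ae ?_
  filter_upwards [hg.ae_hasDerivAt_integral] with t ht htm
  have h2 : HasDerivAt (fun x => ∫ (t : ℝ) in (0:ℝ)..x, g t) (g t) t := ht (uIoc_subset_uIcc htm) 0 left_mem_uIcc
  have h3 := (HasDerivAt.inner ℝ (HasDerivAt.const_add y0 h2) (hΨ t)).deriv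
  exact h3.symm

variable (K : Coef d)

lemma inner_nem {g : EE d → ℝ → ℝ} {L : ℝ} (hg : NL g L) (u : HR d) {φ : EE d → ℝ} (h : MemLp φ 2 volume) :
    ⟪nem g u, ct φ⟫_ℝ = ∫ x, g x (u x) * φ x := by
  rw [inner_ct h]
  refine integral_congr_ae ?_
  filter_upwards [hg.coe u] with x hx
  rw [hx]

lemma NL.mul_int {g : EE d → ℝ → ℝ} {L : ℝ} (hg : NL g L) (u : HR d) {φ : EE d → ℝ} (h : MemLp φ 2 volume) :
    Integrable fun x => g x (u x) * φ x := (hg.memLp u).integrable_mul h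

lemma Coef.G_SS {φ : EE d → ℝ} (h : TF φ) (u : HR d) : K.dat.G u (SS φ) =
    ∫ x, (K.f (u x) * lap φ x + ∑ i, K.B i x (u x) * pd i φ x) := by
  have e1 : SS φ - Jop d (SS φ) = - ct (lap φ) := by
    rw [h.J, SS, ct_sub h.memLp h.lap.memLp]; abel
  have e2 : K.dat.G u (SS φ) = - ⟪nem (fun _ => K.f) u, SS φ - Jop d (SS φ)⟫_ℝ + ∑ i, ⟪nem (K.B i) u, Top i (SS φ)⟫_ℝ := rfl
  rw [e2, e1, inner_neg_right, neg_neg, inner_nem K.fNL u h.lap.memLp]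
  have i1 := K.fNL.mul_int u h.lap.memLp
  have i2 : ∀ i, Integrable fun x => K.B i x (u x) * pd i φ x := fun i => (K.BNL i).mul_int u (h.pd i).memLp
  rw [integral_add i1 (integrable_finsetSum _ fun i _ => i2 i), integral_finsetSum _ fun i _ => i2 i]
  congr 1
  refine Finset.sum_congr rfl fun i _ => ?_
  rw [h.T, inner_nem (K.BNL i) u (h.pd i).memLp]

lemma Coef.weak {T : ℝ} (hT : 0 ≤ T) {u0 : HR d} {U : ℝ → HR d} (hU : K.dat.HSol T u0 U) {Φ : ℝ × EE d → ℝ} (h : TF2 Φ)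
    (hs : ∀ p ∈ tsupport Φ, 0 < p.1 ∧ p.1 < T) :
    ∫ t in (0:ℝ)..T, ∫ x, (U t x * deriv (fun s => Φ (s, x)) t + K.f (U t x) * lap (fun x => Φ (t, x)) x
      + ∑ i, K.B i x (U t x) * pd i (fun x => Φ (t, x)) x) = 0 := by
  obtain ⟨C, hC0, hC⟩ := K.dat.gt_bound
  obtain ⟨R, hR⟩ := hU.1
  have hΘ := h.sub h.lap2
  have eS : ∀ t, SS (fun x => Φ (t, x)) = ct (fun x => Φ (t, x) - Lap2 Φ (t, x)) := fun t => by
    unfold SS; simp_rw [h.lap]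
  have hJ : ∀ t, Jop d (ct fun x => fderiv ℝ (fun p => Φ p - Lap2 Φ p) (t, x) (1, 0)) = ct fun x => fderiv ℝ Φ (t, x) (1, 0) := by
    intro t
    have h1 := (Jop d).hasFDerivAt.comp_hasDerivAt t (hΘ.hasDeriv t)
    have h2 := h.hasDeriv t
    refine h1.unique (h2.congr_of_eventuallyEq (Eventually.of_forall fun s => ?_))
    have := (h.slice s).J
    rw [eS] at this
    exact this
  have hz : ∀ t, ¬ (0 < t ∧ t < T) → ct (fun x => Φ (t, x) - Lap2 Φ (t, x)) = 0 := by
    intro t ht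
    have h1 : (fun x => Φ (t, x)) = fun _ => (0:ℝ) := by
      funext x
      exact image_eq_zero_of_notMem_tsupport fun hc => ht (hs _ hc)
    rw [← eS, h1]
    have h0 : TF (fun _ : EE d => (0:ℝ)) := ⟨contDiff_const, HasCompactSupport.zero⟩
    refine Lp.ext ?_
    filter_upwards [h0.SS_coe, Lp.coeFn_zero ℝ 2 (volume : Measure (EE d))] with x h1 h2
    rw [h1, h2]; simp [lap]
  have key := ibp (H := HR d) hT (g := fun s => K.dat.gt (U s)) (C := C * R)
    (Ψ := fun t => ct (fun x => Φ (t, x) - Lap2 Φ (t, x)))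
    (Ψ' := fun t => ct fun x => fderiv ℝ (fun p => Φ p - Lap2 Φ p) (t, x) (1, 0)) (K.dat.J u0)
    (hU.int ⟨hT, le_rfl⟩) (fun s hs => (hC _).trans (mul_le_mul_of_nonneg_left (hR s hs) hC0))
    (fun t => hΘ.hasDeriv t) (continuous_iff_continuousAt.2 fun t => ((hΘ.D (1, 0)).hasDeriv t).continuousAt)
    (hz 0 (by simp)) (hz T (by simp))
  refine Eq.trans ?_ key
  refine intervalIntegral.integral_congr fun t ht => ?_
  rw [uIcc_of_le hT] at ht
  beta_reduce
  rw [← hU.J_eq ht, ← eS, ← Dat.G_eq, K.G_SS (h.slice t), K.dat.Jsymm]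
  have e0 : K.dat.J (ct fun x => fderiv ℝ (fun p => Φ p - Lap2 Φ p) (t, x) (1, 0)) = ct fun x => fderiv ℝ Φ (t, x) (1, 0) := hJ t
  rw [e0, inner_ct ((h.D (1, 0)).slice t).memLp, ← integral_add]
  · refine integral_congr_ae (Eventually.of_forall fun x => ?_)
    simp only
    rw [(h.hasDeriv_t t x).deriv]; ring
  · exact (Lp.memLp (U t)).integrable_mul ((h.D (1, 0)).slice t).memLp
  · exact (K.fNL.mul_int (U t) (h.slice t).lap.memLp).add (integrable_finsetSum _ fun i _ => (K.BNL i).mul_int _ ((h.slice t).pd i).memLp)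

end FP

namespace FP
set_option linter.unusedSectionVars false
set_option linter.unusedVariables false

open scoped InnerProductSpace Topology ContDiff
variable {d : ℕ}

lemma le_of_cpt {f : EE d → ℝ} (hf : Integrable f) {C : ℝ}
    (h : ∀ ψ : EE d → ℝ, Continuous ψ → HasCompactSupport ψ → (∀ x, 0 ≤ ψ x) → (∃ c, ∀ x, |ψ x| ≤ c) → ∫ x, f x * ψ x ≤ C * ∫ x, ψ x) :
    ∀ᵐ x, f x ≤ C := by
  have cpt : ∀ s : Set (EE d), IsCompact s → ∫ x in s, (f x - C) ≤ 0 := by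
    intro s hs
    have hb : IsCompact (Metric.cthickening 1 s) := hs.cthickening
    set ψ : ℕ → EE d → ℝ := fun n x => (thickenedIndicator (δ := 1 / ((n:ℝ) + 1)) (by positivity) s x : ℝ) with hψ
    have ψc : ∀ n, Continuous (ψ n) := fun n => NNReal.continuous_coe.comp (thickenedIndicator _ s).continuous
    have ψ1 : ∀ n x, ψ n x ≤ 1 := fun n x =>
      NNReal.coe_le_one.2 (thickenedIndicator_le_one (δ := 1 / ((n:ℝ) + 1)) (by positivity) s x)
    have ψz : ∀ n x, x ∉ Metric.cthickening 1 s → ψ n x = 0 := by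
      intro n x hx
      have h2 : x ∉ Metric.thickening (1 / ((n:ℝ) + 1)) s := fun hc => hx (Metric.thickening_subset_cthickening_of_le
        (by rw [div_le_one (by positivity)]; linarith [(Nat.cast_nonneg n : (0:ℝ) ≤ n)]) _ hc)
      simp only [hψ]
      rw [thickenedIndicator_zero _ _ h2]; rfl
    have ψs : ∀ n, HasCompactSupport (ψ n) := fun n => HasCompactSupport.intro hb (ψz n)
    have lim : ∀ x, Tendsto (fun n => ψ n x) atTop (𝓝 (s.indicator (fun _ => (1:ℝ)) x)) := by
      intro x
      have h1 := thickenedIndicator_tendsto_indicator_closure (δseq := fun n : ℕ => 1 / ((n:ℝ) + 1)) (fun n => by positivity)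
        tendsto_one_div_add_atTop_nhds_zero_nat s
      have h2 := (NNReal.continuous_coe.tendsto _).comp (tendsto_pi_nhds.1 h1 x)
      rw [hs.isClosed.closure_eq] at h2
      have e : ((s.indicator (fun _ => (1:NNReal)) x : NNReal) : ℝ) = s.indicator (fun _ => (1:ℝ)) x := by
        by_cases hx : x ∈ s <;> simp [hx]
      rw [e] at h2; exact h2
    have hi : IntegrableOn (fun x => f x - C) (Metric.cthickening 1 s) := hf.integrableOn.sub (integrableOn_const hb.measure_lt_top.ne)
    have L : Tendsto (fun n => ∫ x, (f x - C) * ψ n x) atTop (𝓝 (∫ x, (f x - C) * s.indicator (fun _ => (1:ℝ)) x)) := by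
      refine tendsto_integral_of_dominated_convergence ((Metric.cthickening 1 s).indicator fun x => |f x - C|) 
        (fun n => (hf.1.sub aestronglyMeasurable_const).mul (ψc n).aestronglyMeasurable) 
        ((integrable_indicator_iff hb.isClosed.measurableSet).2 hi.abs) (fun n => Eventually.of_forall fun x => ?_) 
        (Eventually.of_forall fun x => (lim x).const_mul _)
      by_cases hx : x ∈ Metric.cthickening 1 s
      · rw [indicator_of_mem hx, norm_mul, Real.norm_eq_abs, Real.norm_eq_abs, abs_of_nonneg (NNReal.coe_nonneg _ : 0 ≤ ψ n x)]
        exact mul_le_of_le_one_right (abs_nonneg _) (ψ1 n x)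
      · rw [indicator_of_notMem hx, ψz n x hx]; simp
    have e2 : ∫ x in s, (f x - C) = ∫ x, (f x - C) * s.indicator (fun _ => (1:ℝ)) x := by
      rw [← integral_indicator hs.isClosed.measurableSet]
      refine integral_congr_ae (Eventually.of_forall fun x => ?_)
      by_cases hx : x ∈ s <;> simp [hx]
    rw [e2]
    refine le_of_tendsto' L fun n => ?_
    have b1 : Integrable (fun x => f x * ψ n x) := hf.mul_bdd (c := 1) (ψc n).aestronglyMeasurable
      (Eventually.of_forall fun x => by rw [Real.norm_eq_abs, abs_of_nonneg (NNReal.coe_nonneg _ : 0 ≤ ψ n x)]; exact ψ1 n x)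
    have b2 : Integrable (ψ n) := (ψc n).integrable_of_hasCompactSupport (ψs n)
    simp_rw [sub_mul]
    rw [integral_sub b1 (b2.const_mul C), integral_const_mul]
    have := h (ψ n) (ψc n) (ψs n) (fun x => NNReal.coe_nonneg _) ⟨1, fun x => by
      rw [abs_of_nonneg (NNReal.coe_nonneg _ : 0 ≤ ψ n x)]; exact ψ1 n x⟩
    linarith
  set f' := hf.1.mk f with hf'
  have hae : f =ᵐ[volume] f' := hf.1.ae_eq_mk
  have hA : MeasurableSet {x | C < f' x} := measurableSet_lt measurable_const hf.1.stronglyMeasurable_mk.measurable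
  by_contra hc
  have h0 : (0 : ENNReal) < volume {x | C < f' x} := by
    rw [pos_iff_ne_zero]
    intro h0
    refine hc ?_
    have : ∀ᵐ x, ¬ (C < f' x) := by rw [ae_iff]; simpa using h0
    filter_upwards [this, hae] with x h1 h2
    rw [h2]; exact not_lt.1 h1
  obtain ⟨s, hsA, hs, hs0⟩ := hA.exists_lt_isCompact h0
  have h1 := cpt s hs
  have hi : IntegrableOn (fun x => f x - C) s := hf.integrableOn.sub (integrableOn_const hs.measure_lt_top.ne)
  have h2 : ∀ᵐ x ∂(volume.restrict s), 0 < f x - C := by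
    filter_upwards [ae_restrict_mem hs.isClosed.measurableSet, ae_restrict_of_ae hae] with x hx h3
    have := hsA hx
    rw [h3]; exact sub_pos.2 this
  have h3 : 0 < ∫ x in s, (f x - C) := by
    rw [integral_pos_iff_support_of_nonneg_ae (h2.mono fun x hx => hx.le) hi]
    refine hs0.trans_le ?_
    rw [← Measure.restrict_apply_self]
    refine measure_mono_ae ?_
    filter_upwards [h2] with x hx _
    exact hx.ne'
  linarith

lemma pettis {H : Type*} [NormedAddCommGroup H] [InnerProductSpace ℝ H] [CompleteSpace H] [TopologicalSpace.SeparableSpace H]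
    {T : ℝ} {V : ℝ → H} (hV : ∀ e, ContinuousOn (fun t => ⟪V t, e⟫_ℝ) (Icc 0 T)) :
    AEStronglyMeasurable V (volume.restrict (Ioc 0 T)) := by
  set s := TopologicalSpace.denseSeq H
  set F : ℕ → Submodule ℝ H := fun n => Submodule.span ℝ (s '' (Iio n)) with hF
  have fd : ∀ n, FiniteDimensional ℝ (F n) := fun n => FiniteDimensional.span_of_finite ℝ ((finite_Iio n).image s)
  refine aestronglyMeasurable_of_tendsto_ae (u := atTop) (f := fun n t => ((F n).starProjection (V t))) (fun n => ?_) ?_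
  · refine ContinuousOn.aestronglyMeasurable ?_ measurableSet_Ioc
    refine ContinuousOn.mono ?_ Ioc_subset_Icc_self
    have : ∀ t, (F n).starProjection (V t) = ∑ i, ⟪V t, (stdOrthonormalBasis ℝ (F n) i : H)⟫_ℝ • (stdOrthonormalBasis ℝ (F n) i : H) := by
      intro t
      rw [(stdOrthonormalBasis ℝ (F n)).starProjection_eq_sum_rankOne]
      simp [real_inner_comm]
    simp_rw [this]
    exact continuousOn_finsetSum _ fun i _ => (hV _).smul continuousOn_const
  · refine Eventually.of_forall fun t => ?_
    rw [Metric.tendsto_atTop]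
    intro ε hε
    obtain ⟨k, hk⟩ := (TopologicalSpace.denseRange_denseSeq H).exists_dist_lt (V t) hε
    refine ⟨k + 1, fun n hn => ?_⟩
    rw [dist_comm, dist_eq_norm]
    rw [dist_eq_norm] at hk
    refine lt_of_le_of_lt ?_ hk
    rw [Submodule.starProjection_minimal]
    exact ciInf_le ⟨0, by rintro _ ⟨y, rfl⟩; exact norm_nonneg _⟩ (⟨s k, Submodule.subset_span ⟨k, by simp; omega, rfl⟩⟩ : F n)

lemma sepHR : TopologicalSpace.SeparableSpace (HR d) := by
  have : Fact ((2:ENNReal) ≠ ⊤) := ⟨by norm_num⟩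
  have : SecondCountableTopology (HR d) := Lp.SecondCountableTopology
  infer_instance


end FP

namespace FP
set_option linter.unusedSectionVars false
set_option linter.unusedVariables false

open scoped InnerProductSpace Topology ContDiff
variable {d : ℕ}

lemma dbr {T : ℝ} (hT : 0 < T) {h : ℝ → ℝ} (hc : ContinuousOn h (Icc 0 T))
    (H : ∀ η : ℝ → ℝ, ContDiff ℝ ∞ η → HasCompactSupport η → tsupport η ⊆ Ioo 0 T → ∫ t in 0..T, deriv η t * h t = 0) :
    ∀ t ∈ Icc 0 T, h t = h 0 := by
  let B : ContDiffBump (T / 2) := ⟨T / 8, T / 4, by positivity, by linarith⟩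
  set θ0 : ℝ → ℝ := B.normed volume with hθ0
  have θ0s : ContDiff ℝ ∞ θ0 := B.contDiff_normed
  have θ01 : ∫ t, θ0 t = 1 := B.integral_normed
  have θ0t : tsupport θ0 = Metric.closedBall (T / 2) (T / 4) := B.tsupport_normed_eq
  have θ0c : HasCompactSupport θ0 := B.hasCompactSupport_normed
  have ii : ∀ θ : ℝ → ℝ, Continuous θ → IntervalIntegrable (fun t => θ t * h t) volume 0 T := fun θ hθ =>
    (hθ.continuousOn.mul (by rwa [uIcc_of_le hT.le])).intervalIntegrable
  set c := ∫ t in 0..T, θ0 t * h t with hcdef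
  have key : ∀ θ : ℝ → ℝ, ContDiff ℝ ∞ θ → HasCompactSupport θ → tsupport θ ⊆ Ioo 0 T → ∫ t in 0..T, θ t * (h t - c) = 0 := by
    intro θ hθ hθc hθt
    set m := ∫ t, θ t with hm
    set g : ℝ → ℝ := fun t => θ t - m * θ0 t with hg
    have gs : ContDiff ℝ ∞ g := hθ.sub (contDiff_const.mul θ0s)
    have gi : ∫ t, g t = 0 := by
      rw [hg, integral_sub (hθ.continuous.integrable_of_hasCompactSupport hθc) ((θ0s.continuous.integrable_of_hasCompactSupport θ0c).const_mul m),
        integral_const_mul, θ01]; simp [hm]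
    have Kc : IsCompact (tsupport θ ∪ tsupport θ0) := hθc.isCompact.union θ0c.isCompact
    have Ks : tsupport θ ∪ tsupport θ0 ⊆ Ioo 0 T := by
      refine union_subset hθt ?_
      rw [θ0t, Real.closedBall_eq_Icc]
      intro t ht; constructor <;> linarith [ht.1, ht.2]
    have Kn : (tsupport θ ∪ tsupport θ0).Nonempty := ⟨T / 2, Or.inr (by rw [θ0t]; exact Metric.mem_closedBall_self (by positivity))⟩
    obtain ⟨t0, ht0, hmin⟩ := Kc.exists_isMinOn Kn (f := fun t => min t (T - t)) (by fun_prop)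
    set ε := min t0 (T - t0) with hε
    have ε0 : 0 < ε := lt_min (Ks ht0).1 (by linarith [(Ks ht0).2])
    have gz : ∀ t, t ∉ Icc ε (T - ε) → g t = 0 := by
      intro t ht
      have : t ∉ tsupport θ ∪ tsupport θ0 := by
        intro hk
        have := isMinOn_iff.1 hmin t hk
        exact ht ⟨this.trans (min_le_left _ _), by linarith [this.trans (min_le_right t (T - t))]⟩
      rw [mem_union, not_or] at this
      simp [hg, image_eq_zero_of_notMem_tsupport this.1, image_eq_zero_of_notMem_tsupport this.2]
    set η : ℝ → ℝ := fun t => ∫ s in 0..t, g s with hη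
    have ηd : ∀ t, HasDerivAt η (g t) t := fun t => (gs.continuous.integral_hasStrictDerivAt 0 t).hasDerivAt
    have ηd' : deriv η = g := funext fun t => (ηd t).deriv
    have ηs : ContDiff ℝ ∞ η := by
      rw [contDiff_infty_iff_deriv]
      exact ⟨fun t => (ηd t).differentiableAt, by rw [ηd']; exact gs⟩
    have ηz : Function.support η ⊆ Icc ε (T - ε) := by
      intro t ht
      by_contra hn
      refine ht ?_
      rw [mem_Icc, not_and_or, not_le, not_le] at hn
      rcases hn with hn | hn
      · simp only [hη]
        rw [intervalIntegral.integral_congr (g := fun _ => (0:ℝ))]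
        · simp
        · intro s hs
          refine gz s fun hs' => ?_
          have : s ≤ max 0 t := hs.2
          have := this.trans_lt (max_lt ε0 hn)
          linarith [hs'.1]
      · simp only [hη]
        rw [intervalIntegral.integral_eq_integral_of_support_subset, gi]
        intro s hs
        have : s ∈ Icc ε (T - ε) := by by_contra h'; exact hs (gz s h')
        exact ⟨by linarith [this.1], by linarith [this.2]⟩
    have ηt : tsupport η ⊆ Icc ε (T - ε) := closure_minimal ηz isClosed_Icc
    have h1 := H η ηs (isCompact_Icc.of_isClosed_subset (isClosed_tsupport _) ηt) (ηt.trans fun t ht => ⟨by linarith [ht.1], by linarith [ht.2]⟩)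
    rw [ηd'] at h1
    have h2 : ∫ t in 0..T, θ t = m := intervalIntegral.integral_eq_integral_of_support_subset fun t ht => Ioo_subset_Ioc_self (hθt (subset_tsupport _ ht))
    have e1 : ∀ t, g t * h t = θ t * h t - m * (θ0 t * h t) := fun t => by simp only [hg]; ring
    simp_rw [e1] at h1
    rw [intervalIntegral.integral_sub (ii _ hθ.continuous) ((ii _ θ0s.continuous).const_mul m), intervalIntegral.integral_const_mul, ← hcdef] at h1
    simp_rw [mul_sub]
    rw [intervalIntegral.integral_sub (ii _ hθ.continuous) ((hθ.continuous.intervalIntegrable _ _).mul_const c), intervalIntegral.integral_mul_const, h2]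
    exact h1
  have ae0 : ∀ᵐ t, t ∈ Ioo 0 T → h t - c = 0 := by
    refine isOpen_Ioo.ae_eq_zero_of_integral_contDiff_smul_eq_zero (μ := volume) 
      ((((hc.sub continuousOn_const).integrableOn_Icc).mono_set Ioo_subset_Icc_self).locallyIntegrableOn) fun θ hθ hθc hθt => ?_
    have := key θ hθ hθc hθt
    rw [intervalIntegral.integral_eq_integral_of_support_subset] at this
    · exact this
    · intro t ht
      refine Ioo_subset_Ioc_self (hθt (subset_tsupport _ ?_))
      intro h0; exact ht (by simp [h0])
  have eq : EqOn h (fun _ => c) (Icc 0 T) := by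
    have e1 : EqOn h (fun _ => c) (Ioo 0 T) := by
      refine Measure.eqOn_open_of_ae_eq (μ := volume) ?_ isOpen_Ioo (hc.mono Ioo_subset_Icc_self) continuousOn_const
      rw [EventuallyEq, ae_restrict_iff' measurableSet_Ioo]
      filter_upwards [ae0] with t ht h'
      linarith [ht h']
    refine e1.of_subset_closure hc continuousOn_const Ioo_subset_Icc_self ?_
    rw [closure_Ioo hT.ne]
  intro t ht
  rw [eq ht, eq ⟨le_rfl, hT.le⟩]

lemma HSol_of_weak (K : Coef d) {T R : ℝ} (hT : 0 < T) {V : ℝ → HR d} (hR : ∀ t ∈ Icc 0 T, ‖V t‖ ≤ R)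
    (hVc : ∀ e, ContinuousOn (fun t => ⟪V t, e⟫_ℝ) (Icc 0 T))
    (hw : ∀ η : ℝ → ℝ, ContDiff ℝ ∞ η → HasCompactSupport η → tsupport η ⊆ Ioo 0 T → ∀ ζ : EE d → ℝ, TF ζ →
      ∫ t in 0..T, (deriv η t * ⟪V t, ct ζ⟫_ℝ + η t * K.dat.G (V t) (SS ζ)) = 0) : K.dat.HSol T (V 0) V := by
  have := sepHR (d := d)
  have hm := pettis hVc
  obtain ⟨C, hC0, hC⟩ := K.dat.gt_bound
  have gb : ∀ t ∈ Icc 0 T, ‖K.dat.gt (V t)‖ ≤ C * R := fun t ht => (hC _).trans (mul_le_mul_of_nonneg_left (hR t ht) hC0)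
  have gi : IntervalIntegrable (fun s => K.dat.gt (V s)) volume 0 T := by
    rw [intervalIntegrable_iff_integrableOn_Ioc_of_le hT.le]
    refine Integrable.of_bound (K.dat.gt_cont.comp_aestronglyMeasurable hm) (C * R) ?_
    filter_upwards [ae_restrict_mem measurableSet_Ioc] with s hs using gb s (Ioc_subset_Icc_self hs)
  have gi' : ∀ t ∈ Icc 0 T, IntervalIntegrable (fun s => K.dat.gt (V s)) volume 0 t := fun t ht =>
    gi.mono_set (by rw [uIcc_of_le ht.1, uIcc_of_le hT.le]; exact Icc_subset_Icc_right ht.2)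
  have comm : ∀ t ∈ Icc 0 T, ∀ w, ⟪∫ s in 0..t, K.dat.gt (V s), w⟫_ℝ = ∫ s in 0..t, ⟪K.dat.gt (V s), w⟫_ℝ := by
    intro t ht w
    rw [real_inner_comm]
    have := (innerSL ℝ w).intervalIntegral_comp_comm (gi' t ht)
    simp only [innerSL_apply_apply] at this
    rw [← this]
    simp_rw [real_inner_comm]
  have ci : ∀ w, IntervalIntegrable (fun s => ⟪K.dat.gt (V s), w⟫_ℝ) volume 0 T := fun w => by
    have := gi
    rw [intervalIntegrable_iff_integrableOn_Ioc_of_le hT.le] at this ⊢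
    exact Integrable.inner_const this w
  have step : ∀ ζ : EE d → ℝ, TF ζ → ∀ t ∈ Icc 0 T, ⟪V t, ct ζ⟫_ℝ = ⟪V 0, ct ζ⟫_ℝ + ∫ s in 0..t, ⟪K.dat.gt (V s), SS ζ⟫_ℝ := by
    intro ζ hζ
    have Pc : ContinuousOn (fun t => ∫ s in 0..t, ⟪K.dat.gt (V s), SS ζ⟫_ℝ) (Icc 0 T) := by
      have := intervalIntegral.continuousOn_primitive_interval (μ := volume) (a := 0) (b := T)
        (f := fun s => ⟪K.dat.gt (V s), SS ζ⟫_ℝ) (by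
          rw [uIcc_of_le hT.le, integrableOn_Icc_iff_integrableOn_Ioc, ← intervalIntegrable_iff_integrableOn_Ioc_of_le hT.le]; exact ci _)
      rwa [uIcc_of_le hT.le] at this
    have hdb := dbr hT (h := fun t => ⟪V t, ct ζ⟫_ℝ - ∫ s in 0..t, ⟪K.dat.gt (V s), SS ζ⟫_ℝ) ((hVc _).sub Pc) ?_
    · intro t ht
      have := hdb t ht
      simp only [intervalIntegral.integral_same] at this
      linarith
    intro η hη hηc hηt
    have h1 := hw η hη hηc hηt ζ hζ
    have ηd : ∀ t, HasDerivAt η (deriv η t) t := fun t => (hη.differentiable (by simp) t).hasDerivAt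
    have ηc' : Continuous (deriv η) := hη.continuous_deriv (by simp)
    have hz : ∀ t, t ∉ Ioo 0 T → η t = 0 := fun t ht => image_eq_zero_of_notMem_tsupport fun h => ht (hηt h)
    have h2 := ibp (H := ℝ) hT.le (g := fun s => ⟪K.dat.gt (V s), SS ζ⟫_ℝ) (C := C * R * ‖SS ζ‖) 0 (ci _)
      (fun s hs => (norm_inner_le_norm _ _).trans (mul_le_mul_of_nonneg_right (gb s hs) (norm_nonneg _)))
      ηd ηc' (hz 0 (by simp)) (hz T (by simp))
    have i1 : IntervalIntegrable (fun t => deriv η t * ⟪V t, ct ζ⟫_ℝ) volume 0 T :=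
      (ηc'.continuousOn.mul (by rw [uIcc_of_le hT.le]; exact hVc _)).intervalIntegrable
    have i2 : IntervalIntegrable (fun t => deriv η t * ∫ s in 0..t, ⟪K.dat.gt (V s), SS ζ⟫_ℝ) volume 0 T :=
      (ηc'.continuousOn.mul (by rw [uIcc_of_le hT.le]; exact Pc)).intervalIntegrable
    have i3 : IntervalIntegrable (fun t => η t * ⟪K.dat.gt (V t), SS ζ⟫_ℝ) volume 0 T := (ci _).continuousOn_mul hη.continuous.continuousOn
    simp_rw [Dat.G_eq] at h1
    rw [intervalIntegral.integral_add i1 i3] at h1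
    have h3 : (∫ t in 0..T, deriv η t * ∫ s in 0..t, ⟪K.dat.gt (V s), SS ζ⟫_ℝ) + ∫ t in 0..T, η t * ⟪K.dat.gt (V t), SS ζ⟫_ℝ = 0 := by
      rw [← intervalIntegral.integral_add i2 i3]
      refine Eq.trans (intervalIntegral.integral_congr fun t ht => ?_) h2
      simp
    simp_rw [mul_sub]
    rw [intervalIntegral.integral_sub i1 i2]
    linarith
  refine ⟨⟨R, hR⟩, hm, fun t ht ψ => ?_⟩
  have z : K.dat.J (V t) - (K.dat.J (V 0) + ∫ s in 0..t, K.dat.gt (V s)) = 0 := by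
    refine zero_of_SS _ fun ζ hζ => ?_
    have h1 := step ζ hζ t ht
    have e : K.dat.J (SS ζ) = ct ζ := hζ.J
    rw [inner_sub_left, inner_add_left, K.dat.Jsymm, K.dat.Jsymm, e, comm t ht, h1, sub_self]
  rw [← K.dat.Jsymm, sub_eq_zero.1 z, inner_add_left, comm t ht, K.dat.Jsymm]
  simp_rw [Dat.G_eq]

lemma ct_dense : Dense (ct '' {φ : EE d → ℝ | TF φ}) := by
  refine (Lp.dense_hasCompactSupport_contDiff (E := EE d) (F := ℝ) (μ := volume) (p := 2) (by norm_num)).mono ?_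
  rintro f ⟨g, hg, hc, hs⟩
  refine ⟨g, ⟨hs, hc⟩, Lp.ext ?_⟩
  exact (TF.coe ⟨hs, hc⟩).trans hg.symm

end FP

namespace FP
set_option linter.unusedSectionVars false
set_option linter.unusedVariables false

open scoped InnerProductSpace Topology ContDiff
variable {d : ℕ}

def cl (N r : ℝ) : ℝ := max (-N) (min r N)

lemma cl_eq {N r : ℝ} (h : |r| ≤ N) : cl N r = r := by
  rw [abs_le] at h; unfold cl; rw [min_eq_left h.2, max_eq_right h.1]

lemma cl_cont (N : ℝ) : Continuous (cl N) := by unfold cl; fun_prop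

lemma cl_abs {N : ℝ} (hN : 0 ≤ N) (r : ℝ) : |cl N r| ≤ N :=
  abs_le.2 ⟨le_max_left _ _, max_le (by linarith) (min_le_right _ _)⟩

lemma cl_mono (N : ℝ) {r s : ℝ} (h : s ≤ r) : cl N s ≤ cl N r := max_le_max le_rfl (min_le_min h le_rfl)

lemma cl_sub (N : ℝ) (r s : ℝ) : |cl N r - cl N s| ≤ |r - s| := by
  unfold cl
  have h1 := abs_max_sub_max_le_abs (min r N) (min s N) (-N)
  rw [max_comm (-N), max_comm (-N)]
  refine h1.trans ?_
  refine (abs_min_sub_min_le_max r N s N).trans ?_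
  simp

lemma cl_le (N : ℝ) (hN : 0 ≤ N) (r : ℝ) : |cl N r| ≤ |r| := by
  have h := cl_sub N r 0
  rwa [cl_eq (r := 0) (by simpa using hN), sub_zero, sub_zero] at h

lemma exists_coef {β : ℝ → ℝ} {γ0 : ℝ} {b : EE d → ℝ → EE d} (hβ : HypBeta β γ0) (hb : HypB b) :
    ∃ c : ℝ, 0 ≤ c ∧ ∀ N : ℝ, 0 < N → ∃ K : Coef d, K.c = c ∧ (∀ r, |r| ≤ N → K.f r = β r) ∧
      ∀ i x r, |r| ≤ N → K.B i x r = r * b x r i := by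
  obtain ⟨β0, βs, γp, βm⟩ := hβ
  obtain ⟨bs, ⟨C0, hC0⟩, b0, hbr, δb, -, ⟨Cδ, hCδ⟩, hδ⟩ := hb
  refine ⟨max Cδ 0, le_max_right _ _, fun N hN => ?_⟩
  obtain ⟨C1, hC1⟩ := hbr N hN
  have C0n : 0 ≤ C0 := (norm_nonneg _).trans (hC0 0 0)
  have C1n : 0 ≤ C1 := (norm_nonneg _).trans (hC1 0 0 (by simpa using hN.le))
  obtain ⟨Lβ, hLβ⟩ := (isCompact_Icc (a := -N) (b := N)).exists_bound_of_continuousOn (βs.continuous_deriv le_rfl).continuousOn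
  have Ln : 0 ≤ Lβ := (norm_nonneg _).trans (hLβ 0 ⟨by linarith, hN.le⟩)
  have clm : ∀ r, cl N r ∈ Icc (-N) N := fun r => abs_le.1 (cl_abs hN.le r)
  have βlip : ∀ p ∈ Icc (-N) N, ∀ q ∈ Icc (-N) N, |β p - β q| ≤ Lβ * |p - q| := fun p hp q hq =>
    (convex_Icc (-N) N).norm_image_sub_le_of_norm_deriv_le (fun x _ => βs.differentiable (by simp) x) hLβ hq hp
  have ci : ∀ (v : EE d) i, |v i| ≤ ‖v‖ := fun v i => PiLp.norm_apply_le v i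
  have blip : ∀ x, ∀ p ∈ Icc (-N) N, ∀ q ∈ Icc (-N) N, ‖b x p - b x q‖ ≤ C1 * |p - q| := fun x p hp q hq =>
    (convex_Icc (-N) N).norm_image_sub_le_of_norm_deriv_le (f := fun s => b x s) (fun r _ => by
      have h1 : ContDiff ℝ 1 fun s : ℝ => b x s := bs.comp (contDiff_const.prodMk contDiff_id)
      exact h1.differentiable (by simp) r) (fun r hr => hC1 x r (abs_le.2 hr)) hq hp
  have bx : ∀ x y r, ‖b x r - b y r‖ ≤ max Cδ 0 * ‖x - y‖ := fun x y r =>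
    convex_univ.norm_image_sub_le_of_norm_fderiv_le (𝕜 := ℝ) (f := fun y => b y r) (fun y _ => by
      have h1 : ContDiff ℝ 1 fun y : EE d => b y r := bs.comp (contDiff_id.prodMk contDiff_const)
      exact h1.differentiable (by simp) y) (fun z _ => ((hδ r).1 ⟨z, rfl⟩).trans ((hCδ r).trans (le_max_left _ _))) (mem_univ y) (mem_univ x)
  have βmono : ∀ p q, q ≤ p → γ0 * (p - q) ≤ β p - β q := by
    intro p q h
    rcases h.eq_or_lt with rfl | h
    · simp
    · have := βm p q
      have h' : 0 < p - q := sub_pos.2 h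
      nlinarith
  have Lt : 0 ≤ C0 + N * C1 := by positivity
  refine ⟨{ f := fun r => β (cl N r) + γ0 * (r - cl N r)
            B := fun i x r => cl N r * b x (cl N r) i
            γ := γ0
            L := Lβ + γ0 + (C0 + N * C1)
            c := max Cδ 0
            γpos := γp
            Lnn := by positivity
            cnn := le_max_right _ _
            f0 := ?_
            fmono := ?_
            flip := ?_
            Bc := ?_
            B0 := ?_
            Blip := ?_
            Bx := ?_ }, rfl, ?_, ?_⟩
  · simp [cl_eq (r := 0) (N := N) (by simpa using hN.le), β0]
  · intro r s h
    have := βmono _ _ (cl_mono N h)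
    nlinarith
  · intro r s h
    have h1 := βlip _ (clm r) _ (clm s)
    have h2 := cl_sub N r s
    have h3 := cl_mono N h
    rw [abs_of_nonneg (sub_nonneg.2 h)] at h2
    have h4 := (le_abs_self _).trans (h1.trans (mul_le_mul_of_nonneg_left h2 Ln))
    nlinarith [mul_nonneg Lt (sub_nonneg.2 h), mul_nonneg γp.le (sub_nonneg.2 h3)]
  · intro i
    have h1 : Continuous fun p : EE d × ℝ => b p.1 (cl N p.2) :=
      bs.continuous.comp (continuous_fst.prodMk ((cl_cont N).comp continuous_snd))
    exact ((cl_cont N).comp continuous_snd).mul ((EuclideanSpace.proj (𝕜 := ℝ) i).continuous.comp h1)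
  · intro i x
    simp [cl_eq (r := 0) (N := N) (by simpa using hN.le)]
  · intro i x r s
    have h1 := ci (b x (cl N r) - b x (cl N s)) i
    have h2 := blip x _ (clm r) _ (clm s)
    have h3 := (ci (b x (cl N r)) i).trans (hC0 _ _)
    have h4 := cl_sub N r s
    have h5 := cl_abs hN.le s
    have e : cl N r * b x (cl N r) i - cl N s * b x (cl N s) i = (cl N r - cl N s) * b x (cl N r) i + cl N s * (b x (cl N r) - b x (cl N s)) i := by
      simp; ring
    rw [e]
    refine (abs_add_le _ _).trans ?_
    rw [abs_mul, abs_mul]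
    have a1 : |cl N r - cl N s| * |b x (cl N r) i| ≤ |r - s| * C0 := mul_le_mul h4 h3 (abs_nonneg _) (abs_nonneg _)
    have a2 : |cl N s| * |(b x (cl N r) - b x (cl N s)) i| ≤ N * (C1 * |r - s|) :=
      mul_le_mul h5 (h1.trans (h2.trans (mul_le_mul_of_nonneg_left h4 C1n))) (abs_nonneg _) hN.le
    nlinarith [mul_nonneg (add_nonneg Ln γp.le) (abs_nonneg (r - s))]
  · intro i x y r
    have e : cl N r * b x (cl N r) i - cl N r * b y (cl N r) i = cl N r * (b x (cl N r) - b y (cl N r)) i := by simp; ring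
    rw [e, abs_mul]
    have h1 := (ci _ i).trans (bx x y (cl N r))
    refine (mul_le_mul (cl_le N hN.le r) h1 (abs_nonneg _) (abs_nonneg _)).trans (le_of_eq ?_)
    ring
  · intro r hr; simp [cl_eq hr]
  · intro i x r hr; simp [cl_eq hr]

end FP

namespace FP
set_option linter.unusedSectionVars false
set_option linter.unusedVariables false

open scoped InnerProductSpace Topology ContDiff
variable {d : ℕ}

lemma memLp_of_bdd {f : EE d → ℝ} (hf : Integrable f) {C : ℝ} (h : ∀ᵐ x, |f x| ≤ C) : MemLp f 2 volume := by
  rw [memLp_two_iff_integrable_sq hf.1]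
  simp_rw [sq]
  exact hf.mul_bdd hf.1 h

def Mt (β : ℝ → ℝ) (b : EE d → ℝ → EE d) (N : ℝ) (K : Coef d) : Prop :=
  (∀ r, |r| ≤ N → K.f r = β r) ∧ ∀ i x r, |r| ≤ N → K.B i x r = r * b x r i

lemma G_congr {β : ℝ → ℝ} {b : EE d → ℝ → EE d} {N N' : ℝ} {K K' : Coef d} (h : Mt β b N K) (h' : Mt β b N' K')
    {u : HR d} (hu : ∀ᵐ x, |u x| ≤ N) (hu' : ∀ᵐ x, |u x| ≤ N') (w : HR d) : K.dat.G u w = K'.dat.G u w := by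
  have e1 : nem (fun _ => K.f) u = nem (fun _ => K'.f) u := by
    refine Lp.ext ?_
    filter_upwards [K.fNL.coe u, K'.fNL.coe u, hu, hu'] with x h1 h2 h3 h4
    rw [h1, h2, h.1 _ h3, h'.1 _ h4]
  have e2 : ∀ i, nem (K.B i) u = nem (K'.B i) u := by
    intro i
    refine Lp.ext ?_
    filter_upwards [(K.BNL i).coe u, (K'.BNL i).coe u, hu, hu'] with x h1 h2 h3 h4
    rw [h1, h2, h.2 _ _ _ h3, h'.2 _ _ _ h4]
  have g : ∀ K : Coef d, K.dat.G u w = - ⟪nem (fun _ => K.f) u, w - Jop d w⟫_ℝ + ∑ i, ⟪nem (K.B i) u, Top i w⟫_ℝ := fun _ => rfl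
  rw [g, g, e1]
  simp_rw [e2]

lemma transfer {K K' : Coef d} {T T' : ℝ} {u0 : HR d} {U W : ℝ → HR d} (hU : K.dat.HSol T' u0 U) (hT : T ≤ T')
    (h : ∀ t ∈ Icc 0 T, W t = U t) (hG : ∀ t ∈ Icc 0 T, ∀ w, K.dat.G (U t) w = K'.dat.G (U t) w) : K'.dat.HSol T u0 W := by
  obtain ⟨⟨R, hR⟩, hm, he⟩ := hU
  refine ⟨⟨R, fun t ht => by rw [h t ht]; exact hR t ⟨ht.1, ht.2.trans hT⟩⟩, ?_, fun t ht ψ => ?_⟩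
  · refine (hm.mono_measure (Measure.restrict_mono (Ioc_subset_Ioc_right hT) le_rfl)).congr ?_
    filter_upwards [ae_restrict_mem measurableSet_Ioc] with s hs using (h s (Ioc_subset_Icc_self hs)).symm
  · rw [h t ht]
    refine (he t ⟨ht.1, ht.2.trans hT⟩ ψ).trans ?_
    change ⟪u0, K'.dat.J ψ⟫_ℝ + _ = _
    congr 1
    refine intervalIntegral.integral_congr fun s hs => ?_
    rw [uIcc_of_le ht.1] at hs
    have hs' : s ∈ Icc 0 T := ⟨hs.1, hs.2.trans ht.2⟩
    beta_reduce
    rw [h s hs', hG s hs']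

lemma exists_W {β : ℝ → ℝ} {γ0 : ℝ} {b : EE d → ℝ → EE d} (hβ : HypBeta β γ0) (hb : HypB b) {M : ℝ} (hM : 0 ≤ M) (u0 : HR d)
    (h0 : ∀ᵐ x, |u0 x| ≤ M) (hi : Integrable u0) : ∃ c : ℝ, 0 ≤ c ∧ ∃ W : ℝ → HR d,
      (∀ T, 0 ≤ T → ∀ N, M * Real.exp (c * T) ≤ N → ∀ K : Coef d, Mt β b N K → K.dat.HSol T u0 W) ∧
      (∀ t, 0 ≤ t → (∀ᵐ x, |W t x| ≤ M * Real.exp (c * t)) ∧ Integrable (W t) ∧ (∫ x, |W t x|) ≤ ∫ x, |u0 x|) ∧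
      ∀ T, 0 ≤ T → ∃ A, 0 ≤ A ∧ ∀ t ∈ Icc 0 T, ∀ s, 0 ≤ s → ∫ x, wt 0 s x * |W t x| ≤ (∫ x, wt 0 s x * |u0 x|) + A * (√s + s) := by
  obtain ⟨c, hc, hK⟩ := exists_coef hβ hb
  have hdc : 0 ≤ d * c := by positivity
  set N : ℕ → ℝ := fun n => M * Real.exp (d * c * n) + 1 with hN
  have Npos : ∀ n, 0 < N n := fun n => by positivity
  choose K hKc hKf hKB using fun n => hK (N n) (Npos n)
  choose U hU hUb using fun n => (K n).exists_sol hM u0 h0 hi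
  have Km : ∀ n, Mt β b (N n) (K n) := fun n => ⟨hKf n, hKB n⟩
  have emono : ∀ s t : ℝ, s ≤ t → M * Real.exp (d * c * s) ≤ M * Real.exp (d * c * t) := fun s t h =>
    mul_le_mul_of_nonneg_left (Real.exp_le_exp.2 (mul_le_mul_of_nonneg_left h hdc)) hM
  have Ub : ∀ n t, 0 ≤ t → ∀ᵐ x, |U n t x| ≤ M * Real.exp (d * c * t) := fun n t ht => by
    have := (hUb n t ht).1
    rwa [hKc] at this
  have trn : ∀ (n : ℕ) (T : ℝ), 0 ≤ T → T ≤ n → ∀ N', M * Real.exp (d * c * T) ≤ N' → ∀ K' : Coef d, Mt β b N' K' → ∀ W : ℝ → HR d,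
      (∀ t ∈ Icc 0 T, W t = U n t) → K'.dat.HSol T u0 W := by
    intro n T hT hn N' hN' K' hK' W hW
    refine transfer (hU n T hT) le_rfl hW fun t ht w => ?_
    refine G_congr (Km n) hK' ((Ub n t ht.1).mono fun x hx => hx.trans ?_) ((Ub n t ht.1).mono fun x hx => hx.trans ?_) w
    · simp only [hN]; linarith [emono t n (ht.2.trans hn)]
    · exact (emono t T ht.2).trans hN'
  have agree : ∀ m n : ℕ, m ≤ n → ∀ t : ℝ, 0 ≤ t → t ≤ m → U n t = U m t := by
    intro m n hmn t ht htm
    have hmn' : (m:ℝ) ≤ n := by exact_mod_cast hmn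
    have := trn n m (by positivity) hmn' (N m) (by simp only [hN]; linarith) (K m) (Km m) (U n) (fun _ _ => rfl)
    exact this.unique (hU m m (by positivity)) ⟨ht, htm⟩
  refine ⟨d * c, hdc, fun t => U ⌈t⌉₊ t, ?_, fun t ht => ⟨Ub _ t ht, (hUb _ t ht).2.1, (hUb _ t ht).2.2.1⟩, ?_⟩
  · intro T hT N' hN' K' hK'
    refine trn ⌈T⌉₊ T hT (Nat.le_ceil T) N' hN' K' hK' _ fun t ht => ?_
    exact (agree _ _ (Nat.ceil_mono ht.2) t ht.1 (Nat.le_ceil t)).symm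
  · intro T hT
    have i0 : 0 ≤ ∫ x, |u0 x| := integral_nonneg fun x => abs_nonneg _
    have c1 := (K ⌈T⌉₊).C1_nn
    refine ⟨(K ⌈T⌉₊).C1 * (∫ x, |u0 x|) * T, by positivity, fun t ht s hs => ?_⟩
    have e : U ⌈t⌉₊ t = U ⌈T⌉₊ t := (agree _ _ (Nat.ceil_mono ht.2) t ht.1 (Nat.le_ceil t)).symm
    beta_reduce
    rw [e]
    refine ((hUb ⌈T⌉₊ t ht.1).2.2.2 s hs).trans ?_
    have : (K ⌈T⌉₊).C1 * (√s + s) * (∫ x, |u0 x|) * t ≤ (K ⌈T⌉₊).C1 * (√s + s) * (∫ x, |u0 x|) * T :=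
      mul_le_mul_of_nonneg_left ht.2 (by positivity)
    linarith

end FP

namespace FP
set_option linter.unusedSectionVars false
set_option linter.unusedVariables false

open scoped InnerProductSpace Topology ContDiff
variable {d : ℕ}

lemma fderiv_sum (L : EE d →L[ℝ] ℝ) (w : EE d) : L w = ∑ i, w i * L (EuclideanSpace.single i 1) := by
  have : w = ∑ i, w i • EuclideanSpace.single i (1:ℝ) := by
    ext j
    simp [Finset.sum_apply, Pi.single_apply]
  conv_lhs => rw [this]
  rw [map_sum]
  simp

lemma sup_bound {β : ℝ → ℝ} {b : EE d → ℝ → EE d} {u0 : EE d → ℝ} {v : ℝ → EE d → ℝ} (hv : IsDistSol β b u0 v)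
    {T : ℝ} (hT : 0 < T) (h : BddLinfty (T + 1) v) : ∃ C, 0 ≤ C ∧ ∀ t ∈ Icc 0 T, ∀ᵐ x, |v t x| ≤ C := by
  obtain ⟨C, hC⟩ := h
  have hg := Measure.ae_ae_of_ae_prod hC
  rw [ae_restrict_iff' measurableSet_Ioo] at hg
  refine ⟨max C 0, le_max_right _ _, fun t ht => ?_⟩
  have fr : ∃ᶠ s in 𝓝[Ici 0] t, 0 ≤ s ∧ ∀ᵐ x, |v s x| ≤ C := by
    have hle : 𝓝[>] t ≤ 𝓝[Ici 0] t := nhdsWithin_mono _ fun s hs => ht.1.trans (le_of_lt hs)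
    refine Frequently.filter_mono ?_ hle
    intro hn
    obtain ⟨w, hw, hsub⟩ := (mem_nhdsGT_iff_exists_Ioo_subset).1 hn
    have hz : volume (Ioo t (min w (T + 1))) = 0 := by
      refine measure_mono_null ?_ (ae_iff.1 hg)
      intro s hs hc
      have hs0 : 0 < s := ht.1.trans_lt hs.1
      exact hsub ⟨hs.1, hs.2.trans_le (min_le_left _ _)⟩ ⟨hs0.le, hc ⟨hs0, hs.2.trans_le (min_le_right _ _)⟩⟩
    rw [Real.volume_Ioo, ENNReal.ofReal_eq_zero] at hz
    have : t < min w (T + 1) := lt_min hw (by linarith [ht.2])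
    linarith
  have hvt := hv.1 t ht.1
  have up : ∀ᵐ x, v t x ≤ C := by
    refine le_of_cpt hvt fun ψ hψ hψc ψn ψb => ?_
    refine le_of_tendsto_of_frequently (hv.2.1 ψ hψ ψb t ht.1) (fr.mono fun s hs => ?_)
    rw [← integral_const_mul]
    obtain ⟨c, hc⟩ := ψb
    refine integral_mono_ae ((hv.1 s hs.1).mul_bdd hψ.aestronglyMeasurable (Eventually.of_forall hc)) 
      ((hψ.integrable_of_hasCompactSupport hψc).const_mul C) ?_
    filter_upwards [hs.2] with x hx
    exact mul_le_mul_of_nonneg_right ((le_abs_self _).trans hx) (ψn x)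
  have dn : ∀ᵐ x, - v t x ≤ C := by
    refine le_of_cpt hvt.neg fun ψ hψ hψc ψn ψb => ?_
    have h1 := (hv.2.1 ψ hψ ψb t ht.1).neg
    have h2 : ∀ s, -∫ x, v s x * ψ x = ∫ x, -v s x * ψ x := fun s => by rw [← integral_neg]; simp
    simp_rw [h2] at h1
    refine le_of_tendsto_of_frequently h1 (fr.mono fun s hs => ?_)
    rw [← integral_const_mul]
    obtain ⟨c, hc⟩ := ψb
    refine integral_mono_ae ((hv.1 s hs.1).neg.mul_bdd hψ.aestronglyMeasurable (Eventually.of_forall hc)) 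
      ((hψ.integrable_of_hasCompactSupport hψc).const_mul C) ?_
    filter_upwards [hs.2] with x hx
    exact mul_le_mul_of_nonneg_right ((neg_le_abs _).trans hx) (ψn x)
  filter_upwards [up, dn] with x h1 h2
  exact (abs_le.2 ⟨by linarith, h1⟩).trans (le_max_left _ _)

lemma sol_HSol {β : ℝ → ℝ} {b : EE d → ℝ → EE d} {u0 : EE d → ℝ} {v : ℝ → EE d → ℝ} (hv : IsDistSol β b u0 v)
    {T : ℝ} (hT : 0 < T) (h1 : BddL1 (T + 1) v) (h : BddLinfty (T + 1) v) : ∃ C, 0 ≤ C ∧ (∀ t ∈ Icc 0 T, ∀ᵐ x, |v t x| ≤ C) ∧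
      ∀ N, C ≤ N → ∀ K : Coef d, Mt β b N K → K.dat.HSol T (ct u0) (fun t => ct (v t)) := by
  obtain ⟨C, hC0, hC⟩ := sup_bound hv hT h
  refine ⟨C, hC0, hC, fun N hN K hK => ?_⟩
  have mem : ∀ t ∈ Icc 0 T, MemLp (v t) 2 volume := fun t ht => memLp_of_bdd (hv.1 t ht.1) (hC t ht)
  obtain ⟨C1, hC1⟩ := h1
  have L1 : ∀ t ∈ Icc 0 T, ∫ x, |v t x| ≤ max C1 (∫ x, |v 0 x|) := by
    intro t ht
    rcases ht.1.eq_or_lt with rfl | h'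
    · exact le_max_right _ _
    · exact (hC1 t ⟨h', by linarith [ht.2]⟩).trans (le_max_left _ _)
  have nb : ∀ t ∈ Icc 0 T, ‖ct (v t)‖ ≤ √(C * max C1 (∫ x, |v 0 x|)) := by
    intro t ht
    refine Real.le_sqrt_of_sq_le ?_
    rw [normsq_ct (mem t ht)]
    refine le_trans ?_ (mul_le_mul_of_nonneg_left (L1 t ht) hC0)
    rw [← integral_const_mul]
    refine integral_mono_ae ((memLp_two_iff_integrable_sq (mem t ht).1).1 (mem t ht)) ((hv.1 t ht.1).abs.const_mul C) ?_
    filter_upwards [hC t ht] with x hx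
    rw [← sq_abs, sq]
    exact mul_le_mul_of_nonneg_right hx (abs_nonneg _)
  have ic : ∀ t ∈ Icc 0 T, ∀ ζ : EE d → ℝ, TF ζ → ⟪ct (v t), ct ζ⟫_ℝ = ∫ x, v t x * ζ x := by
    intro t ht ζ hζ
    rw [inner_ct hζ.memLp]
    refine integral_congr_ae ?_
    filter_upwards [ct_coe (mem t ht)] with x hx
    rw [hx]
  have e0 : ct u0 = ct (v 0) := by
    have h0 : MemLp (v 0) 2 volume := mem 0 ⟨le_rfl, hT.le⟩
    refine Lp.ext ?_
    filter_upwards [ct_coe h0, ct_coe (h0.ae_eq hv.2.2.2), hv.2.2.2] with x a1 a2 a3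
    rw [a1, a2, a3]
  rw [e0]
  refine HSol_of_weak K hT nb (fun e t ht => ?_) fun η hη hηc hηt ζ hζ => ?_
  · refine weak_tendsto ct_dense (eventually_nhdsWithin_of_forall nb) (nb t ht) ?_ e
    rintro _ ⟨ζ, hζ, rfl⟩
    rw [ic t ht ζ hζ]
    obtain ⟨c, hc⟩ := hζ.2.exists_bound_of_continuous hζ.1.continuous
    have := (hv.2.1 ζ hζ.1.continuous ⟨c, hc⟩ t ht.1).mono_left (nhdsWithin_mono t (Icc_subset_Ici_self (a := T)))
    refine this.congr' ?_
    filter_upwards [self_mem_nhdsWithin] with s hs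
    rw [ic s hs ζ hζ]
  · set φ : ℝ → EE d → ℝ := fun t x => η t * ζ x with hφ
    have ts : tsupport (Function.uncurry φ) ⊆ tsupport η ×ˢ tsupport ζ := by
      refine closure_minimal ?_ ((isClosed_tsupport _).prod (isClosed_tsupport _))
      rintro ⟨t, x⟩ hp
      have : η t * ζ x ≠ 0 := hp
      exact ⟨subset_tsupport _ (left_ne_zero_of_mul this), subset_tsupport _ (right_ne_zero_of_mul this)⟩
    have wk := hv.2.2.1 φ ((hη.comp contDiff_fst).mul (hζ.1.comp contDiff_snd))
      ((hηc.isCompact.prod hζ.2.isCompact).of_isClosed_subset (isClosed_tsupport _) ts) (fun p hp => (hηt (ts hp).1).1)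
    have ηd : Differentiable ℝ η := hη.differentiable (by simp)
    have ζd : Differentiable ℝ ζ := hζ.1.differentiable (by simp)
    have d1 : ∀ t x, deriv (fun s => φ s x) t = deriv η t * ζ x := fun t x => deriv_mul_const (ηd t) _
    have dz : ∀ t x, fderiv ℝ (φ t) x = η t • fderiv ℝ ζ x := fun t x => fderiv_const_mul (ζd x) _
    have dl : ∀ t x, lap (φ t) x = η t * lap ζ x := by
      intro t x
      simp only [lap, dz, _root_.smul_apply, smul_eq_mul]
      rw [Finset.mul_sum]
      refine Finset.sum_congr rfl fun i _ => ?_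
      have : DifferentiableAt ℝ (fun y => fderiv ℝ ζ y (EuclideanSpace.single i 1)) x :=
        (hζ.pd i).1.differentiable (by simp) x
      rw [fderiv_const_mul this]; rfl
    have out : ∀ t ∈ Ioi (0:ℝ) \ Ioc 0 T, (∫ x, (v t x * deriv (fun s => φ s x) t + β (v t x) * lap (φ t) x
        + v t x * fderiv ℝ (φ t) x (b x (v t x)))) = 0 := by
      rintro t ⟨ht0, htT⟩
      have hn : t ∉ tsupport η := fun hc => htT ⟨ht0, (hηt hc).2.le⟩
      have z1 : η t = 0 := image_eq_zero_of_notMem_tsupport hn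
      have z2 : deriv η t = 0 := image_eq_zero_of_notMem_tsupport fun hc => hn (tsupport_deriv_subset (𝕜 := ℝ) hc)
      simp [d1, dz, dl, z1, z2]
    rw [setIntegral_eq_of_subset_of_forall_sdiff_eq_zero measurableSet_Ioi Ioc_subset_Ioi_self out, ← intervalIntegral.integral_of_le hT.le] at wk
    refine Eq.trans ?_ wk
    refine intervalIntegral.integral_congr fun t ht => ?_
    rw [uIcc_of_le hT.le] at ht
    beta_reduce
    have i1 : Integrable fun x => ct (v t) x * ζ x := (Lp.memLp (ct (v t))).integrable_mul hζ.memLp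
    have i2 : Integrable fun x => (K.f (ct (v t) x) * lap ζ x + ∑ i, K.B i x (ct (v t) x) * pd i ζ x) :=
      (K.fNL.mul_int _ hζ.lap.memLp).add (integrable_finsetSum _ fun i _ => (K.BNL i).mul_int _ (hζ.pd i).memLp)
    rw [K.G_SS hζ, inner_ct hζ.memLp, ← integral_const_mul, ← integral_const_mul, ← integral_add (i1.const_mul _) (i2.const_mul _)]
    refine integral_congr_ae ?_
    filter_upwards [ct_coe (mem t ht), hC t ht] with x hx hb
    have hb' := hb.trans hN
    rw [hx, hK.1 _ hb', d1, dl, dz, _root_.smul_apply, smul_eq_mul, fderiv_sum (fderiv ℝ ζ x)]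
    simp_rw [hK.2 _ _ _ hb']
    have : ∑ i, v t x * b x (v t x) i * pd i ζ x = v t x * ∑ i, b x (v t x) i * fderiv ℝ ζ x (EuclideanSpace.single i 1) := by
      rw [Finset.mul_sum]
      refine Finset.sum_congr rfl fun i _ => ?_
      rw [mul_assoc]; rfl
    rw [this]
    ring

end FP

namespace FP
set_option linter.unusedSectionVars false
set_option linter.unusedVariables false

open scoped InnerProductSpace Topology ContDiff
variable {d : ℕ}

lemma wcont {K : Coef d} {T : ℝ} {u0 : HR d} {U : ℝ → HR d} (hT : 0 ≤ T) (hU : K.dat.HSol T u0 U) (e : HR d) :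
    ContinuousOn (fun t => ⟪U t, e⟫_ℝ) (Icc 0 T) := by
  obtain ⟨R, hR⟩ := hU.1
  intro t ht
  refine weak_tendsto (Jop_dense (d := d)) (eventually_nhdsWithin_of_forall hR) (hR t ht) ?_ e
  rintro _ ⟨ψ, rfl⟩
  have Pc : ContinuousOn (fun t => ∫ s in 0..t, K.dat.gt (U s)) (Icc 0 T) := by
    have := intervalIntegral.continuousOn_primitive_interval (μ := volume) (a := 0) (b := T)
      (f := fun s => K.dat.gt (U s)) (by
        rw [uIcc_of_le hT, integrableOn_Icc_iff_integrableOn_Ioc, ← intervalIntegrable_iff_integrableOn_Ioc_of_le hT]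
        exact hU.int ⟨hT, le_rfl⟩)
    rwa [uIcc_of_le hT] at this
  have h1 : ContinuousOn (fun t => ⟪K.dat.J u0 + ∫ s in 0..t, K.dat.gt (U s), ψ⟫_ℝ) (Icc 0 T) := ContinuousOn.inner (𝕜 := ℝ) (continuousOn_const.add Pc) continuousOn_const
  have h2 : ∀ t ∈ Icc 0 T, ⟪U t, Jop d ψ⟫_ℝ = ⟪K.dat.J u0 + ∫ s in 0..t, K.dat.gt (U s), ψ⟫_ℝ := fun t ht => by
    rw [← hU.J_eq ht, K.dat.Jsymm]; rfl
  rw [h2 t ht]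
  refine (h1 t ht).congr' ?_
  filter_upwards [self_mem_nhdsWithin] with s hs
  rw [h2 s hs]

lemma cut {s c : ℝ} (hs : 0 < s) {ψ : EE d → ℝ} (hψ : Continuous ψ) (hc : ∀ x, |ψ x| ≤ c) :
    ∃ e : HR d, ∀ u : HR d, Integrable u → |(∫ x, u x * ψ x) - ⟪u, e⟫_ℝ| ≤ 2 * c * ∫ x, wt 0 s x * |u x| := by
  set B : Set (EE d) := Metric.closedBall 0 (√s)⁻¹ with hB
  have Bm : MeasurableSet B := Metric.isClosed_closedBall.measurableSet
  have c0 : 0 ≤ c := (abs_nonneg _).trans (hc 0)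
  have mem : MemLp (B.indicator ψ) 2 volume := by
    rw [memLp_indicator_iff_restrict Bm]
    have : IsFiniteMeasure (volume.restrict B) := ⟨by rw [Measure.restrict_apply_univ]; exact (isCompact_closedBall _ _).measure_lt_top⟩
    exact MemLp.of_bound hψ.aestronglyMeasurable c (Eventually.of_forall hc)
  have ib : ∀ x, ‖B.indicator ψ x‖ ≤ c := fun x => by
    by_cases hx : x ∈ B
    · rw [indicator_of_mem hx]; exact hc x
    · rw [indicator_of_notMem hx]; simpa using c0
  refine ⟨ct (B.indicator ψ), fun u hu => ?_⟩
  have i1 : Integrable fun x => u x * ψ x := hu.mul_bdd hψ.aestronglyMeasurable (Eventually.of_forall hc)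
  have i2 : Integrable fun x => u x * B.indicator ψ x := hu.mul_bdd mem.1 (Eventually.of_forall ib)
  rw [inner_ct mem, ← integral_sub i1 i2, ← integral_const_mul]
  refine abs_integral_le_integral_abs.trans (integral_mono (i1.sub i2).abs ((wt_mul_int le_rfl hs.le hu).const_mul _) fun x => ?_)
  beta_reduce
  rw [← mul_sub, abs_mul]
  by_cases hx : x ∈ B
  · rw [indicator_of_mem hx, sub_self, abs_zero, mul_zero]
    have := wt_nn (le_refl (0:ℝ)) hs.le x
    positivity
  · rw [indicator_of_notMem hx, sub_zero]
    have h1 : (√s)⁻¹ < ‖x‖ := by simpa [hB] using hx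
    have hr : 0 < √s := Real.sqrt_pos.2 hs
    have h2 : 1 < √s * ‖x‖ := by rwa [inv_lt_iff_one_lt_mul₀ hr, mul_comm] at h1
    have h3 : 1 < s * ‖x‖ ^ 2 := by
      have : s * ‖x‖ ^ 2 = (√s * ‖x‖) ^ 2 := by rw [mul_pow, Real.sq_sqrt hs.le]
      rw [this]; exact one_lt_pow₀ h2 (by norm_num)
    have h4 : 1 ≤ 2 * wt 0 s x := by
      have : (1 + s * ‖x‖ ^ 2)⁻¹ ≤ 2⁻¹ := inv_anti₀ (by norm_num) (by linarith)
      unfold wt; linarith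
    have h5 : |ψ x| ≤ c * (2 * wt 0 s x) := (hc x).trans (le_mul_of_one_le_right c0 h4)
    calc |u x| * |ψ x| ≤ |u x| * (c * (2 * wt 0 s x)) := mul_le_mul_of_nonneg_left h5 (abs_nonneg _)
      _ = _ := by ring

lemma tail {u : EE d → ℝ} (hu : Integrable u) (A : ℝ) {ε : ℝ} (hε : 0 < ε) :
    ∃ s, 0 < s ∧ (∫ x, wt 0 s x * |u x|) + A * (√s + s) < ε := by
  have sl : Tendsto (fun n : ℕ => 1 / ((n:ℝ) + 1)) atTop (𝓝 0) := tendsto_one_div_add_atTop_nhds_zero_nat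
  have h1 : Tendsto (fun n : ℕ => ∫ x, wt 0 (1 / ((n:ℝ) + 1)) x * |u x|) atTop (𝓝 (∫ x : EE d, (0:ℝ))) := by
    refine tendsto_integral_of_dominated_convergence (fun x => |u x|) (fun n => (wt_mul_int le_rfl (by positivity) hu).1) hu.abs
      (fun n => Eventually.of_forall fun x => ?_) (Eventually.of_forall fun x => ?_)
    · have hp : (0:ℝ) ≤ 1 / ((n:ℝ) + 1) := by positivity
      rw [Real.norm_eq_abs, abs_mul, abs_abs, abs_of_nonneg (wt_nn le_rfl hp x)]
      exact mul_le_of_le_one_left (abs_nonneg _) ((wt_le hp x).trans (by norm_num))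
    · have : Tendsto (fun s : ℝ => wt 0 s x * |u x|) (𝓝 0) (𝓝 (wt 0 0 x * |u x|)) := by
        refine ContinuousAt.tendsto ?_
        unfold wt
        refine ContinuousAt.mul (continuousAt_const.add (continuousAt_const.sub (ContinuousAt.inv₀ (by fun_prop) (by simp)))) continuousAt_const
      have e : wt 0 0 x * |u x| = 0 := by simp [wt]
      rw [e] at this
      exact this.comp sl
  have h2 : Tendsto (fun n : ℕ => A * (√(1 / ((n:ℝ) + 1)) + 1 / ((n:ℝ) + 1))) atTop (𝓝 (A * (√0 + 0))) :=
    ((((Real.continuous_sqrt.tendsto 0).comp sl).add sl).const_mul A)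
  have h3 := h1.add h2
  simp only [integral_zero, Real.sqrt_zero, add_zero, mul_zero] at h3
  obtain ⟨n, hn⟩ := (h3.eventually (gt_mem_nhds hε)).exists
  exact ⟨1 / ((n:ℝ) + 1), by positivity, hn⟩

lemma narrow {u0 : HR d} (hi : Integrable u0) {T A : ℝ} {W : ℝ → HR d} (hW : ∀ t ∈ Icc 0 T, Integrable (W t))
    (hc : ∀ e, ContinuousOn (fun t => ⟪W t, e⟫_ℝ) (Icc 0 T))
    (hA : ∀ t ∈ Icc 0 T, ∀ s, 0 ≤ s → ∫ x, wt 0 s x * |W t x| ≤ (∫ x, wt 0 s x * |u0 x|) + A * (√s + s))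
    {ψ : EE d → ℝ} (hψ : Continuous ψ) {c : ℝ} (hb : ∀ x, |ψ x| ≤ c) : ContinuousOn (fun t => ∫ x, W t x * ψ x) (Icc 0 T) := by
  have c0 : 0 ≤ c := (abs_nonneg _).trans (hb 0)
  intro t ht
  rw [ContinuousWithinAt, Metric.tendsto_nhds]
  intro ε hε
  obtain ⟨s, hs, hlt⟩ := tail hi A (ε := ε / (3 * (2 * c + 1))) (by positivity)
  obtain ⟨e, he⟩ := cut hs hψ hb
  have bd : ∀ t ∈ Icc 0 T, |(∫ x, W t x * ψ x) - ⟪W t, e⟫_ℝ| ≤ ε / 3 := by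
    intro t ht
    refine (he _ (hW t ht)).trans ?_
    have h1 := (hA t ht s hs.le).trans hlt.le
    calc 2 * c * ∫ x, wt 0 s x * |W t x| ≤ 2 * c * (ε / (3 * (2 * c + 1))) := mul_le_mul_of_nonneg_left h1 (by positivity)
      _ ≤ (2 * c + 1) * (ε / (3 * (2 * c + 1))) := mul_le_mul_of_nonneg_right (by linarith) (by positivity)
      _ = ε / 3 := by field_simp
  filter_upwards [Metric.tendsto_nhds.1 (hc e t ht) (ε / 3) (by positivity), self_mem_nhdsWithin] with r hr hr'
  rw [Real.dist_eq] at hr ⊢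
  have h1 := abs_le.1 (bd r hr')
  have h2 := abs_le.1 (bd t ht)
  have h3 := abs_lt.1 hr
  rw [abs_lt]
  constructor <;> linarith [h1.1, h1.2, h2.1, h2.2, h3.1, h3.2]

lemma weakform {β : ℝ → ℝ} {b : EE d → ℝ → EE d} {u0 : HR d} {W : ℝ → HR d} {u : ℝ → EE d → ℝ} {φ : ℝ → EE d → ℝ}
    (h1 : ContDiff ℝ ∞ (Function.uncurry φ)) (h2 : HasCompactSupport (Function.uncurry φ))
    (h3 : ∀ p ∈ tsupport (Function.uncurry φ), 0 < p.1) (hu : ∀ t, 0 ≤ t → u t =ᵐ[volume] W t)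
    (H : ∀ T, 0 ≤ T → ∃ K : Coef d, K.dat.HSol T u0 W ∧ ∀ t ∈ Icc 0 T, ∀ᵐ x, K.f (W t x) = β (W t x) ∧ ∀ i, K.B i x (W t x) = W t x * b x (W t x) i) :
    (∫ t in Ioi (0 : ℝ), ∫ x, (u t x * deriv (fun s => φ s x) t + β (u t x) * lap (φ t) x
        + u t x * fderiv ℝ (φ t) x (b x (u t x)))) = 0 := by
  obtain ⟨C, hC⟩ := h2.isCompact.exists_bound_of_continuousOn (f := fun p : ℝ × EE d => p.1) continuous_fst.continuousOn
  set T := max C 0 + 1 with hT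
  have T0 : 0 ≤ T := by positivity
  have ltT : ∀ p ∈ tsupport (Function.uncurry φ), p.1 < T := fun p hp => by
    have := (le_abs_self _).trans (hC p hp)
    linarith [le_max_left C 0]
  obtain ⟨K, hK, hm⟩ := H T T0
  have wk := K.weak T0 hK (Φ := Function.uncurry φ) ⟨h1, h2⟩ (fun p hp => ⟨h3 p hp, ltT p hp⟩)
  have out : ∀ t ∈ Ioi (0:ℝ) \ Ioc 0 T, (∫ x, (u t x * deriv (fun s => φ s x) t + β (u t x) * lap (φ t) x
        + u t x * fderiv ℝ (φ t) x (b x (u t x)))) = 0 := by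
    rintro t ⟨ht0, htT⟩
    have hlt : T < t := by
      by_contra hc; exact htT ⟨ht0, not_lt.1 hc⟩
    have z : ∀ s, T < s → ∀ x, φ s x = 0 := fun s hs x =>
      image_eq_zero_of_notMem_tsupport (f := Function.uncurry φ) (x := (s, x)) fun hc => by linarith [ltT _ hc]
    have z1 : φ t = fun _ => 0 := funext (z t hlt)
    have z2 : ∀ x, deriv (fun s => φ s x) t = 0 := fun x => by
      have : (fun s => φ s x) =ᶠ[𝓝 t] fun _ => (0:ℝ) := by
        filter_upwards [lt_mem_nhds hlt] with s hs using z s hs x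
      rw [this.deriv_eq]; simp
    simp [z1, z2, lap]
  rw [setIntegral_eq_of_subset_of_forall_sdiff_eq_zero measurableSet_Ioi Ioc_subset_Ioi_self out, ← intervalIntegral.integral_of_le T0]
  refine Eq.trans ?_ wk
  refine intervalIntegral.integral_congr fun t ht => ?_
  rw [uIcc_of_le T0] at ht
  beta_reduce
  refine integral_congr_ae ?_
  filter_upwards [hu t ht.1, hm t ht] with x hx hb
  rw [hx, hb.1, fderiv_sum (fderiv ℝ (φ t) x), Finset.mul_sum]
  simp_rw [hb.2]
  congr 1
  refine Finset.sum_congr rfl fun i _ => ?_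
  rw [mul_assoc]; rfl

theorem main {β : ℝ → ℝ} {γ0 : ℝ} (hβ : HypBeta β γ0) {b : EE d → ℝ → EE d} (hb : HypB b) {u0 : EE d → ℝ}
    (h1 : Integrable u0) (h2 : ∃ C, ∀ᵐ x, |u0 x| ≤ C) :
    ∃ u : ℝ → EE d → ℝ, (IsDistSol β b u0 u ∧ ∀ T : ℝ, 0 < T → BddL1 T u ∧ BddLinfty T u) ∧
      ∀ v : ℝ → EE d → ℝ, (IsDistSol β b u0 v ∧ ∀ T : ℝ, 0 < T → BddL1 T v ∧ BddLinfty T v) →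
        ∀ t : ℝ, 0 ≤ t → v t =ᵐ[volume] u t := by
  obtain ⟨M', hM'⟩ := h2
  set M := max M' 0 with hMd
  have M0 : 0 ≤ M := le_max_right _ _
  have hM : ∀ᵐ x, |u0 x| ≤ M := hM'.mono fun x hx => hx.trans (le_max_left _ _)
  have mem := memLp_of_bdd h1 hM
  have ce := ct_coe mem
  have ci : Integrable (ct u0) := h1.congr ce.symm
  obtain ⟨c, c0, W, hsol, hW, hA⟩ := exists_W hβ hb M0 (ct u0) (by filter_upwards [ce, hM] with x a1 a2; rwa [a1]) ci
  obtain ⟨c', -, hcoef⟩ := exists_coef hβ hb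
  have emono : ∀ s t : ℝ, s ≤ t → M * Real.exp (c * s) ≤ M * Real.exp (c * t) := fun s t h =>
    mul_le_mul_of_nonneg_left (Real.exp_le_exp.2 (mul_le_mul_of_nonneg_left h c0)) M0
  have ex : ∀ T, 0 ≤ T → ∃ K : Coef d, K.dat.HSol T (ct u0) W ∧ Mt β b (M * Real.exp (c * T) + 1) K := by
    intro T hT
    obtain ⟨K, -, hK⟩ := hcoef (M * Real.exp (c * T) + 1) (by positivity)
    exact ⟨K, hsol T hT _ (by linarith) K hK, hK⟩
  set u : ℝ → EE d → ℝ := fun t x => cl (M * Real.exp (c * t)) (W t x) with hu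
  have ue : ∀ t, 0 ≤ t → u t =ᵐ[volume] W t := fun t ht => (hW t ht).1.mono fun x hx => cl_eq hx
  refine ⟨u, ⟨⟨fun t ht => (hW t ht).2.1.congr (ue t ht).symm, ?_, ?_, ?_⟩, fun T hT => ⟨⟨∫ x, |ct u0 x|, fun t ht => ?_⟩,
    ⟨M * Real.exp (c * T), ?_⟩⟩⟩, ?_⟩
  · rintro ψ hψ ⟨C, hC⟩ s hs
    obtain ⟨K, hK, -⟩ := ex (s + 1) (by linarith)
    obtain ⟨A, -, hA⟩ := hA (s + 1) (by linarith)
    have h3 := narrow ci (fun t ht => (hW t ht.1).2.1) (wcont (by linarith) hK) hA hψ hC s ⟨hs, by linarith⟩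
    have h4 : 𝓝[Ici 0] s = 𝓝[Icc 0 (s + 1)] s := by
      rw [← Ici_inter_Iic, inter_comm, nhdsWithin_inter_of_mem (nhdsWithin_le_nhds (Iic_mem_nhds (lt_add_one s)))]
    have e : ∀ t, 0 ≤ t → ∫ x, W t x * ψ x = ∫ x, u t x * ψ x := fun t ht =>
      integral_congr_ae ((ue t ht).mono fun x hx => by beta_reduce; rw [hx])
    rw [h4, ← e s hs]
    refine h3.congr' ?_
    filter_upwards [self_mem_nhdsWithin] with t ht using e t ht.1
  · intro φ p1 p2 p3
    refine weakform (u0 := ct u0) p1 p2 p3 ue fun T hT => ?_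
    obtain ⟨K, hK, hm⟩ := ex T hT
    refine ⟨K, hK, fun t ht => ?_⟩
    filter_upwards [(hW t ht.1).1] with x hx
    have hx' : |W t x| ≤ M * Real.exp (c * T) + 1 := by linarith [emono t T ht.2]
    exact ⟨hm.1 _ hx', fun i => hm.2 i x _ hx'⟩
  · obtain ⟨K, hK, -⟩ := ex 0 le_rfl
    have h3 := hK.J_eq (t := 0) ⟨le_rfl, le_rfl⟩
    rw [intervalIntegral.integral_same, add_zero, ← sub_eq_zero, ← map_sub] at h3
    have h4 := sub_eq_zero.1 (K.dat.Jinj h3)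
    refine (ue 0 le_rfl).trans ?_
    rw [h4]; exact ce
  · rw [integral_congr_ae ((ue t ht.1.le).mono fun x hx => (by beta_reduce; rw [hx] : |u t x| = |W t x|))]
    exact (hW t ht.1.le).2.2
  · have : ∀ᵐ p ∂((volume.restrict (Ioo 0 T)).prod (volume : Measure (EE d))), p.1 ∈ Ioo 0 T :=
      Measure.quasiMeasurePreserving_fst.ae (ae_restrict_mem measurableSet_Ioo)
    filter_upwards [this] with p hp
    exact (cl_abs (by positivity) _).trans (emono _ _ hp.2.le)
  · rintro v ⟨hv, hvb⟩ t ht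
    have T0 : 0 < t + 1 := by linarith
    obtain ⟨b1, b2⟩ := hvb (t + 1 + 1) (by linarith)
    obtain ⟨C, C0, hC, hvs⟩ := sol_HSol hv T0 b1 b2
    obtain ⟨K, -, hK⟩ := hcoef (C + M * Real.exp (c * (t + 1)) + 1) (by positivity)
    have tm : t ∈ Icc 0 (t + 1) := ⟨ht, by linarith⟩
    have p1 : 0 ≤ M * Real.exp (c * (t + 1)) := by positivity
    have e := (hvs _ (by linarith) K hK).unique (hsol (t + 1) T0.le _ (by linarith) K hK) tm
    have m := ct_coe (memLp_of_bdd (hv.1 t ht) (hC t tm))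
    have e' : ct (v t) = W t := e
    rw [e'] at m
    exact m.symm.trans (ue t ht).symm

end FP

/-- Theorem 2.3: under hypotheses (i)–(iii), for every
`u0 ∈ L¹ ∩ L^∞` the nonlinear Fokker–Planck equation
`∂_t u − Δβ(u) + div(b(x,u)u) = 0`, `u(0) = u0`, has exactly one distributional solution
lying in `L^∞((0,T); L¹) ∩ L^∞((0,T) × ℝ^d)` for every `T > 0`. -/
theorem fokker_planck_existence_uniqueness
    {d : ℕ} (hd : 1 ≤ d)
    (β : ℝ → ℝ) (γ0 : ℝ) (hβ : HypBeta β γ0)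
    (b : EuclideanSpace ℝ (Fin d) → ℝ → EuclideanSpace ℝ (Fin d)) (hb : HypB b)
    (hΦ : HypPhi β)
    (u0 : EuclideanSpace ℝ (Fin d) → ℝ)
    (hu0L1 : Integrable u0) (hu0Linf : ∃ C, ∀ᵐ x, |u0 x| ≤ C) :
    ∃ u : ℝ → EuclideanSpace ℝ (Fin d) → ℝ,
      (IsDistSol β b u0 u ∧ ∀ T : ℝ, 0 < T → BddL1 T u ∧ BddLinfty T u) ∧
      ∀ v : ℝ → EuclideanSpace ℝ (Fin d) → ℝ,
        (IsDistSol β b u0 v ∧ ∀ T : ℝ, 0 < T → BddL1 T v ∧ BddLinfty T v) →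
        ∀ t : ℝ, 0 ≤ t → v t =ᵐ[volume] u t := by
  exact FP.main hβ hb hu0L1 hu0Linf

end
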